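/- arXiv:1809.10957 — 2 statements merged into one kernel-verified Lean document; each statement's English description precedes it below -/
import Mathlib

section
/- Let H/K and H'/K' be genetic subquotients for the same 𝕂G-irrep ψ. Then |H| = |H'| and |K| = |K'|. Furthermore, the index satisfies |G : H| ≤ |K|. -/
open scoped Classical

noncomputable section

namespace Genotype

variable {k : Type} [Field k] {G : Type} [Group G]

/-- The subfield generated (over the prime field `ℚ`) by the values of a function,
e.g. the field `ℚ[ψ]` generated by the values of a character. -/
def charField {X : Type} {k : Type} [Field k] (f : X → k) : Subfield k :=
  Subfield.closure (Set.range f)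

theorem mem_charField {X : Type} {k : Type} [Field k] (f : X → k) (x : X) :
    f x ∈ charField f :=
  Subfield.subset_closure ⟨x, rfl⟩

/-- Two functions (typically characters of irreps over possibly different
characteristic-zero fields) are Galois conjugate: there is a Galois extension `M` of `ℚ`
containing (copies of) all their values and a field automorphism `α` of `M` with
`α (f g) = f' g` for all `g`. -/
def IsGaloisConj {k l : Type} [Field k] [Field l] {G : Type}
    (f : G → k) (f' : G → l) : Prop :=
  ∃ (M : Type) (_ : Field M) (_ : Algebra ℚ M), IsGalois ℚ M ∧
    ∃ (i : charField f →+* M) (j : charField f' →+* M) (α : M ≃+* M),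
      ∀ g : G, α (i ⟨f g, mem_charField f g⟩) = j ⟨f' g, mem_charField f' g⟩

/-- Irreducibility of a finite-dimensional representation. -/
def IsIrr (V : FDRep k G) : Prop :=
  Nontrivial V ∧
    ∀ U : Submodule k V, (∀ g : G, ∀ x ∈ U, V.ρ g x ∈ U) → U = ⊥ ∨ U = ⊤

/-- Faithfulness of a representation. -/
def IsFaithfulRep (V : FDRep k G) : Prop := Function.Injective V.ρ

/-- `f` (the character of an irrep) occurs in the character `c`,
i.e. `c = f + (character of some representation)`. -/
def CharOccurs (f c : G → k) : Prop :=
  ∃ W : FDRep k G, c = f + W.character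

/-- `f` (the character of an irrep) occurs in `c` with multiplicity exactly `m`. -/
def CharMult (f c : G → k) (m : ℕ) : Prop :=
  ∃ W : FDRep k G, c = m • f + W.character ∧ ¬ CharOccurs f W.character

/-- `f` is the character of an irreducible representation. -/
def IsIrrChar (f : G → k) : Prop := ∃ V : FDRep k G, IsIrr V ∧ f = V.character

/-- Restriction of a character to a subgroup. -/
def resChar (H : Subgroup G) (c : G → k) : H → k := fun h => c h

/-- The induced character `ind_H^G f`. -/
def indChar (H : Subgroup G) (f : H → k) : G → k := fun g =>
  (Nat.card H : k)⁻¹ *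
    ∑ᶠ x : G, if h : x⁻¹ * g * x ∈ H then f ⟨x⁻¹ * g * x, h⟩ else 0

/-- The character `cψ` (of a `kG`-irrep) is tightly induced from the character `cφ`
(of a `kH`-irrep): `cψ` is the induced character of `cφ`, `cφ` occurs with multiplicity
exactly `1` in the restriction of `cψ`, and no Galois conjugate of `cφ` other than `cφ`
itself occurs in the restriction of `cψ`. -/
def TightInd (H : Subgroup G) (cψ : G → k) (cφ : H → k) : Prop :=
  cψ = indChar H cφ ∧ CharMult cφ (resChar H cψ) 1 ∧
    ∀ cφ' : H → k, IsIrrChar cφ' → IsGaloisConj cφ cφ' →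
      CharOccurs cφ' (resChar H cψ) → cφ' = cφ

/-- Tight induction from a subquotient `H/K` of `G`: tight induction from `H`
of the inflation. -/
def TightIndSub (H : Subgroup G) (K : Subgroup H) [K.Normal]
    (cψ : G → k) (cφ : (H ⧸ K) → k) : Prop :=
  TightInd H cψ (fun h => cφ (QuotientGroup.mk h))

/-- A group is Roquette if every normal abelian subgroup of it is cyclic. -/
def IsRoquette (P : Type) [Group P] : Prop :=
  ∀ A : Subgroup P, A.Normal → (∀ x ∈ A, ∀ y ∈ A, x * y = y * x) → IsCyclic A

/-- `χ` is the rational form `ψ_ℚ` of `V`: a rational irrep such that `V` occurs in the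
scalar extension `k ⊗_ℚ χ`. -/
def IsRatForm [CharZero k] (χ : FDRep ℚ G) (V : FDRep k G) : Prop :=
  IsIrr χ ∧ CharOccurs V.character (fun g => algebraMap ℚ k (χ.character g))

/-- Irreps over possibly different characteristic-zero fields are quasiconjugate if they
determine the same rational irrep. -/
def Quasiconj {k l : Type} [Field k] [Field l] [CharZero k] [CharZero l] {G : Type} [Group G]
    (V : FDRep k G) (W : FDRep l G) : Prop :=
  ∃ χ : FDRep ℚ G, IsRatForm χ V ∧ IsRatForm χ W

end Genotype

namespace Genotype

theorem pow_formula {P : Type} [Group P] (g x t : P) (hx : x * g * x⁻¹ = g * t)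
    (htx : x * t = t * x) (htg : g * t = t * g) (i : ℤ) (m : ℕ) :
    (g ^ i * x) ^ m = g ^ (i * m) * t ^ (i * (m * (m - 1) / 2 : ℕ)) * x ^ m := by
  have hc : Commute g t := htg
  have h1 : ∀ j : ℤ, x * g ^ j = g ^ j * t ^ j * x := by
    intro j
    have : x * g ^ j * x⁻¹ = g ^ j * t ^ j := by
      rw [← conj_zpow, hx, hc.mul_zpow]
    rw [← this]; group
  have hct : Commute x t := htx
  have h2 : ∀ (n : ℕ) (j : ℤ), x ^ n * g ^ j = g ^ j * t ^ (j * n) * x ^ n := by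
    intro n
    induction n with
    | zero => intro j; simp
    | succ n ih =>
      intro j
      have e1 : x * t ^ (j * (n:ℤ)) = t ^ (j * (n:ℤ)) * x := (hct.zpow_right _)
      calc x ^ (n+1) * g ^ j = x * (x ^ n * g ^ j) := by rw [pow_succ']; group
        _ = (x * g ^ j) * t ^ (j * (n:ℤ)) * x ^ n := by rw [ih]; group
        _ = g ^ j * t ^ j * (x * t ^ (j * (n:ℤ))) * x ^ n := by rw [h1]; group
        _ = g ^ j * (t ^ j * t ^ (j * (n:ℤ))) * x ^ (n+1) := by rw [e1, pow_succ']; group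
        _ = _ := by rw [← zpow_add]; push_cast; ring_nf
  induction m with
  | zero => simp
  | succ m ih =>
    have e2 : t ^ (i * ((m * (m - 1) / 2 : ℕ) : ℤ)) * g ^ i = g ^ i * t ^ (i * ((m * (m - 1) / 2 : ℕ) : ℤ)) :=
      ((hc.zpow_zpow _ _).symm)
    have e3 : (m + 1) * (m + 1 - 1) / 2 = m * (m - 1) / 2 + m := by
      rw [← Finset.sum_range_id_mul_two (m+1) |> fun h => (Nat.div_eq_of_eq_mul_left two_pos h.symm).symm, ← Finset.sum_range_id_mul_two m |> fun h => (Nat.div_eq_of_eq_mul_left two_pos h.symm).symm, Finset.sum_range_succ]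
    calc (g ^ i * x) ^ (m+1) = (g ^ i * x) ^ m * (g ^ i * x) := pow_succ _ _
      _ = g ^ (i * m) * t ^ (i * (m * (m - 1) / 2 : ℕ)) * (x ^ m * g ^ i) * x := by rw [ih]; group
      _ = g ^ (i * m) * (t ^ (i * (m * (m - 1) / 2 : ℕ)) * g ^ i) * t ^ (i * m) * (x ^ m * x) := by
          rw [h2]; group
      _ = (g ^ (i * m) * g ^ i) * (t ^ (i * (m * (m - 1) / 2 : ℕ)) * t ^ (i * m)) * (x ^ m * x) := by
          rw [e2]; group
      _ = _ := by
          rw [← zpow_add, ← zpow_add, ← pow_succ, e3]; push_cast; ring_nf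

/-- no Klein-type normal subgroup in a Roquette group -/
theorem no_klein {P : Type} [Group P] [Finite P] (p : ℕ) (hp : p.Prime) (hR : IsRoquette P)
    (z y : P) (hz1 : z ≠ 1) (hzp : z ^ p = 1) (hyp : y ^ p = 1) (hcz : ∀ x, x * z = z * x)
    (hn : ∀ h : P, ∃ c ∈ Subgroup.zpowers z, h * y * h⁻¹ = c * y) : y ∈ Subgroup.zpowers z := by
  set V := Subgroup.closure ({z, y} : Set P) with hV
  have hzV : z ∈ V := Subgroup.subset_closure (by simp)
  have hyV : y ∈ V := Subgroup.subset_closure (by simp)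
  have hnorm : V.Normal := by
    refine ⟨fun v hv g => ?_⟩
    refine Subgroup.closure_induction (p := fun v _ => g * v * g⁻¹ ∈ V) ?_ ?_ ?_ ?_ hv
    · rintro x (rfl | rfl)
      · rw [hcz g]; simpa using hzV
      · obtain ⟨c, hc, e⟩ := hn g
        rw [e]
        exact V.mul_mem ((Subgroup.zpowers_le.2 hzV) hc) hyV
    · simp
    · intro a b _ _ ha hb
      have := V.mul_mem ha hb
      simpa [mul_assoc] using this
    · intro a _ ha
      have := V.inv_mem ha
      simpa [mul_assoc] using this
  have hcomm : ∀ a ∈ V, ∀ b ∈ V, a * b = b * a := by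
    intro a ha b hb
    refine Subgroup.closure_induction₂ (p := fun a b _ _ => a * b = b * a) ?_ ?_ ?_ ?_ ?_ ?_ ?_ ha hb
    · rintro a b (rfl | rfl) (rfl | rfl)
      · rfl
      · exact (hcz _).symm
      · exact hcz _
      · rfl
    · simp
    · simp
    · intro x y z _ _ _ h1 h2
      exact (Commute.mul_left (show Commute x z from h1) h2)
    · intro x y z _ _ _ h1 h2
      exact (Commute.mul_right (show Commute z x from h1) h2)
    · intro x y _ _ h
      exact (Commute.inv_left (show Commute x y from h))
    · intro x y _ _ h
      exact (Commute.inv_right (show Commute x y from h))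
  have hexp : ∀ v ∈ V, v ^ p = 1 := by
    intro v hv
    refine Subgroup.closure_induction (p := fun v _ => v ^ p = 1) ?_ ?_ ?_ ?_ hv
    · rintro x (rfl | rfl) <;> assumption
    · simp
    · intro a b ha hb h1 h2
      rw [Commute.mul_pow (hcomm a ha b hb), h1, h2, one_mul]
    · intro a _ h; rw [inv_pow, h, inv_one]
  have := hR V hnorm hcomm
  obtain ⟨⟨v, hv⟩, hgen⟩ := IsCyclic.exists_generator (α := V)
  have hgen' : ∀ w ∈ V, w ∈ Subgroup.zpowers v := by
    intro w hw
    obtain ⟨i, hi⟩ := hgen ⟨w, hw⟩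
    exact ⟨i, by simpa using congrArg Subtype.val hi⟩
  have := Fact.mk hp
  have hoz : orderOf z = p := orderOf_eq_prime hzp hz1
  have hvp : orderOf v = p := by
    apply orderOf_eq_prime (hexp v hv)
    rintro rfl
    have := hgen' z hzV
    simp at this
    exact hz1 this
  have : Subgroup.zpowers z = Subgroup.zpowers v := by
    apply Subgroup.eq_of_le_of_card_ge
    · exact Subgroup.zpowers_le.2 (hgen' z hzV)
    · rw [Nat.card_zpowers, Nat.card_zpowers, hoz, hvp]
  rw [this]
  exact hgen' y hyV

end Genotype

namespace Genotype

theorem mem_z {P : Type} [Group P] (p : ℕ) (hp : p.Prime) (g : P) (n : ℕ) (hn : 1 ≤ n)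
    (hg : orderOf g = p ^ n) (w : P) (hw : w ∈ Subgroup.zpowers g) (hwp : w ^ p = 1) :
    w ∈ Subgroup.zpowers (g ^ (p ^ (n - 1))) := by
  obtain ⟨i, rfl⟩ := hw
  simp only at hwp
  rw [← zpow_natCast, ← zpow_mul, ← orderOf_dvd_iff_zpow_eq_one, hg] at hwp
  obtain ⟨m, rfl⟩ : ∃ m, n = m + 1 := ⟨n - 1, by omega⟩
  rw [pow_succ] at hwp
  push_cast at hwp
  have hp0 : (p : ℤ) ≠ 0 := by exact_mod_cast hp.ne_zero
  obtain ⟨j, hj⟩ := Int.dvd_of_mul_dvd_mul_right hp0 hwp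
  refine ⟨j, ?_⟩
  simp only [Nat.add_sub_cancel]
  rw [← zpow_natCast, ← zpow_mul, hj]
  push_cast; rfl

theorem KL {P : Type} [Group P] [Finite P] (p : ℕ) (hp : p.Prime) (hR : IsRoquette P)
    (A : Subgroup P) (hA : A.Normal) (g : P) (hgA : g ∈ A) (hgen : ∀ y ∈ A, y ∈ Subgroup.zpowers g)
    (hsc : ∀ x, x * g = g * x → x ∈ A) (n : ℕ) (hg : orderOf g = p ^ n) (hn1 : 1 ≤ n)
    (hn : p ≠ 2 ∨ (p = 2 ∧ 3 ≤ n)) (hcz : ∀ x, x * g ^ (p ^ (n-1)) = g ^ (p ^ (n-1)) * x)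
    (x : P) (hx : x * g ^ p = g ^ p * x) : x ∈ A := by
  by_contra hxA
  have hone : ∀ i : ℤ, g ^ i = 1 ↔ ((p : ℤ) ^ n ∣ i) := by
    intro i; rw [← orderOf_dvd_iff_zpow_eq_one, hg]; push_cast; rfl
  have hmul : ∀ i : ℤ, g ^ i ∈ A := fun i => A.zpow_mem hgA i
  have hconj : ∀ h : P, ∃ u : ℤ, h * g * h⁻¹ = g ^ u := by
    intro h
    obtain ⟨u, hu⟩ := hgen _ (hA.conj_mem g hgA h)
    exact ⟨u, hu.symm⟩
  set z := g ^ (p ^ (n-1)) with hz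
  have hz1 : z ≠ 1 := by
    intro h
    have := orderOf_dvd_of_pow_eq_one h
    rw [hg] at this
    have := (Nat.pow_dvd_pow_iff_le_right hp.one_lt).1 this
    omega
  have hzp : z ^ p = 1 := by
    rw [hz, ← pow_mul, ← pow_succ, Nat.sub_add_cancel hn1, ← hg, pow_orderOf_eq_one]
  have hzA : Subgroup.zpowers z ≤ A := Subgroup.zpowers_le.2 (A.pow_mem hgA _)
  obtain ⟨u, hu⟩ := hconj x
  set t := g ^ (u - 1) with ht
  have hxt : x * g * x⁻¹ = g * t := by rw [hu, ht, ← zpow_one_add]; ring_nf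
  have htp : t ^ p = 1 := by
    have e1 : x * g ^ p * x⁻¹ = g ^ p := by rw [hx]; group
    rw [← conj_pow, hu] at e1
    rw [ht, ← zpow_natCast, ← zpow_mul, sub_mul, zpow_sub, one_mul, zpow_mul, zpow_natCast, zpow_natCast, e1]
    group
  have htz : t ∈ Subgroup.zpowers z := mem_z p hp g n hn1 hg t ⟨u-1, rfl⟩ htp
  have htc : ∀ h, h * t = t * h := by
    intro h
    obtain ⟨j, hj⟩ := htz
    rw [← hj]
    exact (show Commute h z from hcz h).zpow_right j
  have ht1 : t ≠ 1 := by
    intro h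
    apply hxA
    apply hsc
    rw [h, mul_one] at hxt
    exact mul_inv_eq_iff_eq_mul.1 hxt
  have F := fun (y : P) (hy : y * g * y⁻¹ = g * t) => pow_formula g y t hy (htc y) (htc g)
  have := Fact.mk hp
  have hot : orderOf t = p := orderOf_eq_prime htp ht1
  have htone : ∀ i : ℤ, t ^ i = 1 ↔ ((p : ℤ) ∣ i) := by
    intro i; rw [← orderOf_dvd_iff_zpow_eq_one, hot]
  -- x^p in A
  have hxpA : x ^ p ∈ A := by
    apply hsc
    have h2 : ∀ m : ℕ, x ^ m * g * (x ^ m)⁻¹ = g * t ^ m := by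
      intro m
      induction m with
      | zero => simp
      | succ m ih =>
        calc x ^ (m+1) * g * (x ^ (m+1))⁻¹ = x * (x ^ m * g * (x ^ m)⁻¹) * x⁻¹ := by
              rw [pow_succ']; group
          _ = x * (g * t ^ m) * x⁻¹ := by rw [ih]
          _ = x * g * (x⁻¹ * x) * t ^ m * x⁻¹ := by group
          _ = x * g * x⁻¹ * (x * t ^ m) * x⁻¹ := by group
          _ = _ := by
            rw [(show Commute x t from htc x).pow_right m, hxt, pow_succ']; group
    have := h2 p
    rw [htp, mul_one] at this
    exact mul_inv_eq_iff_eq_mul.1 this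
  obtain ⟨e, he⟩ := hgen _ hxpA
  simp only at he
  have hte : t ^ e = 1 := by
    have e1 : x * g ^ e * x⁻¹ = g ^ e := by rw [he]; group
    rw [← conj_zpow, hxt, (show Commute g t from htc g).mul_zpow] at e1
    simpa using e1
  obtain ⟨f, rfl⟩ := (htone e).1 hte
  -- find y0
  have hp2' : p ≠ 2 → (p : ℤ) ∣ ((p * (p - 1) / 2 : ℕ) : ℤ) := by
    intro h
    have hodd := hp.odd_of_ne_two h
    obtain ⟨m, hm⟩ := hodd
    have : p * (p - 1) / 2 = p * m := by
      rw [show p - 1 = 2 * m by omega, show p * (2 * m) = (p * m) * 2 by ring, Nat.mul_div_cancel _ two_pos]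
    rw [this]; push_cast; exact dvd_mul_right _ _
  have hy0 : ∃ i : ℤ, (g ^ i * x) ^ p = 1 := by
    rcases hn with h | ⟨rfl, hn3⟩
    · refine ⟨-f, ?_⟩
      rw [F x hxt, (htone _).2 ((hp2' h).mul_left _), mul_one, ← he, ← zpow_add]
      simp [mul_comm]
    · have hzt : t = z := by
        obtain ⟨j, hj⟩ := htz
        simp only at hj
        rw [← hj]
        rcases Int.even_or_odd j with ⟨r, hr⟩ | ⟨r, hr⟩
        · exfalso
          apply ht1
          rw [← hj, hr, ← two_mul, zpow_mul, show z ^ (2:ℤ) = 1 from by exact_mod_cast hzp, one_zpow]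
        · rw [hr, zpow_add, zpow_mul, show z ^ (2:ℤ) = 1 from by exact_mod_cast hzp]; simp
      by_cases hf : t ^ f = 1
      · refine ⟨-f, ?_⟩
        rw [F x hxt]
        have : t ^ (-f * ((2 * (2-1) / 2 : ℕ) : ℤ)) = 1 := by norm_num [hf]
        rw [this, mul_one, ← he, ← zpow_add]
        simp [mul_comm]
      · have hfo : Odd f := by
          rw [← Int.not_even_iff_odd]
          intro h; apply hf
          exact (htone f).2 (by exact_mod_cast h.two_dvd)
        refine ⟨-f + 2 ^ (n-2), ?_⟩
        rw [F x hxt]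
        have h1 : t ^ ((-f + 2 ^ (n-2)) * ((2 * (2-1) / 2 : ℕ) : ℤ)) = t := by
          norm_num
          have : (-f + 2 ^ (n-2)) = 1 + ((-f + 2 ^ (n-2)) - 1) := by ring
          rw [this, zpow_add, zpow_one]
          rw [(htone _).2, mul_one]
          obtain ⟨r, hr⟩ := hfo
          obtain ⟨m, rfl⟩ : ∃ m, n = m + 3 := ⟨n-3, by omega⟩
          refine ⟨-r - 1 + 2 ^ m, ?_⟩
          rw [hr, show m + 3 - 2 = m + 1 by omega]; push_cast; ring
        rw [h1, ← he]
        have h2 : g ^ ((-f + 2 ^ (n-2)) * ((2:ℕ):ℤ)) = z * g ^ (-(((2:ℕ):ℤ) * f)) := by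
          rw [hz, ← zpow_natCast g, ← zpow_add]
          congr 1
          obtain ⟨m, rfl⟩ : ∃ m, n = m + 3 := ⟨n-3, by omega⟩
          rw [show m + 3 - 2 = m + 1 by omega, show m + 3 - 1 = m + 2 by omega]; push_cast; ring
        rw [h2, hzt, mul_assoc, mul_assoc, ← mul_assoc _ z, hcz, mul_assoc z, ← zpow_add]
        rw [show z * (z * g ^ (-(((2:ℕ):ℤ) * f) + ((2:ℕ):ℤ) * f)) = z ^ 2 by
          rw [neg_add_cancel, zpow_zero, mul_one, sq]]
        exact hzp
  obtain ⟨i, hi⟩ := hy0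
  set y := g ^ i * x with hy
  have hyA : y ∉ A := fun h => hxA ((A.mul_mem_cancel_left (hmul i)).1 h)
  have hyt : y * g * y⁻¹ = g * t := by
    rw [hy]
    calc g ^ i * x * g * (g ^ i * x)⁻¹ = g ^ i * (x * g * x⁻¹) * (g ^ i)⁻¹ := by group
      _ = g ^ i * g * (t * (g ^ i)⁻¹) := by rw [hxt]; group
      _ = _ := by rw [← htc]; group
  apply hyA
  apply hzA
  refine no_klein p hp hR z y hz1 hzp hi hcz ?_
  intro h
  obtain ⟨v, hv⟩ := hconj h
  have hcA : h * y * h⁻¹ * y⁻¹ ∈ A := by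
    apply hsc
    -- commutator acts trivially
    have hv' : g = h⁻¹ * g ^ v * h := by rw [← hv]; group
    obtain ⟨v2, hv2⟩ := hconj h⁻¹
    have hvv : g ^ (v2 * v) = g := by
      rw [zpow_mul, ← hv2, conj_zpow, ← hv]; group
    obtain ⟨w, hw⟩ := hconj y
    obtain ⟨w2, hw2⟩ := hconj y⁻¹
    have hww : g ^ (w2 * w) = g := by
      rw [zpow_mul, ← hw2, conj_zpow, ← hw]; group
    have key : (h * y * h⁻¹ * y⁻¹) * g * (h * y * h⁻¹ * y⁻¹)⁻¹ = g := by
      have e1 : (h * y * h⁻¹ * y⁻¹) * g * (h * y * h⁻¹ * y⁻¹)⁻¹ = h * (y * (h⁻¹ * (y⁻¹ * g * (y⁻¹)⁻¹) * (h⁻¹)⁻¹) * y⁻¹) * h⁻¹ := by group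
      rw [e1, hw2, ← conj_zpow, hv2, ← zpow_mul, ← conj_zpow, hw, ← zpow_mul, ← conj_zpow, hv, ← zpow_mul]
      have : v * (w * (v2 * w2)) = (v2 * v) * (w2 * w) := by ring
      rw [this, zpow_mul, hvv, hww]
    exact mul_inv_eq_iff_eq_mul.1 key
  obtain ⟨j, hj⟩ := hgen _ hcA
  simp only at hj
  refine ⟨g ^ j, ?_, by rw [hj]; group⟩
  apply mem_z p hp g n hn1 hg _ ⟨j, rfl⟩
  have hcy : (g ^ j * y) ^ p = 1 := by
    rw [hj, inv_mul_cancel_right, conj_pow, hi]; group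
  rw [F y hyt, hi, mul_one] at hcy
  rcases hn with h | ⟨rfl, hn3⟩
  · rw [(htone _).2 ((hp2' h).mul_left _), mul_one] at hcy
    rw [← zpow_natCast, ← zpow_mul]; exact hcy
  · norm_num at hcy
    have h4 : g ^ (j * 4) = 1 := by
      have := congrArg (fun a => a ^ 2) hcy
      simp only [one_pow] at this
      have hc : Commute (g ^ (j*2)) (t ^ j) := (show Commute g t from htc g).zpow_zpow _ _
      rw [hc.mul_pow, ← zpow_natCast (t ^ j), zpow_comm, zpow_natCast t 2, htp, one_zpow, mul_one, ← zpow_natCast, ← zpow_mul] at this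
      rw [← this]; congr 1; push_cast; ring
    obtain ⟨r, hr⟩ := (hone _).1 h4
    obtain ⟨m, rfl⟩ : ∃ m, n = m + 3 := ⟨n-3, by omega⟩
    have : t ^ j = 1 := by
      rw [htone]
      refine ⟨2 ^ m * r, ?_⟩
      rw [pow_succ, pow_succ, pow_succ] at hr
      push_cast at hr ⊢
      linarith
    rw [this, mul_one] at hcy
    rw [← zpow_natCast, ← zpow_mul]; exact_mod_cast hcy

end Genotype

namespace Genotype

theorem normal_meets_center {P : Type} [Group P] [Finite P] (p : ℕ) (hp : p.Prime) (hP : IsPGroup p P)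
    (N : Subgroup P) [N.Normal] (hN : N ≠ ⊥) : ∃ x ∈ N, x ≠ 1 ∧ ∀ y, y * x = x * y := by
  have := Fact.mk hp
  letI : MulAction P N := MulAction.compHom N (MulAut.conjNormal : P →* MulAut N)
  have hnt : Nontrivial N := (Subgroup.nontrivial_iff_ne_bot N).2 hN
  have hd : p ∣ Nat.card N := by
    obtain ⟨m, hm⟩ := (IsPGroup.iff_card.1 (hP.to_subgroup N))
    have h1 : 1 < Nat.card N := Finite.one_lt_card
    rw [hm] at h1 ⊢
    exact dvd_pow_self p (by rintro rfl; simp at h1)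
  have hs : ∀ (g : P) (n : N), ((g • n : N) : P) = g * n * g⁻¹ := fun g n => MulAut.conjNormal_apply g n
  obtain ⟨b, hb, hb1⟩ := hP.exists_fixed_point_of_prime_dvd_card_of_fixed_point N hd (a := 1) (by
    intro g; apply Subtype.ext; rw [hs]; simp)
  refine ⟨b, b.2, fun h => hb1 (Subtype.ext h.symm), fun y => ?_⟩
  have := congrArg Subtype.val (hb y)
  rw [hs] at this
  exact mul_inv_eq_iff_eq_mul.1 this

theorem exists_max_abelian {P : Type} [Group P] [Finite P] (p : ℕ) (hp : p.Prime) (hP : IsPGroup p P) :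
    ∃ A : Subgroup P, A.Normal ∧ (∀ x ∈ A, ∀ y ∈ A, x * y = y * x) ∧
      ∀ x, (∀ a ∈ A, x * a = a * x) → x ∈ A := by
  obtain ⟨A, ⟨hA, hab⟩, hmax⟩ := Set.Finite.exists_maximal
    (s := {A : Subgroup P | A.Normal ∧ ∀ x ∈ A, ∀ y ∈ A, x * y = y * x}) (Set.toFinite _)
    ⟨⊥, inferInstance, by simp⟩
  refine ⟨A, hA, hab, fun x₀ hx₀ => ?_⟩
  by_contra hx₀A
  let C := Subgroup.centralizer (A : Set P)
  have hC : ∀ x, x ∈ C ↔ ∀ a ∈ A, a * x = x * a := fun x => Subgroup.mem_centralizer_iff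
  have hCn : C.Normal := by
    refine ⟨fun c hc g => ?_⟩
    rw [hC] at hc ⊢
    intro a ha
    have := hc _ (hA.conj_mem a ha g⁻¹)
    simp only [inv_inv] at this
    calc a * (g * c * g⁻¹) = g * ((g⁻¹ * a * g) * c) * g⁻¹ := by group
      _ = g * (c * (g⁻¹ * a * g)) * g⁻¹ := by rw [this]
      _ = _ := by group
  let N := C.map (QuotientGroup.mk' A)
  have hNn : N.Normal := Subgroup.Normal.map hCn _ (QuotientGroup.mk'_surjective A)
  have hN : N ≠ ⊥ := by
    intro h
    have : QuotientGroup.mk' A x₀ ∈ N := ⟨x₀, (hC _).2 fun a ha => (hx₀ a ha).symm, rfl⟩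
    rw [h, Subgroup.mem_bot, ← MonoidHom.mem_ker, QuotientGroup.ker_mk'] at this
    exact hx₀A this
  obtain ⟨_, ⟨x, hxC, rfl⟩, hx1, hxc⟩ := normal_meets_center p hp (hP.to_quotient A) N hN
  have hxA : x ∉ A := by
    intro h; apply hx1
    rwa [← MonoidHom.mem_ker, QuotientGroup.ker_mk']
  let B := (Subgroup.zpowers (QuotientGroup.mk' A x)).comap (QuotientGroup.mk' A)
  have hB : ∀ b ∈ B, ∃ i : ℤ, ∃ a ∈ A, b = x ^ i * a := by
    rintro b ⟨i, hi⟩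
    refine ⟨i, (x^i)⁻¹ * b, ?_, by group⟩
    simp only at hi
    rw [← map_zpow] at hi
    exact QuotientGroup.eq.1 hi
  have hz : (Subgroup.zpowers (QuotientGroup.mk' A x)).Normal := by
    refine ⟨?_⟩
    rintro _ ⟨i, rfl⟩ g
    refine ⟨i, ?_⟩
    have : Commute g (QuotientGroup.mk' A x) := hxc g
    simp only
    rw [(this.zpow_right i).eq]; group
  have hle : B ≤ A := hmax ⟨hz.comap _, ?_⟩ ?_
  · exact hxA (hle ⟨1, by simp⟩)
  · intro b hb b' hb'
    obtain ⟨i, a, ha, rfl⟩ := hB b hb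
    obtain ⟨j, a', ha', rfl⟩ := hB b' hb'
    have c1 : Commute a' x := (hC x).1 hxC a' ha'
    have c2 : Commute a x := (hC x).1 hxC a ha
    have c3 : Commute a a' := hab a ha a' ha'
    exact (((Commute.refl x).zpow_zpow i j).mul_left (c2.zpow_right j)).mul_right ((c1.symm.zpow_left i).mul_left c3)
  · intro a ha
    refine ⟨0, ?_⟩
    simp only [zpow_zero]
    exact ((QuotientGroup.eq_one_iff a).2 ha).symm

theorem lte (p : ℕ) (hp : p.Prime) (n : ℕ) (u : ℤ) (h1 : (p:ℤ) ∣ u - 1) (h4 : p = 2 → (4:ℤ) ∣ u - 1)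
    (h : (p:ℤ) ^ n ∣ u ^ p - 1) : (p:ℤ) ^ (n - 1) ∣ u - 1 := by
  have hu : ¬ (p:ℤ) ∣ u := by
    intro hd
    have : (p:ℤ) ∣ 1 := by simpa using dvd_sub hd h1
    have := Int.le_of_dvd one_pos this
    have := hp.one_lt
    omega
  have e : emultiplicity (p:ℤ) (u ^ p - 1 ^ p) = emultiplicity (p:ℤ) (u - 1) + 1 := by
    rcases hp.eq_two_or_odd' with rfl | ho
    · have := Int.two_pow_sub_pow' 2 (h4 rfl) hu
      rw [show emultiplicity (2:ℤ) ((2:ℕ):ℤ) = 1 from ?_] at this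
      · exact_mod_cast this
      · have := (Nat.finiteMultiplicity_iff.2 ⟨by norm_num, by norm_num⟩ : FiniteMultiplicity 2 2).emultiplicity_self
        have h := Int.natCast_emultiplicity 2 2
        rw [this] at h
        exact_mod_cast h
    · have := Int.emultiplicity_pow_sub_pow hp ho h1 hu p
      rw [this, (Nat.finiteMultiplicity_iff.2 ⟨hp.ne_one, hp.pos⟩ : FiniteMultiplicity p p).emultiplicity_self]
  rw [one_pow] at e
  rw [pow_dvd_iff_le_emultiplicity] at h ⊢
  rw [e] at h
  rcases n with _ | n
  · simp
  · simp only [Nat.add_sub_cancel]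
    push_cast at h
    exact (ENat.add_le_add_iff_right (by simp)).1 h

end Genotype

namespace Genotype

structure RS (p : ℕ) (P : Type) [Group P] (A : Subgroup P) (z : P) : Prop where
  norm : A.Normal
  comm : ∀ x ∈ A, ∀ y ∈ A, x * y = y * x
  zA : z ∈ A
  z1 : z ≠ 1
  zp : z ^ p = 1
  zc : ∀ x, x * z = z * x
  om : ∀ y ∈ A, y ^ p = 1 → y ∈ Subgroup.zpowers z
  tr : ∀ y ∈ A, y ≠ 1 → z ∈ Subgroup.zpowers y
  alt : (∀ x, x ∈ A) ∨ (p = 2 ∧ (∀ x, x ∉ A → ∀ y, y ∉ A → x * y ∈ A) ∧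
    (∀ x, x ∉ A → ∀ y ∈ A, x * y = y * x → y ^ 2 = 1) ∧ 4 ≤ Nat.card A ∧
    (∀ x, x ∉ A → x ^ 2 = 1 → 8 ≤ Nat.card A) ∧
    (∀ x, x ∉ A → ∃ y ∈ A, y * x * y⁻¹ = z * x))

theorem exists_RS {P : Type} [Group P] [Finite P] [Nontrivial P] (p : ℕ) (hp : p.Prime) (hP : IsPGroup p P)
    (hR : IsRoquette P) : ∃ A z, RS p P A z := by
  have := Fact.mk hp
  obtain ⟨A, hA, hab, hself⟩ := exists_max_abelian p hp hP
  obtain ⟨⟨g, hgA⟩, hg0⟩ := (hR A hA hab).exists_generator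
  have hgen : ∀ y ∈ A, y ∈ Subgroup.zpowers g := by
    intro y hy
    obtain ⟨i, hi⟩ := hg0 ⟨y, hy⟩
    exact ⟨i, congrArg Subtype.val hi⟩
  have hAz : A = Subgroup.zpowers g := le_antisymm hgen (Subgroup.zpowers_le.2 hgA)
  have hsc : ∀ x, x * g = g * x → x ∈ A := by
    intro x hx
    apply hself
    intro a ha
    obtain ⟨i, rfl⟩ := hgen a ha
    exact (show Commute x g from hx).zpow_right i
  obtain ⟨n, hn⟩ := IsPGroup.iff_orderOf.1 hP g
  have hcard : Nat.card A = p ^ n := by rw [hAz, Nat.card_zpowers, hn]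
  have hn1 : 1 ≤ n := by
    by_contra h
    have h0 : n = 0 := by omega
    rw [h0, pow_zero, orderOf_eq_one_iff] at hn
    obtain ⟨x, hx⟩ := exists_ne (1 : P)
    have h1 := hgen x (hsc x (by rw [hn]; simp))
    rw [hn] at h1
    simp at h1
    exact hx h1
  have hone : ∀ i : ℤ, g ^ i = 1 ↔ ((p : ℤ) ^ n ∣ i) := by
    intro i; rw [← orderOf_dvd_iff_zpow_eq_one, hn]; push_cast; rfl
  have heq : ∀ i j : ℤ, g ^ i = g ^ j ↔ ((p : ℤ) ^ n ∣ i - j) := by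
    intro i j; rw [← hone, zpow_sub, mul_inv_eq_one]
  obtain ⟨m, rfl⟩ : ∃ m, n = m + 1 := ⟨n - 1, by omega⟩
  set z := g ^ (p ^ m) with hz
  have hzA : z ∈ A := A.pow_mem hgA _
  have hz1 : z ≠ 1 := by
    intro h
    have := orderOf_dvd_of_pow_eq_one h
    rw [hn] at this
    have := (Nat.pow_dvd_pow_iff_le_right hp.one_lt).1 this
    omega
  have hzp : z ^ p = 1 := by
    rw [hz, ← pow_mul, ← pow_succ, ← hn, pow_orderOf_eq_one]
  have hom : ∀ y ∈ A, y ^ p = 1 → y ∈ Subgroup.zpowers z := fun y hy hyp =>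
    mem_z p hp g (m+1) hn1 hn y (hgen y hy) hyp
  have htr : ∀ y ∈ A, y ≠ 1 → z ∈ Subgroup.zpowers y := by
    intro y hy hy1
    obtain ⟨s, hs⟩ := IsPGroup.iff_orderOf.1 hP y
    have hs0 : s ≠ 0 := by
      rintro rfl; rw [pow_zero, orderOf_eq_one_iff] at hs; exact hy1 hs
    obtain ⟨s, rfl⟩ := Nat.exists_eq_succ_of_ne_zero hs0
    set y' := y ^ (p ^ s) with hy'
    have h1 : y' ≠ 1 := by
      intro h
      have := orderOf_dvd_of_pow_eq_one h
      rw [hs] at this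
      have := (Nat.pow_dvd_pow_iff_le_right hp.one_lt).1 this
      omega
    have h2 : y' ^ p = 1 := by
      rw [hy', ← pow_mul, ← pow_succ, ← Nat.succ_eq_add_one, ← hs, pow_orderOf_eq_one]
    have h3 : Subgroup.zpowers y' ≤ Subgroup.zpowers z :=
      Subgroup.zpowers_le.2 (hom y' (A.pow_mem hy _) h2)
    have h4 : Subgroup.zpowers y' = Subgroup.zpowers z := by
      apply Subgroup.eq_of_le_of_card_ge h3
      rw [Nat.card_zpowers, Nat.card_zpowers, orderOf_eq_prime h2 h1, orderOf_eq_prime hzp hz1]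
    have h5 : z ∈ Subgroup.zpowers y' := h4 ▸ Subgroup.mem_zpowers z
    exact (Subgroup.zpowers_le.2 (Subgroup.pow_mem _ (Subgroup.mem_zpowers y) _)) h5
  have hcz : ∀ x, x * z = z * x := by
    have hzn : (Subgroup.zpowers z).Normal := by
      refine ⟨?_⟩
      rintro _ ⟨i, rfl⟩ x
      apply hom
      · exact hA.conj_mem _ (A.zpow_mem hzA i) x
      · simp only
        rw [conj_pow, ← zpow_natCast, ← zpow_mul, mul_comm, zpow_mul, zpow_natCast, hzp]; simp
    obtain ⟨w, hw, hw1, hwc⟩ := normal_meets_center p hp hP (Subgroup.zpowers z) (by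
      rw [Ne, Subgroup.zpowers_eq_bot]; exact hz1)
    obtain ⟨j, hj⟩ := htr w ((Subgroup.zpowers_le.2 hzA) hw) hw1
    intro x
    rw [← hj]
    exact (show Commute x w from hwc x).zpow_right j
  have hconj : ∀ h : P, ∃ u : ℤ, h * g * h⁻¹ = g ^ u := by
    intro h
    obtain ⟨u, hu⟩ := hgen _ (hA.conj_mem g hgA h)
    exact ⟨u, hu.symm⟩
  have hcp : ∀ (x : P) (u : ℤ), x * g * x⁻¹ = g ^ u → ∀ i : ℤ, x * g ^ i * x⁻¹ = g ^ (u * i) := by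
    intro x u hu i
    rw [← conj_zpow, hu, zpow_mul]
  have hpow0 : (p:ℤ) ^ m ≠ 0 := by exact_mod_cast pow_ne_zero _ hp.ne_zero
  have hu1 : ∀ (x : P) (u : ℤ), x * g * x⁻¹ = g ^ u → (p:ℤ) ∣ u - 1 := by
    intro x u hu
    have h1 := hcp x u hu ((p:ℤ)^m)
    have h2 : g ^ ((p:ℤ)^m) = z := by rw [hz, ← zpow_natCast]; push_cast; rfl
    rw [h2, hcz x, mul_inv_cancel_right, ← h2, eq_comm, heq] at h1
    rw [show u * (p:ℤ)^m - p^m = p^m * (u - 1) by ring, pow_succ] at h1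
    exact Int.dvd_of_mul_dvd_mul_left hpow0 h1
  have hM : ∀ (x : P) (u : ℤ), x * g * x⁻¹ = g ^ u → (p = 2 → (4:ℤ) ∣ u - 1) → x ∈ A := by
    intro x u hu h4
    by_cases hsmall : p = 2 ∧ m + 1 ≤ 2
    · apply hsc
      have : g ^ u = g ^ (1:ℤ) := by
        rw [heq]
        refine dvd_trans ?_ (h4 hsmall.1)
        rw [hsmall.1, show (4:ℤ) = 2^2 by norm_num]
        exact pow_dvd_pow _ hsmall.2
      rw [this, zpow_one] at hu
      exact mul_inv_eq_iff_eq_mul.1 hu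
    · by_contra hxA
      have hex : ∃ j, x ^ (p ^ j) ∈ A := by
        obtain ⟨j, hj⟩ := hP x
        exact ⟨j, by rw [hj]; exact A.one_mem⟩
      obtain ⟨j, hj⟩ : ∃ j, Nat.find hex = j + 1 := by
        apply Nat.exists_eq_succ_of_ne_zero
        intro h0
        have := Nat.find_spec hex
        rw [h0] at this
        simp at this
        exact hxA this
      have hin := Nat.find_spec hex
      have hnin := Nat.find_min hex (m := j) (by omega)
      rw [hj, pow_succ, pow_mul] at hin
      have hpw : ∀ s : ℕ, x ^ s * g * (x ^ s)⁻¹ = g ^ (u ^ s) := by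
        intro s
        induction s with
        | zero => simp
        | succ s ih =>
          calc x ^ (s+1) * g * (x ^ (s+1))⁻¹ = x * (x ^ s * g * (x ^ s)⁻¹) * x⁻¹ := by
                rw [pow_succ']; group
            _ = _ := by rw [ih, hcp x u hu, pow_succ']
      set x' := x ^ (p ^ j) with hx'
      set u' := u ^ (p ^ j) with hu'
      have e1 : x' * g * x'⁻¹ = g ^ u' := hpw _
      have e2 : (p:ℤ)^(m+1) ∣ u' ^ p - 1 := by
        rw [← heq, hu', ← pow_mul, ← hpw, pow_mul, ← hx', hab _ hin g hgA]; group
      have hdv : u - 1 ∣ u' - 1 := by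
        have := sub_dvd_pow_sub_pow u 1 (p^j)
        rwa [one_pow] at this
      have e3 := lte p hp (m+1) u' (hu1 x' u' e1) (fun h => (h4 h).trans hdv) e2
      simp only [Nat.add_sub_cancel] at e3
      apply hnin
      refine KL p hp hR A hA g hgA hgen hsc (m+1) hn hn1 ?_ (by simpa using hcz) x' ?_
      · by_cases h2 : p = 2
        · right; refine ⟨h2, ?_⟩; by_contra hh; exact hsmall ⟨h2, by omega⟩
        · left; exact h2
      · have := hcp x' u' e1 p
        rw [zpow_natCast] at this
        apply mul_inv_eq_iff_eq_mul.1
        rw [this, ← zpow_natCast, heq, show u' * (p:ℤ) - p = (u' - 1) * p by ring, pow_succ]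
        exact mul_dvd_mul_right e3 _
  refine ⟨A, z, hA, hab, hzA, hz1, hzp, hcz, hom, htr, ?_⟩
  by_cases h2 : p = 2
  swap
  · left; intro x
    obtain ⟨u, hu⟩ := hconj x
    exact hM x u hu (fun h => absurd h h2)
  by_cases hall : ∀ x, x ∈ A
  · exact Or.inl hall
  right
  subst h2
  have h3 : ∀ x, x ∉ A → ∃ u : ℤ, x * g * x⁻¹ = g ^ u ∧ u % 4 = 3 := by
    intro x hx
    obtain ⟨u, hu⟩ := hconj x
    refine ⟨u, hu, ?_⟩
    have a1 := hu1 x u hu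
    have a2 : ¬ (4:ℤ) ∣ u - 1 := fun h => hx (hM x u hu (fun _ => h))
    push_cast at a1
    omega
  have hprod : ∀ x, x ∉ A → ∀ y, y ∉ A → x * y ∈ A := by
    intro x hx y hy
    obtain ⟨u, hu, hu3⟩ := h3 x hx
    obtain ⟨v, hv, hv3⟩ := h3 y hy
    refine hM _ (u * v) ?_ (fun _ => ?_)
    · rw [← hcp x u hu, ← hv]; group
    · apply Int.dvd_of_emod_eq_zero
      rw [Int.sub_emod, Int.mul_emod, hu3, hv3]; rfl
  have hm1 : 1 ≤ m := by
    by_contra h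
    push Not at hall
    obtain ⟨x, hx⟩ := hall
    obtain ⟨u, hu, hu3⟩ := h3 x hx
    apply hx
    apply hsc
    have : g ^ u = g ^ (1:ℤ) := by
      rw [heq]
      have : m = 0 := by omega
      rw [this]; push_cast; norm_num; omega
    rw [this, zpow_one] at hu
    exact mul_inv_eq_iff_eq_mul.1 hu
  obtain ⟨l, rfl⟩ : ∃ l, m = l + 1 := ⟨m - 1, by omega⟩
  refine ⟨rfl, hprod, ?_, ?_, ?_, ?_⟩
  · intro x hx y hy hxy
    obtain ⟨u, hu, hu3⟩ := h3 x hx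
    obtain ⟨i, rfl⟩ := hgen y hy
    have e := hcp x u hu i
    simp only at hxy ⊢
    rw [hxy, mul_inv_cancel_right, eq_comm, heq] at e
    obtain ⟨w, hw⟩ : ∃ w, u = 4 * w + 3 := ⟨u / 4, by omega⟩
    rw [hw, show (4 * w + 3) * i - i = (2 * i) * (2 * w + 1) by ring] at e
    rw [← zpow_natCast, ← zpow_mul, hone, mul_comm]
    push_cast at e ⊢
    refine IsCoprime.dvd_of_dvd_mul_right ?_ e
    apply IsCoprime.pow_left
    exact ⟨-w, 1, by ring⟩
  · rw [hcard, show (4:ℕ) = 2 ^ 2 by norm_num]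
    exact Nat.pow_le_pow_right two_pos (by omega)
  · intro x hx hx2
    rw [hcard, show (8:ℕ) = 2 ^ 3 by norm_num]
    by_contra hlt
    have hl0 : l = 0 := by
      by_contra h
      exact hlt (Nat.pow_le_pow_right two_pos (by omega))
    subst hl0
    obtain ⟨u, hu, hu3⟩ := h3 x hx
    have key : ∀ h ∈ A, ∃ c ∈ Subgroup.zpowers z, h * x * h⁻¹ = c * x := by
      intro h hh
      obtain ⟨i, rfl⟩ := hgen h hh
      refine ⟨g ^ ((1 - u) * i), hom _ (A.zpow_mem hgA _) ?_, ?_⟩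
      · rw [← zpow_natCast, ← zpow_mul, hone]
        obtain ⟨w, hw⟩ : ∃ w, u = 4 * w + 3 := ⟨u / 4, by omega⟩
        push_cast
        exact ⟨(-2 * w - 1) * i, by rw [hw]; ring⟩
      · have := hcp x u hu (-i)
        simp only
        rw [sub_mul, one_mul, sub_eq_add_neg, zpow_add, ← mul_neg, ← this]
        group
    apply hx
    refine (Subgroup.zpowers_le.2 hzA) (no_klein 2 Nat.prime_two hR z x hz1 hzp hx2 hcz ?_)
    intro h
    by_cases hh : h ∈ A
    · exact key h hh
    · obtain ⟨c, hc, e⟩ := key (h * x) (hprod h hh x hx)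
      refine ⟨c, hc, ?_⟩
      rw [← e]; group
  · intro x hx
    obtain ⟨u, hu, hu3⟩ := h3 x hx
    refine ⟨g ^ ((2:ℤ) ^ l), A.zpow_mem hgA _, ?_⟩
    have := hcp x u hu (-(2:ℤ)^l)
    obtain ⟨w, hw⟩ : ∃ w, u = 4 * w + 3 := ⟨u / 4, by omega⟩
    have e2 : z = g ^ ((2:ℤ)^(l+1)) := by rw [hz, ← zpow_natCast]; push_cast; rfl
    have e : g ^ ((1 - u) * 2 ^ l) = z := by
      rw [e2, heq, hw]
      push_cast
      exact ⟨-w-1, by ring⟩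
    rw [← e, sub_mul, one_mul, sub_eq_add_neg, zpow_add, ← mul_neg, ← this]
    group

end Genotype

namespace Genotype

theorem RS.theta {P : Type} [Group P] [Finite P] {p : ℕ} (hp : p.Prime) {A : Subgroup P} {z : P}
    (S : RS p P A z) (r : ℕ) (hr : r.Coprime (Nat.card P)) :
    ∃ θ : P →* P, Function.Bijective θ ∧ (∀ a ∈ A, θ a = a ^ r) ∧ (∀ x, x ∉ A → θ x ∉ A) ∧
      (∀ x, x ∉ A → x ^ r ∉ A) := by
  suffices h : ∃ θ : P →* P, (∀ a ∈ A, θ a = a ^ r) ∧ (∀ x, x ∉ A → θ x ∉ A) ∧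
      (∀ x, x ∉ A → x ^ r ∉ A) by
    obtain ⟨θ, h1, h2, h3⟩ := h
    refine ⟨θ, Finite.injective_iff_bijective.1 ?_, h1, h2, h3⟩
    rw [injective_iff_map_eq_one]
    intro x hx
    by_cases hxA : x ∈ A
    · rw [h1 x hxA] at hx
      have a1 := orderOf_dvd_of_pow_eq_one hx
      have a2 := orderOf_dvd_natCard x
      have := Nat.dvd_gcd a1 a2
      rw [hr.gcd_eq_one, Nat.dvd_one, orderOf_eq_one_iff] at this
      exact this
    · exact absurd (hx ▸ A.one_mem) (h2 x hxA)
  rcases S.alt with hall | ⟨rfl, hprod, hQ, h4, -, -⟩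
  · refine ⟨⟨⟨fun x => x ^ r, one_pow r⟩, fun x y => ?_⟩, fun a _ => rfl, fun x hx => absurd (hall x) hx,
      fun x hx => absurd (hall x) hx⟩
    exact (show Commute x y from S.comm x (hall x) y (hall y)).mul_pow r
  by_cases hall : ∀ x, x ∈ A
  · refine ⟨⟨⟨fun x => x ^ r, one_pow r⟩, fun x y => ?_⟩, fun a _ => rfl, fun x hx => absurd (hall x) hx,
      fun x hx => absurd (hall x) hx⟩
    exact (show Commute x y from S.comm x (hall x) y (hall y)).mul_pow r
  have hodd : Odd r := by
    have h2 : 2 ∣ Nat.card P := by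
      rw [← orderOf_eq_prime S.zp S.z1]; exact orderOf_dvd_natCard z
    have := Nat.Coprime.coprime_dvd_right h2 hr
    exact (Nat.coprime_two_right).1 this
  obtain ⟨s, hs⟩ := hodd
  push Not at hall
  obtain ⟨b, hb⟩ := hall
  have hb' : b⁻¹ ∉ A := fun h => hb (by simpa using A.inv_mem h)
  have hsq : ∀ x, x ∉ A → x ^ 2 ∈ A := fun x hx => by rw [pow_two]; exact hprod x hx x hx
  have hb4 : (b ^ 2) ^ r = b ^ 2 := by
    have h1 := hQ b hb _ (hsq b hb) ((Commute.refl b).pow_right 2)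
    rw [hs, pow_succ, pow_mul, h1]; simp
  have hdec : ∀ x, x ∉ A → ∃ a ∈ A, x = a * b := fun x hx => ⟨x * b⁻¹, hprod x hx _ hb', by group⟩
  have hnot : ∀ a ∈ A, a * b ∉ A := fun a ha h => hb ((A.mul_mem_cancel_left ha).1 h)
  let f : P → P := fun x => if x ∈ A then x ^ r else (x * b⁻¹) ^ r * b
  have f1 : ∀ a ∈ A, f a = a ^ r := fun a ha => if_pos ha
  have f2 : ∀ a ∈ A, f (a * b) = a ^ r * b := fun a ha => by
    simp only [f]; rw [if_neg (hnot a ha)]; simp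
  refine ⟨⟨⟨f, by rw [f1 1 A.one_mem, one_pow]⟩, ?_⟩, f1, ?_, ?_⟩
  · have hcp : ∀ a ∈ A, ∀ c ∈ A, (a * c) ^ r = a ^ r * c ^ r := fun a ha c hc =>
      (show Commute a c from S.comm a ha c hc).mul_pow r
    have hcj : ∀ c ∈ A, b * c * b⁻¹ ∈ A := fun c hc => S.norm.conj_mem c hc b
    intro x y
    show f (x * y) = f x * f y
    by_cases hx : x ∈ A <;> by_cases hy : y ∈ A
    · rw [f1 _ (A.mul_mem hx hy), f1 _ hx, f1 _ hy, hcp x hx y hy]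
    · obtain ⟨c, hc, rfl⟩ := hdec y hy
      rw [← mul_assoc, f2 _ (A.mul_mem hx hc), f2 _ hc, f1 _ hx, hcp x hx c hc, mul_assoc]
    · obtain ⟨a, ha, rfl⟩ := hdec x hx
      rw [show a * b * y = a * (b * y * b⁻¹) * b by group, f2 _ (A.mul_mem ha (hcj y hy)), f2 _ ha,
        f1 _ hy, hcp _ ha _ (hcj y hy), conj_pow]
      group
    · obtain ⟨a, ha, rfl⟩ := hdec x hx
      obtain ⟨c, hc, rfl⟩ := hdec y hy
      rw [show a * b * (c * b) = a * (b * c * b⁻¹) * b ^ 2 by group,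
        f1 _ (A.mul_mem (A.mul_mem ha (hcj c hc)) (hsq b hb)), f2 _ ha, f2 _ hc,
        hcp _ (A.mul_mem ha (hcj c hc)) _ (hsq b hb), hcp _ ha _ (hcj c hc), hb4, conj_pow]
      group
  · intro x hx
    obtain ⟨a, ha, rfl⟩ := hdec x hx
    show f (a * b) ∉ A
    rw [f2 a ha]
    exact hnot _ (A.pow_mem ha r)
  · intro x hx h
    rw [hs, pow_succ, pow_mul] at h
    exact hx ((A.mul_mem_cancel_left (A.pow_mem (hsq x hx) s)).1 h)

theorem mem_zpow2 {P : Type} [Group P] {z y : P} (hz : z ^ 2 = 1) (hy : y ∈ Subgroup.zpowers z) :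
    y = 1 ∨ y = z := by
  obtain ⟨i, rfl⟩ := hy
  simp only
  rcases Int.even_or_odd' i with ⟨c, rfl | rfl⟩
  · left; rw [zpow_mul, zpow_ofNat, hz, one_zpow]
  · right; rw [zpow_add, zpow_mul, zpow_ofNat, hz, one_zpow, one_mul, zpow_one]

theorem RS.propI {P : Type} [Group P] [Finite P] {p : ℕ} {A : Subgroup P} {z : P}
    (S : RS p P A z) (X : Subgroup P) (hX : X ⊓ Subgroup.zpowers z = ⊥) (hX1 : X ≠ ⊥) :
    p = 2 ∧ Nat.card X = 2 ∧ Nat.card (Subgroup.normalizer (X : Set P)) ≤ 4 ∧ 16 ≤ Nat.card P := by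
  have hXA : ∀ y ∈ X, y ∈ A → y = 1 := by
    intro y hy hyA
    by_contra h1
    have h2 : z ∈ X := (Subgroup.zpowers_le.2 hy) (S.tr y hyA h1)
    have h3 : z ∈ X ⊓ Subgroup.zpowers z := ⟨h2, Subgroup.mem_zpowers z⟩
    rw [hX, Subgroup.mem_bot] at h3
    exact S.z1 h3
  obtain ⟨⟨x, hx⟩, hx0⟩ := Subgroup.ne_bot_iff_exists_ne_one.1 hX1
  have hx1 : x ≠ 1 := fun h => hx0 (Subtype.ext h)
  have hxA : x ∉ A := fun h => hx1 (hXA x hx h)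
  rcases S.alt with hall | ⟨rfl, hprod, hQ, h4, h8, -⟩
  · exact absurd (hall x) hxA
  have hinv : ∀ y ∈ X, y ≠ 1 → x * y = 1 := fun y hy hy1 =>
    hXA _ (X.mul_mem hx hy) (hprod x hxA y fun h => hy1 (hXA y hy h))
  have hxx := hinv x hx hx1
  have hel : ∀ y ∈ X, y = 1 ∨ y = x := by
    intro y hy
    by_cases h : y = 1
    · exact Or.inl h
    · right
      have := hinv y hy h
      exact mul_left_cancel (this.trans hxx.symm)
  have hXs : X = Subgroup.zpowers x := le_antisymm (fun y hy => by
    rcases hel y hy with rfl | rfl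
    · exact Subgroup.one_mem _
    · exact Subgroup.mem_zpowers _) (Subgroup.zpowers_le.2 hx)
  refine ⟨rfl, ?_, ?_, ?_⟩
  · rw [hXs, Nat.card_zpowers]; exact orderOf_eq_prime (by rw [pow_two, hxx]) hx1
  · have hNA : ∀ y ∈ Subgroup.normalizer (X : Set P), y ∈ A → y = 1 ∨ y = z := by
      intro y hy hyA
      have h1 := (Subgroup.mem_normalizer_iff.1 hy x).1 hx
      have h2 : y * x * y⁻¹ = x := by
        rcases hel _ h1 with h | h
        · exfalso; apply hx1
          have : x = y⁻¹ * (y * x * y⁻¹) * y := by group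
          rw [this, h]; group
        · exact h
      have h3 := mul_inv_eq_iff_eq_mul.1 h2
      exact mem_zpow2 S.zp (S.om y hyA (hQ x hxA y hyA h3.symm))
    have hsub : ((Subgroup.normalizer (X : Set P) : Subgroup P) : Set P) ⊆ ({1, z, x⁻¹, x⁻¹ * z} : Finset P) := by
      intro y hy
      simp only [Finset.coe_insert, Finset.coe_singleton, Set.mem_insert_iff, Set.mem_singleton_iff]
      by_cases hyA : y ∈ A
      · rcases hNA y hy hyA with h | h <;> simp [h]
      · rcases hNA (x * y) (Subgroup.mul_mem _ (Subgroup.le_normalizer hx) hy) (hprod x hxA y hyA) with h | h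
        · right; right; left; exact (inv_eq_of_mul_eq_one_right h).symm
        · right; right; right; rw [← h]; group
    have := Set.ncard_le_ncard hsub (Finset.finite_toSet _)
    rw [Set.ncard_coe_finset] at this
    exact this.trans Finset.card_le_four
  · have h1 : A.index ≠ 1 := by
      rw [Ne, Subgroup.index_eq_one]; rintro rfl; exact hxA trivial
    have h0 : A.index ≠ 0 := Subgroup.index_ne_zero_of_finite
    have := h8 x hxA (by rw [pow_two, hxx])
    rw [← Subgroup.card_mul_index A]
    calc 16 = 8 * 2 := rfl
      _ ≤ _ := Nat.mul_le_mul this (by omega)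

end Genotype

namespace Genotype

theorem core {L P P' : Type} [Group L] [Group P] [Group P'] [Finite L] [Finite P] [Finite P']
    (p : ℕ) (hp : p.Prime) (hL : IsPGroup p L) (hP : IsPGroup p P) (hP' : IsPGroup p P')
    {A : Subgroup P} {z : P} (S : RS p P A z) {A' : Subgroup P'} {z' : P'} (S' : RS p P' A' z')
    (α : L →* P) (β : L →* P')
    (hLL : ∀ l, α l ∈ Subgroup.zpowers z → β l ∈ Subgroup.zpowers z' → (α l = 1 ↔ β l = 1))
    (hlt : Nat.card P < Nat.card P')
    (hineq : Nat.card P * Nat.card P' *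
      (Nat.card ((Subgroup.zpowers z).comap α ⊓ (Subgroup.zpowers z').comap β : Subgroup L)) ^ 2
      ≤ p ^ 2 * (Nat.card L) ^ 2) : False := by
  have := Fact.mk hp
  set Ω := Subgroup.zpowers z with hΩ
  set Ω' := Subgroup.zpowers z' with hΩ'
  set L0 := Ω.comap α ⊓ Ω'.comap β with hL0
  set L1 := α.ker ⊓ β.ker with hL1
  have hL10 : L1 ≤ L0 := by
    rintro l ⟨h1, h2⟩
    have h1 : α l = 1 := h1
    have h2 : β l = 1 := h2
    exact ⟨by simp [h1, Ω.one_mem], by simp [h2, Ω'.one_mem]⟩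
  set Y := α.ker.map β with hY
  set X := β.ker.map α with hX
  have hYΩ : Y ⊓ Ω' = ⊥ := by
    rw [eq_bot_iff]
    rintro _ ⟨⟨l, hl, rfl⟩, h2⟩
    have hl' : α l = 1 := hl
    exact (hLL l (hl' ▸ Ω.one_mem) h2).1 hl'
  have hXΩ : X ⊓ Ω = ⊥ := by
    rw [eq_bot_iff]
    rintro _ ⟨⟨l, hl, rfl⟩, h2⟩
    have hl' : β l = 1 := hl
    exact (hLL l h2 (hl' ▸ Ω'.one_mem)).2 hl'
  have hca : Nat.card α.range * Nat.card α.ker = Nat.card L := by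
    rw [← Subgroup.index_ker, mul_comm]; exact Subgroup.card_mul_index _
  have hcb : Nat.card β.range * Nat.card β.ker = Nat.card L := by
    rw [← Subgroup.index_ker, mul_comm]; exact Subgroup.card_mul_index _
  have hkc : Nat.card Y * Nat.card L1 = Nat.card α.ker := by
    have h1 := Subgroup.card_mul_index (β.domRestrict α.ker).ker
    rw [Subgroup.index_ker, MonoidHom.domRestrict_range, MonoidHom.ker_domRestrict,
      ← Subgroup.card_subtype, Subgroup.subgroupOf_map_subtype, inf_comm] at h1
    rw [← h1, mul_comm]
  have hkd : Nat.card X * Nat.card L1 = Nat.card β.ker := by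
    have h1 := Subgroup.card_mul_index (α.domRestrict β.ker).ker
    rw [Subgroup.index_ker, MonoidHom.domRestrict_range, MonoidHom.ker_domRestrict,
      ← Subgroup.card_subtype, Subgroup.subgroupOf_map_subtype] at h1
    rw [← h1, mul_comm]
  have hl10 : Nat.card L1 ≤ Nat.card L0 := Subgroup.card_le_of_le hL10
  have heq01 : Nat.card L0 ≤ Nat.card L1 → L1 = L0 := fun h => Subgroup.eq_of_le_of_card_ge hL10 h
  have hl1pos : 0 < Nat.card L1 := Nat.card_pos
  obtain ⟨nP, hnP⟩ := IsPGroup.iff_card.1 hP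
  obtain ⟨nP', hnP'⟩ := IsPGroup.iff_card.1 hP'
  obtain ⟨nL, hnL⟩ := IsPGroup.iff_card.1 hL
  obtain ⟨n0, hn0⟩ := IsPGroup.iff_card.1 (hL.to_subgroup L0)
  have hple : ∀ a b : ℕ, p ^ a < p ^ (b + 1) → p ^ a ≤ p ^ b := by
    intro a b h
    have := (Nat.pow_lt_pow_iff_right hp.one_lt).1 h
    exact Nat.pow_le_pow_right hp.pos (by omega)
  have hP2 : 2 ≤ Nat.card P := by
    have h1 : p ∣ Nat.card P := by
      rw [← orderOf_eq_prime S.zp S.z1]; exact orderOf_dvd_natCard z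
    exact hp.two_le.trans (Nat.le_of_dvd Nat.card_pos h1)
  have hmain : Nat.card P * Nat.card L0 ≤ Nat.card L := by
    have h1 : p * Nat.card P ≤ Nat.card P' := by
      rw [hnP, hnP'] at hlt ⊢
      have := (Nat.pow_lt_pow_iff_right hp.one_lt).1 hlt
      rw [← pow_succ']
      exact Nat.pow_le_pow_right hp.pos (by omega)
    have h2 : p * (Nat.card P * Nat.card L0) ^ 2 ≤ p * (p * (Nat.card L)^2) := by
      calc p * (Nat.card P * Nat.card L0) ^ 2 = Nat.card P * (p * Nat.card P) * (Nat.card L0)^2 := by ring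
        _ ≤ Nat.card P * Nat.card P' * (Nat.card L0)^2 := by gcongr
        _ ≤ _ := hineq.trans (by rw [← mul_assoc, ← pow_two])
    have h3 := Nat.le_of_mul_le_mul_left h2 hp.pos
    have h4 : (Nat.card P * Nat.card L0) ^ 2 < (p * Nat.card L) ^ 2 := by
      refine lt_of_le_of_lt h3 ?_
      rw [mul_pow]
      apply Nat.mul_lt_mul_of_pos_right
      · nlinarith [hp.one_lt]
      · exact pow_pos Nat.card_pos 2
    have h5 := lt_of_pow_lt_pow_left₀ 2 (Nat.zero_le _) h4
    rw [hnP, hnL, hn0, ← pow_add] at *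
    rw [← pow_succ'] at h5
    exact hple _ _ h5
  have hend : ∀ M : Subgroup P', z' ∈ M → β.range ≤ M → Nat.card M ≤ 4 → Nat.card β.range = 4 →
      L1 = L0 → 16 ≤ Nat.card P := by
    intro M hz'M hM hM4 hb4 h10
    have hbM : β.range = M := Subgroup.eq_of_le_of_card_ge hM (by omega)
    rw [← hbM] at hz'M
    obtain ⟨l2, hl2⟩ := hz'M
    refine (S.propI ((Ω'.comap β).map α) ?_ ?_).2.2.2
    · rw [eq_bot_iff]
      rintro _ ⟨⟨l, hl, rfl⟩, h2⟩
      have : l ∈ L1 := h10 ▸ (⟨h2, hl⟩ : l ∈ L0)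
      exact this.1
    · intro h
      have h2 : β l2 ∈ Ω' := hl2 ▸ Subgroup.mem_zpowers z'
      have h1 : α l2 = 1 := by
        have : α l2 ∈ (Ω'.comap β).map α := ⟨l2, h2, rfl⟩
        rwa [h] at this
      have : l2 ∈ L1 := h10 ▸ (⟨by simp [h1, Ω.one_mem], h2⟩ : l2 ∈ L0)
      exact S'.z1 (hl2 ▸ this.2)
  have hzN : ∀ M : Subgroup P', z' ∈ Subgroup.normalizer (M : Set P') := by
    intro M
    rw [Subgroup.mem_normalizer_iff]
    intro h
    rw [← S'.zc h]; simp
  have hnorm : ∀ (N : Subgroup L), N.Normal → β.range ≤ Subgroup.normalizer ((N.map β : Subgroup P') : Set P') := by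
    rintro N hN _ ⟨l, rfl⟩
    have key : ∀ l h, h ∈ N.map β → β l * h * (β l)⁻¹ ∈ N.map β := by
      rintro l _ ⟨m, hm, rfl⟩
      exact ⟨l * m * l⁻¹, hN.conj_mem m hm l, by simp⟩
    rw [Subgroup.mem_normalizer_iff]
    intro h
    refine ⟨key l h, fun hh => ?_⟩
    have := key l⁻¹ _ hh
    simpa [mul_assoc] using this
  have hXcase : X ≠ ⊥ → Nat.card β.range ≤ 4 → False := by
    intro h hb
    obtain ⟨-, h2, -, h16⟩ := S.propI X hXΩ h
    rw [h2] at hkd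
    have e1 : Nat.card L ≤ 8 * Nat.card L1 := by
      rw [← hcb, ← hkd]; nlinarith
    have e2 : 16 * Nat.card L1 ≤ Nat.card L := (Nat.mul_le_mul h16 hl10).trans hmain
    omega
  by_cases hYb : Y = ⊥
  · rw [hYb] at hkc
    simp only [Subgroup.card_bot, one_mul] at hkc
    rw [← hkc] at hca
    have haP : Nat.card α.range ≤ Nat.card P := Subgroup.card_le_card_group _
    have e1 : Nat.card P * Nat.card L0 ≤ Nat.card P * Nat.card L1 := by
      refine hmain.trans ?_
      rw [← hca]; gcongr
    have e2 : Nat.card L0 ≤ Nat.card L1 := Nat.le_of_mul_le_mul_left e1 (by omega)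
    have h10 := heq01 e2
    have e3 : Nat.card P ≤ Nat.card α.range := by
      rw [← hca, ← h10] at hmain
      exact Nat.le_of_mul_le_mul_right hmain hl1pos
    have hsurj : α.range = ⊤ := Subgroup.eq_top_of_card_eq _ (le_antisymm haP e3)
    obtain ⟨l, hl⟩ : z ∈ α.range := hsurj ▸ Subgroup.mem_top z
    have hΩn : Ω.Normal := by
      refine ⟨?_⟩
      rintro _ ⟨i, rfl⟩ x
      have : Commute x z := S.zc x
      refine ⟨i, ?_⟩
      simp only
      rw [(this.zpow_right i).eq]; group
    obtain ⟨rfl, -, h4, h16⟩ := S'.propI ((Ω.comap α).map β) (by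
      rw [eq_bot_iff]
      rintro _ ⟨⟨l, hl, rfl⟩, h2⟩
      have : l ∈ L1 := h10 ▸ (⟨hl, h2⟩ : l ∈ L0)
      exact this.2) (by
      intro h
      have h2 : α l ∈ Ω := hl ▸ Subgroup.mem_zpowers z
      have h1 : β l = 1 := by
        have : β l ∈ (Ω.comap α).map β := ⟨l, h2, rfl⟩
        rwa [h] at this
      have : l ∈ L1 := h10 ▸ (⟨h2, by simp [h1, Ω'.one_mem]⟩ : l ∈ L0)
      exact S.z1 (hl ▸ this.1))
    have hbM := hnorm (Ω.comap α) (hΩn.comap α)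
    have hb4 : Nat.card β.range ≤ 4 := (Subgroup.card_le_of_le hbM).trans h4
    by_cases hXb : X = ⊥
    · rw [hXb] at hkd
      simp only [Subgroup.card_bot, one_mul] at hkd
      rw [← hkd] at hcb
      have hab : Nat.card α.range = Nat.card β.range :=
        Nat.eq_of_mul_eq_mul_right hl1pos (hca.trans hcb.symm)
      have hP4 : nP ≤ 2 := by
        have : 2 ^ nP ≤ 2 ^ 2 := by rw [← hnP]; omega
        exact (Nat.pow_le_pow_iff_right (by norm_num)).1 this
      have haP' : Nat.card α.range = Nat.card P := le_antisymm haP e3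
      rcases (by omega : nP = 0 ∨ nP = 1 ∨ nP = 2) with h | h | h
      · rw [h] at hnP; omega
      · rw [h] at hnP
        rw [← hca, haP', hnP, ← h10] at hineq
        have : 0 < (Nat.card L1)^2 := pow_pos hl1pos 2
        have h5 : 16 * (Nat.card L1)^2 ≤ Nat.card P' * (Nat.card L1)^2 := by gcongr
        nlinarith
      · rw [h] at hnP
        have := hend _ (hzN _) hbM h4 (by omega) h10
        omega
    · exact hXcase hXb hb4
  · obtain ⟨rfl, hy2, h4, h16⟩ := S'.propI Y hYΩ hYb
    have hbM := hnorm α.ker inferInstance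
    have hb4 : Nat.card β.range ≤ 4 := (Subgroup.card_le_of_le hbM).trans h4
    by_cases hXb : X = ⊥
    · rw [hXb] at hkd
      simp only [Subgroup.card_bot, one_mul] at hkd
      rw [← hkd] at hcb
      have e1 : Nat.card L ≤ 4 * Nat.card L1 := by rw [← hcb]; gcongr
      have hP4 : nP ≤ 2 := by
        have h1 : Nat.card P * Nat.card L1 ≤ 4 * Nat.card L1 :=
          ((Nat.mul_le_mul_left _ hl10).trans hmain).trans e1
        have : 2 ^ nP ≤ 2 ^ 2 := by rw [← hnP]; exact Nat.le_of_mul_le_mul_right h1 hl1pos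
        exact (Nat.pow_le_pow_iff_right (by norm_num)).1 this
      have e4 : 4 * Nat.card L0 ≤ Nat.card L := by
        rcases (by omega : nP = 0 ∨ nP = 1 ∨ nP = 2) with h | h | h
        · rw [h] at hnP; omega
        · rw [h] at hnP
          rw [hnP] at hineq
          have h6 : (2 * Nat.card L0)^2 < (Nat.card L)^2 := by
            have : 0 < (Nat.card L0)^2 := pow_pos Nat.card_pos 2
            have h5 : 16 * (Nat.card L0)^2 ≤ Nat.card P' * (Nat.card L0)^2 := by gcongr
            nlinarith
          have h7 := lt_of_pow_lt_pow_left₀ 2 (Nat.zero_le _) h6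
          rw [hn0, hnL] at *
          rw [← pow_succ'] at h7
          have := (Nat.pow_lt_pow_iff_right (by norm_num)).1 h7
          calc 4 * 2 ^ n0 = 2 ^ (n0 + 2) := by ring
            _ ≤ _ := Nat.pow_le_pow_right two_pos (by omega)
        · rw [h] at hnP; rw [hnP] at hmain; exact hmain
      have h10 := heq01 (by omega)
      have hb : Nat.card β.range = 4 := by
        have : 4 * Nat.card L1 ≤ Nat.card β.range * Nat.card L1 := by rw [hcb, h10]; exact e4
        have := Nat.le_of_mul_le_mul_right this hl1pos
        omega
      have := hend _ (hzN _) hbM h4 hb h10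
      have : Nat.card P ≤ 2 ^ 2 := by rw [hnP]; exact Nat.pow_le_pow_right two_pos hP4
      omega
    · exact hXcase hXb hb4

end Genotype

namespace Genotype

theorem card_mul_relIndex {G : Type} [Group G] {K M : Subgroup G} (h : K ≤ M) :
    Nat.card K * K.relIndex M = Nat.card M := by
  rw [← Subgroup.relIndex_bot_left, ← Subgroup.relIndex_bot_left]
  exact Subgroup.relIndex_mul_relIndex _ _ _ bot_le h

theorem dich {G : Type} [Group G] [Finite G] {p : ℕ} (hp : p.Prime) (hG : IsPGroup p G)
    {K Z : Subgroup G} (h : K ≤ Z) (hc : Nat.card Z = p * Nat.card K) {M : Subgroup G} (hM : M ≤ Z) :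
    Nat.card M = Nat.card (K ⊓ M : Subgroup G) ∨ Nat.card M = p * Nat.card (K ⊓ M : Subgroup G) := by
  have h1 : K.relIndex Z = p := by
    have := card_mul_relIndex h
    rw [hc, mul_comm p] at this
    exact Nat.eq_of_mul_eq_mul_left Nat.card_pos this
  have h2 : K.relIndex M ≤ p := h1 ▸ Subgroup.relIndex_le_of_le_right hM (by rw [h1]; exact hp.ne_zero)
  have h3 : Nat.card (K ⊓ M : Subgroup G) * K.relIndex M = Nat.card M := by
    rw [← Subgroup.inf_relIndex_right]; exact card_mul_relIndex inf_le_right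
  have := Fact.mk hp
  obtain ⟨m, hm⟩ := IsPGroup.iff_card.1 (hG.to_subgroup M)
  obtain ⟨j, -, hj⟩ := (Nat.dvd_prime_pow hp).1 (hm ▸ Dvd.intro_left _ h3)
  have : j ≤ 1 := by
    by_contra hh
    rw [hj] at h2
    have : p ^ 2 ≤ p ^ j := Nat.pow_le_pow_right hp.pos (by omega)
    have := hp.two_le
    nlinarith
  rcases (by omega : j = 0 ∨ j = 1) with rfl | rfl
  · left; rw [← h3, hj]; simp
  · right; rw [← h3, hj, pow_one, mul_comm]

def wf {G : Type} [Group G] (p : ℕ) (K Z : Subgroup G) (g : G) : ℚ :=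
  (p : ℚ) * (if g ∈ K then 1 else 0) - (if g ∈ Z then 1 else 0)

theorem sum_mem {G : Type} [Group G] [Fintype G] (K : Subgroup G) :
    ∑ g : G, (if g ∈ K then (1:ℚ) else 0) = Nat.card K := by
  rw [Finset.sum_boole, Nat.card_eq_fintype_card, Fintype.card_subtype]

theorem sum_wf_mul {G : Type} [Group G] [Fintype G] (p : ℕ) (K Z K' Z' : Subgroup G) :
    ∑ g : G, wf p K Z g * wf p K' Z' g = (p:ℚ)^2 * Nat.card (K ⊓ K' : Subgroup G)
      - p * Nat.card (K ⊓ Z' : Subgroup G) - p * Nat.card (Z ⊓ K' : Subgroup G)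
      + Nat.card (Z ⊓ Z' : Subgroup G) := by
  have : ∀ A B : Subgroup G, (Nat.card (A ⊓ B : Subgroup G) : ℚ) =
      ∑ g : G, (if g ∈ A then (1:ℚ) else 0) * (if g ∈ B then (1:ℚ) else 0) := by
    intro A B
    rw [← sum_mem]
    refine Finset.sum_congr rfl fun g _ => ?_
    by_cases h1 : g ∈ A <;> by_cases h2 : g ∈ B <;> simp [Subgroup.mem_inf, h1, h2]
  rw [this, this, this, this]
  simp only [Finset.mul_sum]
  rw [← Finset.sum_sub_distrib, ← Finset.sum_sub_distrib, ← Finset.sum_add_distrib]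
  refine Finset.sum_congr rfl fun g _ => ?_
  simp only [wf]; ring

theorem Tlem {G : Type} [Group G] [Fintype G] {p : ℕ} (hp : p.Prime) (hG : IsPGroup p G)
    {K Z K' Z' : Subgroup G} (h : K ≤ Z) (hc : Nat.card Z = p * Nat.card K)
    (h' : K' ≤ Z') (hc' : Nat.card Z' = p * Nat.card K') :
    ((K ⊓ Z' = Z ⊓ K') ∧ ((p:ℚ) - 1) * Nat.card (Z ⊓ Z' : Subgroup G) ≤ ∑ g : G, wf p K Z g * wf p K' Z' g)
     ∨ ∑ g : G, wf p K Z g * wf p K' Z' g = 0 := by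
  rw [sum_wf_mul]
  have hp1 : (1:ℚ) < p := by exact_mod_cast hp.one_lt
  have hp2 : (2:ℚ) ≤ p := by exact_mod_cast hp.two_le
  have d1 := dich hp hG h hc (inf_le_left : Z ⊓ Z' ≤ Z)
  rw [← inf_assoc, inf_eq_left.2 h] at d1
  have d2 := dich hp hG h' hc' (inf_le_right : Z ⊓ Z' ≤ Z')
  rw [show K' ⊓ (Z ⊓ Z') = Z ⊓ K' by rw [inf_left_comm, inf_eq_left.2 h']] at d2
  have d3 := dich hp hG h hc (inf_le_left : Z ⊓ K' ≤ Z)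
  rw [← inf_assoc, inf_eq_left.2 h] at d3
  have d4 := dich hp hG h' hc' (inf_le_right : K ⊓ Z' ≤ Z')
  rw [show K' ⊓ (K ⊓ Z') = K ⊓ K' by rw [inf_left_comm, inf_eq_left.2 h']] at d4
  by_cases he : K ⊓ Z' = Z ⊓ K'
  · left
    refine ⟨he, ?_⟩
    have e1 : K ⊓ K' = K ⊓ Z' := le_antisymm (inf_le_inf_left _ h') (le_inf inf_le_left (he.trans_le inf_le_right))
    have e2 : Nat.card (K ⊓ Z' : Subgroup G) = Nat.card (Z ⊓ K' : Subgroup G) := by rw [he]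
    rw [e1, ← e2]
    have hd : (0:ℚ) < Nat.card (K ⊓ Z' : Subgroup G) := by exact_mod_cast Nat.card_pos
    rcases d1 with d1 | d1
    · rw [d1]; nlinarith [mul_nonneg (mul_pos (sub_pos.2 hp1) hd).le (sub_nonneg.2 hp2)]
    · rw [d1]; push_cast; nlinarith
  · right
    set m := Nat.card (Z ⊓ Z' : Subgroup G)
    set a := Nat.card (K ⊓ Z' : Subgroup G) with ha
    set b := Nat.card (Z ⊓ K' : Subgroup G) with hb
    set d := Nat.card (K ⊓ K' : Subgroup G) with hd
    -- equal cards imply equality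
    have ad : a = d → K ⊓ K' = K ⊓ Z' := fun e =>
      Subgroup.eq_of_le_of_card_ge (inf_le_inf_left _ h') e.le
    have bd : b = d → K ⊓ K' = Z ⊓ K' := fun e =>
      Subgroup.eq_of_le_of_card_ge (inf_le_inf_right _ h) e.le
    have am : m = a → K ⊓ Z' = Z ⊓ Z' := fun e =>
      Subgroup.eq_of_le_of_card_ge (inf_le_inf_right _ h) e.le
    have bm : m = b → Z ⊓ K' = Z ⊓ Z' := fun e =>
      Subgroup.eq_of_le_of_card_ge (inf_le_inf_left _ h') e.le
    have hnd : ¬ (a = d ∧ b = d) := fun ⟨e1, e2⟩ => he ((ad e1).symm.trans (bd e2))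
    have ham : m = a → b = d := by
      intro e
      have e1 := am e
      have : Z ⊓ K' ≤ K ⊓ K' := le_inf ((inf_le_inf_left Z h').trans (e1.symm.le.trans inf_le_left)) inf_le_right
      have e2 : Z ⊓ K' = K ⊓ K' := le_antisymm this (inf_le_inf_right _ h)
      rw [hb, e2]
    have hbm : m = b → a = d := by
      intro e
      have e1 := bm e
      have : K ⊓ Z' ≤ K ⊓ K' := le_inf inf_le_left ((inf_le_inf_right Z' h).trans (e1.symm.le.trans inf_le_right))
      have e2 : K ⊓ Z' = K ⊓ K' := le_antisymm this (inf_le_inf_left _ h')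
      rw [ha, e2]
    by_cases c1 : m = a
    · have e1 := ham c1
      have e2 : a = p * d := d4.resolve_left fun e => hnd ⟨e, e1⟩
      rw [c1, e1, e2]; push_cast; ring
    · by_cases c2 : m = b
      · have e1 := hbm c2
        have e2 : b = p * d := d3.resolve_left fun e => hnd ⟨e1, e⟩
        rw [c2, e1, e2]; push_cast; ring
      · have e1 := d1.resolve_left c1
        have e2 := d2.resolve_left c2
        have e3 : a = b := Nat.eq_of_mul_eq_mul_left hp.pos (e1.symm.trans e2)
        have e4 : a = p * d := d4.resolve_left fun e => hnd ⟨e, e3 ▸ e⟩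
        rw [e1, ← e3, e4]; push_cast; ring

end Genotype

namespace Genotype

def Kg {G : Type} [Group G] (H : Subgroup G) (K : Subgroup H) : Subgroup G := K.map H.subtype

def Zg {G : Type} [Group G] (H : Subgroup G) (K : Subgroup H) [K.Normal] (z : H ⧸ K) : Subgroup G :=
  ((Subgroup.zpowers z).comap (QuotientGroup.mk' K)).map H.subtype

theorem mem_Kg {G : Type} [Group G] {H : Subgroup G} {K : Subgroup H} [K.Normal] {g : G} :
    g ∈ Kg H K ↔ ∃ h : g ∈ H, ((⟨g, h⟩ : H) : H ⧸ K) = 1 := by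
  constructor
  · rintro ⟨⟨x, hx⟩, hk, rfl⟩
    exact ⟨hx, (QuotientGroup.eq_one_iff _).2 hk⟩
  · rintro ⟨h, hk⟩
    exact ⟨⟨g, h⟩, (QuotientGroup.eq_one_iff _).1 hk, rfl⟩

theorem mem_Zg {G : Type} [Group G] {H : Subgroup G} {K : Subgroup H} [K.Normal] {z : H ⧸ K} {g : G} :
    g ∈ Zg H K z ↔ ∃ h : g ∈ H, ((⟨g, h⟩ : H) : H ⧸ K) ∈ Subgroup.zpowers z := by
  constructor
  · rintro ⟨⟨x, hx⟩, hk, rfl⟩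
    exact ⟨hx, hk⟩
  · rintro ⟨h, hk⟩
    exact ⟨⟨g, h⟩, hk, rfl⟩

theorem Kg_le_Zg {G : Type} [Group G] {H : Subgroup G} {K : Subgroup H} [K.Normal] {z : H ⧸ K} :
    Kg H K ≤ Zg H K z := by
  intro g hg
  obtain ⟨h, hk⟩ := mem_Kg.1 hg
  exact mem_Zg.2 ⟨h, hk ▸ Subgroup.one_mem _⟩

theorem card_Kg {G : Type} [Group G] (H : Subgroup G) (K : Subgroup H) :
    Nat.card (Kg H K) = Nat.card K := Subgroup.card_map_of_injective H.subtype_injective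

theorem card_Zg {G : Type} [Group G] [Finite G] (H : Subgroup G) (K : Subgroup H) [K.Normal] (z : H ⧸ K)
    (p : ℕ) (hz : orderOf z = p) : Nat.card (Zg H K z) = p * Nat.card K := by
  rw [Zg, Subgroup.card_map_of_injective H.subtype_injective]
  have h1 := Subgroup.card_mul_index ((Subgroup.zpowers z).comap (QuotientGroup.mk' K))
  rw [Subgroup.index_comap_of_surjective _ (QuotientGroup.mk'_surjective K),
    Subgroup.card_eq_card_quotient_mul_card_subgroup K, ← Subgroup.card_mul_index (Subgroup.zpowers z),
    Nat.card_zpowers, hz] at h1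
  have h0 : 0 < (Subgroup.zpowers z).index := Nat.pos_of_ne_zero Subgroup.index_ne_zero_of_finite
  apply Nat.eq_of_mul_eq_mul_right h0
  rw [h1]; ring

theorem wf_conj {G : Type} [Group G] {H : Subgroup G} {K : Subgroup H} [K.Normal] {z : H ⧸ K}
    (hz : ∀ x, x * z = z * x) (p : ℕ) {h : G} (hh : h ∈ H) (g : G) :
    wf p (Kg H K) (Zg H K z) (h⁻¹ * g * h) = wf p (Kg H K) (Zg H K z) g := by
  have hcc : ∀ y : H ⧸ K, ∀ w ∈ Subgroup.zpowers z, y⁻¹ * w * y = w := by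
    rintro y _ ⟨i, rfl⟩
    have : Commute y z := hz y
    simp only
    rw [mul_assoc, ← (this.zpow_right i).eq]; group
  have aux : ∀ (h : G) (hh : h ∈ H) (g : G) (hg : g ∈ H),
      ((⟨h⁻¹ * g * h, H.mul_mem (H.mul_mem (H.inv_mem hh) hg) hh⟩ : H) : H ⧸ K)
        = ((⟨h, hh⟩ : H) : H ⧸ K)⁻¹ * ((⟨g, hg⟩ : H) : H ⧸ K) * ((⟨h, hh⟩ : H) : H ⧸ K) := by
    intro h hh g hg; rfl
  have k1 : ∀ h ∈ H, ∀ g, g ∈ Kg H K → h⁻¹ * g * h ∈ Kg H K := by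
    intro h hh g hg
    obtain ⟨h1, h2⟩ := mem_Kg.1 hg
    refine mem_Kg.2 ⟨H.mul_mem (H.mul_mem (H.inv_mem hh) h1) hh, ?_⟩
    rw [aux h hh g h1, h2]; group
  have k2 : ∀ h ∈ H, ∀ g, g ∈ Zg H K z → h⁻¹ * g * h ∈ Zg H K z := by
    intro h hh g hg
    obtain ⟨h1, h2⟩ := mem_Zg.1 hg
    refine mem_Zg.2 ⟨H.mul_mem (H.mul_mem (H.inv_mem hh) h1) hh, ?_⟩
    rw [aux h hh g h1, hcc _ _ h2]; exact h2
  have e1 : h⁻¹ * g * h ∈ Kg H K ↔ g ∈ Kg H K := by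
    refine ⟨fun hg => ?_, k1 h hh g⟩
    have := k1 h⁻¹ (H.inv_mem hh) _ hg
    simpa [mul_assoc] using this
  have e2 : h⁻¹ * g * h ∈ Zg H K z ↔ g ∈ Zg H K z := by
    refine ⟨fun hg => ?_, k2 h hh g⟩
    have := k2 h⁻¹ (H.inv_mem hh) _ hg
    simpa [mul_assoc] using this
  simp only [wf, e1, e2]

def indSum {G R : Type} [Group G] [Fintype G] [CommRing R] (v : G → R) (g : G) : R :=
  ∑ x : G, v (x⁻¹ * g * x)

theorem indSum_conj {G R : Type} [Group G] [Fintype G] [CommRing R] (v : G → R) (y g : G) :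
    indSum v (y⁻¹ * g * y) = indSum v g := by
  unfold indSum
  refine Fintype.sum_equiv (Equiv.mulLeft y) _ _ fun x => ?_
  congr 1
  simp only [Equiv.coe_mulLeft]; group

theorem sum_mul_indSum {G R : Type} [Group G] [Fintype G] [CommRing R] (f v : G → R)
    (hf : ∀ y g, f (y⁻¹ * g * y) = f g) :
    ∑ g, f g * indSum v g = (Nat.card G : R) * ∑ g, f g * v g := by
  unfold indSum
  simp only [Finset.mul_sum]
  rw [Finset.sum_comm]
  have : ∀ y : G, ∑ g, f g * v (y⁻¹ * g * y) = ∑ g, f g * v g := by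
    intro y
    refine Fintype.sum_equiv ((MulAut.conj y⁻¹).toEquiv) _ _ fun g => ?_
    have e : (MulAut.conj y⁻¹).toEquiv g = y⁻¹ * g * y := by simp
    rw [e, hf]
  rw [Finset.sum_congr rfl fun y _ => this y, Finset.sum_const, Finset.card_univ, nsmul_eq_mul,
    Nat.card_eq_fintype_card, Finset.mul_sum]

theorem sum_wf {G : Type} [Group G] [Fintype G] {p : ℕ} {K Z : Subgroup G}
    (hc : Nat.card Z = p * Nat.card K) : ∑ g : G, wf p K Z g = 0 := by
  unfold wf
  rw [Finset.sum_sub_distrib, ← Finset.mul_sum, sum_mem, sum_mem, hc]; push_cast; ring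

theorem wf_one {G : Type} [Group G] (p : ℕ) (K Z : Subgroup G) : wf p K Z 1 = p - 1 := by
  simp [wf, K.one_mem, Z.one_mem]

theorem indSum_wf_one {G : Type} [Group G] [Fintype G] (p : ℕ) (K Z : Subgroup G) :
    indSum (wf p K Z) 1 = Nat.card G * ((p:ℚ) - 1) := by
  simp [indSum, wf_one]; ring

/-- double coset inequality -/
theorem dc_ineq {G : Type} [Group G] [Fintype G] (H H' : Subgroup G) (T : G → ℚ) (hT0 : ∀ x, 0 ≤ T x)
    (hT : ∀ h' ∈ H', ∀ h ∈ H, ∀ x, T (h' * x * h) = T x) (x : G) :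
    (Nat.card H : ℚ) * Nat.card H' * T x ≤
      Nat.card (H' ⊓ H.map (MulAut.conj x).toMonoidHom : Subgroup G) * ∑ y, T y := by
  set L := H' ⊓ H.map (MulAut.conj x).toMonoidHom
  have e1 : ∑ q : H' × H, T (q.1 * x * q.2) = (Nat.card H : ℚ) * Nat.card H' * T x := by
    rw [Finset.sum_congr rfl fun q _ => hT q.1 q.1.2 q.2 q.2.2 x, Finset.sum_const, Finset.card_univ,
      Fintype.card_prod, nsmul_eq_mul, Nat.card_eq_fintype_card, Nat.card_eq_fintype_card]
    push_cast; ring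
  rw [← e1, ← Finset.sum_fiberwise (g := fun q : H' × H => (q.1 * x * q.2 : G)), Finset.mul_sum]
  refine Finset.sum_le_sum fun y _ => ?_
  rw [Finset.sum_congr rfl (g := fun _ => T y) (fun q hq => by rw [(Finset.mem_filter.1 hq).2]),
    Finset.sum_const, nsmul_eq_mul]
  refine mul_le_mul_of_nonneg_right ?_ (hT0 y)
  norm_cast
  set s := Finset.univ.filter (fun q : H' × H => (q.1 * x * q.2 : G) = y)
  rcases s.eq_empty_or_nonempty with h | ⟨q0, hq0⟩
  · rw [h]; simp
  have hq0' : (q0.1 * x * q0.2 : G) = y := (Finset.mem_filter.1 hq0).2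
  rw [Nat.card_eq_fintype_card, ← Finset.card_univ]
  have hmem : ∀ q ∈ s, (q0.1 : G)⁻¹ * q.1 ∈ L := by
    intro q hq
    have hq' : (q.1 * x * q.2 : G) = y := (Finset.mem_filter.1 hq).2
    refine ⟨H'.mul_mem (H'.inv_mem q0.1.2) q.1.2, q0.2 * (q.2 : G)⁻¹, H.mul_mem q0.2.2 (H.inv_mem q.2.2), ?_⟩
    have : (q.1 : G) = q0.1 * x * q0.2 * (q.2:G)⁻¹ * x⁻¹ := by rw [hq0', ← hq']; group
    rw [this]
    simp [mul_assoc]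
  refine Finset.card_le_card_of_injOn
    (fun q => if h : (q0.1 : G)⁻¹ * q.1 ∈ L then (⟨_, h⟩ : L) else 1) (fun _ _ => Finset.mem_coe.2 (Finset.mem_univ _)) ?_
  intro q hq q' hq' heq
  simp only [dif_pos (hmem q hq), dif_pos (hmem q' hq'), Subtype.mk.injEq, mul_right_inj] at heq
  have h1 : (q.1 * x * q.2 : G) = y := (Finset.mem_filter.1 hq).2
  have h2 : (q'.1 * x * q'.2 : G) = y := (Finset.mem_filter.1 hq').2
  rw [← heq, ← h1] at h2
  have h3 := mul_left_cancel h2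
  exact Prod.ext (Subtype.ext heq) (Subtype.ext h3.symm)

end Genotype

namespace Genotype

theorem mem_conj_map {G : Type} [Group G] (M : Subgroup G) (x g : G) :
    g ∈ M.map (MulAut.conj x).toMonoidHom ↔ x⁻¹ * g * x ∈ M := by
  constructor
  · rintro ⟨m, hm, rfl⟩
    simpa [mul_assoc] using hm
  · intro h
    exact ⟨_, h, by simp [mul_assoc]⟩

theorem card_conj_map {G : Type} [Group G] (M : Subgroup G) (x : G) :
    Nat.card (M.map (MulAut.conj x).toMonoidHom) = Nat.card M :=
  Subgroup.card_map_of_injective (MulAut.conj x).injective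

theorem counting_lt {G : Type} [Group G] [Fintype G] (p : ℕ) (hp : p.Prime) (hG : IsPGroup p G)
    (H : Subgroup G) (K : Subgroup H) [K.Normal] (H' : Subgroup G) (K' : Subgroup H') [K'.Normal]
    {A : Subgroup (H ⧸ K)} {z : H ⧸ K} (S : RS p (H ⧸ K) A z)
    {A' : Subgroup (H' ⧸ K')} {z' : H' ⧸ K'} (S' : RS p (H' ⧸ K') A' z')
    (hW : ∀ g, indSum (wf p (Kg H K) (Zg H K z)) g = indSum (wf p (Kg H' K') (Zg H' K' z')) g)
    (hS : ∑ g, (indSum (wf p (Kg H K) (Zg H K z)) g) ^ 2 =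
      Nat.card G * (p * (p - 1) * Nat.card K * Nat.card H))
    (hS' : ∑ g, (indSum (wf p (Kg H' K') (Zg H' K' z')) g) ^ 2 =
      Nat.card G * (p * (p - 1) * Nat.card K' * Nat.card H'))
    (hlt : Nat.card (H ⧸ K) < Nat.card (H' ⧸ K')) : False := by
  have := Fact.mk hp
  have hoz : orderOf z = p := orderOf_eq_prime S.zp S.z1
  have hoz' : orderOf z' = p := orderOf_eq_prime S'.zp S'.z1
  set w := wf p (Kg H K) (Zg H K z) with hw
  set w' := wf p (Kg H' K') (Zg H' K' z') with hw'
  have hp1 : (0:ℚ) < p - 1 := by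
    have : (1:ℚ) < p := by exact_mod_cast hp.one_lt
    linarith
  have hpp : (0:ℚ) < p := by exact_mod_cast hp.pos
  have cpos : ∀ M : Subgroup G, (0:ℚ) < Nat.card M := fun M => by exact_mod_cast Nat.card_pos
  have hGpos : (0:ℚ) < Nat.card G := by exact_mod_cast Nat.card_pos
  have hKpos : (0:ℚ) < Nat.card K := by exact_mod_cast Nat.card_pos
  have hKpos' : (0:ℚ) < Nat.card K' := by exact_mod_cast Nat.card_pos
  let T : G → ℚ := fun x => ∑ g, w (x⁻¹ * g * x) * w' g
  have hKH : (Nat.card K : ℚ) * Nat.card H = Nat.card K' * Nat.card H' := by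
    rw [Finset.sum_congr rfl fun g _ => by rw [hW g], hS'] at hS
    have h1 := mul_left_cancel₀ hGpos.ne' hS
    have h2 : (p:ℚ) * (p - 1) ≠ 0 := (mul_pos hpp hp1).ne'
    apply mul_left_cancel₀ h2
    linarith
  have hsT : ∑ x, T x = p * (p - 1) * Nat.card K * Nat.card H := by
    apply mul_left_cancel₀ hGpos.ne'
    rw [← hS]
    have e1 : ∀ g, (indSum w g)^2 = indSum w g * indSum w' g := fun g => by rw [pow_two]; rw [← hW g]
    rw [Finset.sum_congr rfl fun g _ => e1 g, sum_mul_indSum _ _ (indSum_conj w)]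
    congr 1
    simp only [T, indSum, Finset.sum_mul]
    exact Finset.sum_comm
  -- shift
  have hTc : ∀ h' ∈ H', ∀ h ∈ H, ∀ x, T (h' * x * h) = T x := by
    intro h' hh' h hh x
    refine Fintype.sum_equiv ((MulAut.conj h'⁻¹).toEquiv) _ _ fun g => ?_
    have e : (MulAut.conj h'⁻¹).toEquiv g = h'⁻¹ * g * h' := by simp
    have e2 : w' (h'⁻¹ * g * h') = w' g := wf_conj S'.zc p hh' g
    have e3 : w (h⁻¹ * (x⁻¹ * (h'⁻¹ * g * h') * x) * h) = w (x⁻¹ * (h'⁻¹ * g * h') * x) :=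
      wf_conj S.zc p hh (x⁻¹ * (h'⁻¹ * g * h') * x)
    rw [e, e2, ← e3]
    congr 2
    group
  have hKx : ∀ x g, w (x⁻¹ * g * x) = wf p ((Kg H K).map (MulAut.conj x).toMonoidHom)
      ((Zg H K z).map (MulAut.conj x).toMonoidHom) g := by
    intro x g
    simp only [hw, wf, mem_conj_map]
  have hcc : Nat.card (Zg H K z) = p * Nat.card (Kg H K) := by rw [card_Zg H K z p hoz, card_Kg]
  have hcc' : Nat.card (Zg H' K' z') = p * Nat.card (Kg H' K') := by rw [card_Zg H' K' z' p hoz', card_Kg]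
  have hTl : ∀ x, ((Kg H K).map (MulAut.conj x).toMonoidHom ⊓ Zg H' K' z' =
      (Zg H K z).map (MulAut.conj x).toMonoidHom ⊓ Kg H' K' ∧
      ((p:ℚ) - 1) * Nat.card ((Zg H K z).map (MulAut.conj x).toMonoidHom ⊓ Zg H' K' z' : Subgroup G) ≤ T x) ∨ T x = 0 := by
    intro x
    have := Tlem hp hG (K := (Kg H K).map (MulAut.conj x).toMonoidHom)
      (Z := (Zg H K z).map (MulAut.conj x).toMonoidHom) (Subgroup.map_mono Kg_le_Zg)
      (by rw [card_conj_map, card_conj_map, hcc]) (Kg_le_Zg (z := z')) hcc'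
    simp only [T, hKx]
    exact this
  have hT0 : ∀ x, 0 ≤ T x := by
    intro x
    rcases hTl x with h | h
    · exact le_trans (mul_pos hp1 (cpos _)).le h.2
    · exact h.ge
  obtain ⟨x, hx⟩ : ∃ x, T x ≠ 0 := by
    by_contra hne
    push Not at hne
    rw [Finset.sum_congr rfl fun x _ => hne x, Finset.sum_const_zero] at hsT
    have : (0:ℚ) < p * (p - 1) * Nat.card K * Nat.card H :=
      mul_pos (mul_pos (mul_pos hpp hp1) hKpos) (cpos H)
    linarith
  obtain ⟨hxe, hxT⟩ := (hTl x).resolve_right hx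
  have hdc := dc_ineq H H' T hT0 hTc x
  rw [hsT] at hdc
  set L := H' ⊓ H.map (MulAut.conj x).toMonoidHom with hL
  set M := (Zg H K z).map (MulAut.conj x).toMonoidHom ⊓ Zg H' K' z' with hM
  have i1 : (Nat.card H : ℚ) * Nat.card H' * ((p - 1) * Nat.card M) ≤
      Nat.card L * (p * (p - 1) * Nat.card K * Nat.card H) :=
    le_trans (mul_le_mul_of_nonneg_left hxT (mul_pos (cpos H) (cpos H')).le) hdc
  have i2 : (Nat.card H' : ℚ) * Nat.card M ≤ p * Nat.card L * Nat.card K := by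
    have : ((Nat.card H : ℚ) * (p - 1)) * (Nat.card H' * Nat.card M) ≤
      ((Nat.card H : ℚ) * (p - 1)) * (p * Nat.card L * Nat.card K) := by linarith
    exact le_of_mul_le_mul_left this (mul_pos (cpos H) hp1)
  have i3 : (Nat.card H : ℚ) * Nat.card M ≤ p * Nat.card L * Nat.card K' := by
    have : ((Nat.card H' : ℚ) * (p - 1)) * (Nat.card H * Nat.card M) ≤
      ((Nat.card H' : ℚ) * (p - 1)) * (p * Nat.card L * Nat.card K') := by
      have e : (Nat.card L : ℚ) * (p * (p - 1) * Nat.card K * Nat.card H) =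
        ((Nat.card H' : ℚ) * (p - 1)) * (p * Nat.card L * Nat.card K') := by
        calc (Nat.card L : ℚ) * (p * (p - 1) * Nat.card K * Nat.card H) =
            Nat.card L * p * (p - 1) * (Nat.card K * Nat.card H) := by ring
          _ = _ := by rw [hKH]; ring
      rw [← e]; linarith
    exact le_of_mul_le_mul_left this (mul_pos (cpos H') hp1)
  have cH : Nat.card H = Nat.card (H ⧸ K) * Nat.card K := Subgroup.card_eq_card_quotient_mul_card_subgroup K
  have cH' : Nat.card H' = Nat.card (H' ⧸ K') * Nat.card K' := Subgroup.card_eq_card_quotient_mul_card_subgroup K'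
  have i4 : Nat.card (H ⧸ K) * Nat.card (H' ⧸ K') * (Nat.card M)^2 ≤ p ^ 2 * (Nat.card L)^2 := by
    have j := mul_le_mul i2 i3 (mul_pos (cpos H) (cpos M)).le
      (mul_pos (mul_pos hpp (cpos L)) hKpos).le
    rw [cH, cH'] at j
    push_cast at j
    have : ((Nat.card K : ℚ) * Nat.card K') * (Nat.card (H ⧸ K) * Nat.card (H' ⧸ K') * (Nat.card M)^2) ≤
        ((Nat.card K : ℚ) * Nat.card K') * (p ^ 2 * (Nat.card L)^2) := by linarith
    exact_mod_cast le_of_mul_le_mul_left this (mul_pos hKpos hKpos')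
  have hmL : ∀ l : L, x⁻¹ * (l:G) * x ∈ H := fun l => (mem_conj_map H x l).1 l.2.2
  let α0 : L →* H := ⟨⟨fun l => ⟨x⁻¹ * (l:G) * x, hmL l⟩, Subtype.ext (by simp)⟩, fun a b => Subtype.ext (by simp [mul_assoc])⟩
  let β0 : L →* H' := Subgroup.inclusion inf_le_left
  let α : L →* H ⧸ K := (QuotientGroup.mk' K).comp α0
  let β : L →* H' ⧸ K' := (QuotientGroup.mk' K').comp β0
  have a1 : ∀ l : L, α l ∈ Subgroup.zpowers z ↔ (l:G) ∈ (Zg H K z).map (MulAut.conj x).toMonoidHom := by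
    intro l
    rw [mem_conj_map, mem_Zg]
    exact ⟨fun h => ⟨hmL l, h⟩, fun ⟨_, h⟩ => h⟩
  have a2 : ∀ l : L, α l = 1 ↔ (l:G) ∈ (Kg H K).map (MulAut.conj x).toMonoidHom := by
    intro l
    rw [mem_conj_map, mem_Kg]
    exact ⟨fun h => ⟨hmL l, h⟩, fun ⟨_, h⟩ => h⟩
  have b1 : ∀ l : L, β l ∈ Subgroup.zpowers z' ↔ (l:G) ∈ Zg H' K' z' := by
    intro l
    rw [mem_Zg]
    exact ⟨fun h => ⟨l.2.1, h⟩, fun ⟨_, h⟩ => h⟩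
  have b2 : ∀ l : L, β l = 1 ↔ (l:G) ∈ Kg H' K' := by
    intro l
    rw [mem_Kg]
    exact ⟨fun h => ⟨l.2.1, h⟩, fun ⟨_, h⟩ => h⟩
  have hLM : Nat.card ((Subgroup.zpowers z).comap α ⊓ (Subgroup.zpowers z').comap β : Subgroup L) = Nat.card M := by
    suffices hh : Subgroup.map L.subtype ((Subgroup.zpowers z).comap α ⊓ (Subgroup.zpowers z').comap β) = M by
      rw [← hh, Subgroup.card_map_of_injective L.subtype_injective]
    ext g
    constructor
    · rintro ⟨l, ⟨h1, h2⟩, rfl⟩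
      exact ⟨(a1 l).1 h1, (b1 l).1 h2⟩
    · rintro ⟨h1, h2⟩
      have hg : g ∈ L := ⟨(mem_Zg.1 h2).1, (mem_conj_map H x g).2 (mem_Zg.1 ((mem_conj_map _ x g).1 h1)).1⟩
      exact ⟨⟨g, hg⟩, ⟨(a1 ⟨g, hg⟩).2 h1, (b1 ⟨g, hg⟩).2 h2⟩, rfl⟩
  refine core p hp (hG.to_subgroup L) ((hG.to_subgroup H).to_quotient K) ((hG.to_subgroup H').to_quotient K')
    S S' α β ?_ hlt (by rw [hLM]; exact i4)
  intro l h1 h2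
  rw [a1] at h1
  rw [b1] at h2
  rw [a2, b2]
  constructor
  · intro h
    have : (l:G) ∈ (Zg H K z).map (MulAut.conj x).toMonoidHom ⊓ Kg H' K' := hxe ▸ ⟨h, h2⟩
    exact this.2
  · intro h
    have : (l:G) ∈ (Kg H K).map (MulAut.conj x).toMonoidHom ⊓ Zg H' K' z' := hxe.symm ▸ ⟨h1, h⟩
    exact this.1

theorem bound {G : Type} [Group G] [Fintype G] (p : ℕ) (hp : p.Prime) (hG : IsPGroup p G)
    (H : Subgroup G) (K : Subgroup H) [K.Normal]
    {A : Subgroup (H ⧸ K)} {z : H ⧸ K} (S : RS p (H ⧸ K) A z)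
    (hS : ∑ g, (indSum (wf p (Kg H K) (Zg H K z)) g) ^ 2 =
      Nat.card G * (p * (p - 1) * Nat.card K * Nat.card H)) : H.index ≤ Nat.card K := by
  have := Fact.mk hp
  have hoz : orderOf z = p := orderOf_eq_prime S.zp S.z1
  have hcc : Nat.card (Zg H K z) = p * Nat.card (Kg H K) := by rw [card_Zg H K z p hoz, card_Kg]
  set w := wf p (Kg H K) (Zg H K z) with hw
  have hp1 : (0:ℚ) < p - 1 := by
    have : (1:ℚ) < p := by exact_mod_cast hp.one_lt
    linarith
  have hGpos : (0:ℚ) < Nat.card G := by exact_mod_cast Nat.card_pos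
  have hHpos : (0:ℚ) < Nat.card H := by exact_mod_cast Nat.card_pos
  have hKpos : (0:ℚ) < Nat.card K := by exact_mod_cast Nat.card_pos
  have h0 : ∑ g, indSum w g = 0 := by
    have := sum_mul_indSum (fun _ => (1:ℚ)) w (fun _ _ => rfl)
    simp only [one_mul] at this
    rw [this, sum_wf hcc, mul_zero]
  have h1 := indSum_wf_one p (Kg H K) (Zg H K z)
  rw [← hw] at h1
  rw [← Finset.add_sum_erase _ _ (Finset.mem_univ (1:G))] at h0 hS
  have hcs := sq_sum_le_card_mul_sum_sq (s := Finset.univ.erase (1:G)) (f := indSum w)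
  rw [Finset.card_erase_of_mem (Finset.mem_univ _), Finset.card_univ, ← Nat.card_eq_fintype_card] at hcs
  have hc1 : ((Nat.card G - 1 : ℕ) : ℚ) = Nat.card G - 1 := by
    rw [Nat.cast_sub Nat.card_pos]; simp
  rw [hc1] at hcs
  have e1 : ∑ x ∈ Finset.univ.erase (1:G), indSum w x = - indSum w 1 := by linarith
  have e2 : ∑ x ∈ Finset.univ.erase (1:G), indSum w x ^ 2 = Nat.card G * (p * (p - 1) * Nat.card K * Nat.card H) - indSum w 1 ^ 2 := by linarith
  rw [e1, e2, h1] at hcs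
  have hidx : (Nat.card G : ℚ) = Nat.card H * H.index := by exact_mod_cast (Subgroup.card_mul_index H).symm
  have hlt : (H.index : ℚ) * (p - 1) < p * Nat.card K := by
    by_contra hge
    push Not at hge
    have q1 : (Nat.card G : ℚ)^2 * (p - 1) * ((Nat.card G : ℚ) * (p - 1)) ≤
        (Nat.card G : ℚ)^2 * (p - 1) * ((1 - 1 / Nat.card G) * (p * Nat.card K * Nat.card H)) := by
      have : (1:ℚ) / Nat.card G * Nat.card G = 1 := by field_simp
      have r : (Nat.card G : ℚ)^2 * (p - 1) * ((1 - 1 / Nat.card G) * (p * Nat.card K * Nat.card H)) =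
        (Nat.card G - 1) * (Nat.card G * (p * (p - 1) * Nat.card K * Nat.card H)) := by
        field_simp
      rw [r]; linarith
    have q2 := le_of_mul_le_mul_left q1 (mul_pos (pow_pos hGpos 2) hp1)
    have q3 : (1 - 1 / (Nat.card G:ℚ)) * (p * Nat.card K * Nat.card H) < p * Nat.card K * Nat.card H := by
      have : 0 < 1 / (Nat.card G:ℚ) := by positivity
      have : 0 < (p:ℚ) * Nat.card K * Nat.card H := mul_pos (mul_pos (by linarith) hKpos) hHpos
      nlinarith
    have q4 : (p:ℚ) * Nat.card K * Nat.card H ≤ Nat.card G * (p - 1) := by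
      rw [hidx]; nlinarith
    linarith
  have hN : ∃ a, H.index = p ^ a := by
    obtain ⟨m, hm⟩ := IsPGroup.iff_card.1 hG
    obtain ⟨a, -, ha⟩ := (Nat.dvd_prime_pow hp).1 (hm ▸ Subgroup.index_dvd_card H)
    exact ⟨a, ha⟩
  obtain ⟨a, ha⟩ := hN
  obtain ⟨b, hb⟩ := IsPGroup.iff_card.1 ((hG.to_subgroup H).to_subgroup K)
  rw [ha, hb] at hlt ⊢
  by_contra hgt
  push Not at hgt
  have hab := (Nat.pow_lt_pow_iff_right hp.one_lt).1 hgt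
  have : p ^ (b+1) ≤ p ^ a := Nat.pow_le_pow_right hp.pos hab
  have t1 : ((p:ℚ))^(b+1) ≤ p ^ a := by exact_mod_cast this
  push_cast at hlt
  have t2 : (1:ℚ) ≤ p - 1 := by
    have : (2:ℚ) ≤ p := by exact_mod_cast hp.two_le
    linarith
  have t3 : (0:ℚ) < (p:ℚ)^a := pow_pos (by linarith) _
  rw [← pow_succ'] at hlt
  nlinarith

end Genotype

namespace Genotype

theorem schur_char {k : Type} [Field k] [CharZero k] {G : Type} [Group G] [Fintype G]
    (V W : FDRep k G) (hV : IsIrr V) (hW : IsIrr W)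
    (h : ∑ g, V.character g * W.character g⁻¹ ≠ 0) : V.character = W.character := by
  have hc : (Nat.card G : k) ≠ 0 := by exact_mod_cast Nat.card_pos.ne'
  have : Invertible (Nat.card G : k) := invertibleOfNonzero hc
  have h1 := Representation.card_inv_mul_sum_char_mul_char_eq_finrank (k := k) (G := G) W.ρ V.ρ
  have h2 : (Module.finrank k (Representation.IntertwiningMap W.ρ V.ρ) : k) ≠ 0 := by
    rw [← h1]; exact mul_ne_zero (inv_ne_zero hc) h
  have h3 : ∃ f : Representation.IntertwiningMap W.ρ V.ρ, f ≠ 0 := by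
    by_contra hne
    push Not at hne
    have : Subsingleton (Representation.IntertwiningMap W.ρ V.ρ) := ⟨fun a b => by rw [hne a, hne b]⟩
    rw [Module.finrank_zero_of_subsingleton] at h2
    simp at h2
  obtain ⟨f, hf⟩ := h3
  have hint : ∀ g v, f.toLinearMap (W.ρ g v) = V.ρ g (f.toLinearMap v) := fun g v => Representation.IntertwiningMap.isIntertwining (A := k) (G := G) W.ρ V.ρ f g v
  have hf' : f.toLinearMap ≠ 0 := fun h0 => hf (Representation.IntertwiningMap.ext h0)
  have hker : LinearMap.ker f.toLinearMap = ⊥ := by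
    refine (hW.2 (LinearMap.ker f.toLinearMap) fun g x hx => ?_).resolve_right fun h => hf' (LinearMap.ker_eq_top.1 h)
    rw [LinearMap.mem_ker] at hx ⊢
    rw [hint, hx, map_zero]
  have hran : LinearMap.range f.toLinearMap = ⊤ := by
    refine (hV.2 (LinearMap.range f.toLinearMap) fun g x hx => ?_).resolve_left fun h => hf' (LinearMap.range_eq_bot.1 h)
    obtain ⟨y, rfl⟩ := hx
    exact ⟨W.ρ g y, hint g y⟩
  let e := LinearEquiv.ofBijective f.toLinearMap ⟨LinearMap.ker_eq_bot.1 hker, LinearMap.range_eq_top.1 hran⟩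
  funext g
  have : V.ρ g = e.conj (W.ρ g) := by
    ext v
    obtain ⟨w, rfl⟩ := e.surjective v
    simp only [LinearEquiv.conj_apply_apply, LinearEquiv.symm_apply_apply]
    exact (hint g w).symm
  simp only [FDRep.character]
  rw [this, LinearMap.trace_conj']

theorem IsIrr.char_one_ne {k : Type} [Field k] [CharZero k] {G : Type} [Group G]
    {V : FDRep k G} (hV : IsIrr V) : V.character 1 ≠ 0 := by
  rw [FDRep.char_one]
  have := hV.1
  exact_mod_cast (Module.finrank_pos (R := k) (M := V)).ne'

/-- restriction to an invariant subspace -/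
def subRep {k : Type} [Field k] {G : Type} [Group G] (V : FDRep k G) (U : Submodule k V)
    (hU : ∀ g : G, ∀ x ∈ U, V.ρ g x ∈ U) : FDRep k G :=
  FDRep.of (V := U) (⟨⟨fun g => (V.ρ g).restrict (hU g), by ext; simp⟩, fun a b => by ext; simp⟩ : G →* U →ₗ[k] U)

theorem subRep_add {k : Type} [Field k] {G : Type} [Group G] (V : FDRep k G) (U U' : Submodule k V)
    (hU : ∀ g : G, ∀ x ∈ U, V.ρ g x ∈ U) (hU' : ∀ g : G, ∀ x ∈ U', V.ρ g x ∈ U') (hc : IsCompl U U') :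
    V.character = (subRep V U hU).character + (subRep V U' hU').character := by
  funext g
  let N : Bool → Submodule k V := fun b => if b then U else U'
  have hN : DirectSum.IsInternal N := by
    rw [DirectSum.isInternal_submodule_iff_isCompl N (i := true) (j := false) (by simp) (by ext b; cases b <;> simp)]
    exact hc
  have := LinearMap.trace_eq_sum_trace_restrict (N := N) hN (f := V.ρ g) (by
    intro b; cases b
    · exact hU' g
    · exact hU g)
  simp only [Fintype.sum_bool] at this
  exact this

theorem exists_compl {k : Type} [Field k] [CharZero k] {G : Type} [Group G] [Fintype G] (V : FDRep k G) (U : Submodule k V)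
    (hU : ∀ g : G, ∀ x ∈ U, V.ρ g x ∈ U) : ∃ U' : Submodule k V, (∀ g : G, ∀ x ∈ U', V.ρ g x ∈ U') ∧ IsCompl U U' := by
  have hc : (Nat.card G : k) ≠ 0 := by exact_mod_cast Nat.card_pos.ne'
  have : NeZero (Nat.card G : k) := ⟨hc⟩
  have hs : Representation.IsSemisimpleRepresentation (k := k) (G := G) V.ρ := inferInstance
  let S : Subrepresentation (A := k) (G := G) V.ρ := ⟨U, fun g x hx => hU g x hx⟩
  obtain ⟨T, hT⟩ := exists_isCompl S
  refine ⟨T.toSubmodule, fun g x hx => T.apply_mem_toSubmodule g hx, ?_, ?_⟩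
  · rw [disjoint_iff]
    have := disjoint_iff.1 hT.1
    exact congrArg Subrepresentation.toSubmodule this
  · rw [codisjoint_iff]
    have := codisjoint_iff.1 hT.2
    exact congrArg Subrepresentation.toSubmodule this

theorem exists_irr_sub {k : Type} [Field k] [CharZero k] {G : Type} [Group G] [Fintype G] (V : FDRep k G) (U : Submodule k V)
    (hU : ∀ g : G, ∀ x ∈ U, V.ρ g x ∈ U) (hne : U ≠ ⊥) :
    ∃ (u : FDRep k G) (j : u →ₗ[k] V), IsIrr u ∧ CharOccurs u.character V.character ∧
      Function.Injective j ∧ (∀ x, j x ∈ U) ∧ ∀ g x, j (u.ρ g x) = V.ρ g (j x) := by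
  let Q : Submodule k V → Prop := fun M => (∀ g : G, ∀ x ∈ M, V.ρ g x ∈ M) ∧ M ≠ ⊥ ∧ M ≤ U
  obtain ⟨M, hM, hmin⟩ := WellFounded.has_min (wellFounded_lt (α := Submodule k V)) {M | Q M} ⟨U, hU, hne, le_rfl⟩
  obtain ⟨M', hM', hc⟩ := exists_compl V M hM.1
  refine ⟨subRep V M hM.1, M.subtype, ⟨?_, ?_⟩, ⟨_, subRep_add V M M' hM.1 hM' hc⟩, M.subtype_injective,
    fun x => hM.2.2 x.2, fun g x => rfl⟩
  · exact Submodule.nontrivial_iff_ne_bot.2 hM.2.1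
  · intro N hN
    by_cases hb : N = ⊥
    · exact Or.inl hb
    right
    have q : Q (Submodule.map M.subtype N) := by
      refine ⟨?_, ?_, ?_⟩
      · rintro g _ ⟨x, hx, rfl⟩
        exact ⟨_, hN g x hx, rfl⟩
      · intro h
        refine hb ((Submodule.eq_bot_iff _).2 fun x hx => M.subtype_injective ?_)
        have := (Submodule.eq_bot_iff _).1 h _ ⟨x, hx, rfl⟩
        exact this
      · rintro _ ⟨x, hx, rfl⟩
        exact hM.2.2 x.2
    have h1 := hmin _ q
    have h2 : Submodule.map M.subtype N ≤ M := by
      rintro _ ⟨x, hx, rfl⟩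
      exact x.2
    have h3 : Submodule.map M.subtype N = M := by
      by_contra hne
      exact h1 (lt_of_le_of_ne h2 hne)
    rw [eq_top_iff]
    intro x _
    have : (M.subtype x : V) ∈ Submodule.map M.subtype N := h3.symm ▸ (x : M).2
    obtain ⟨y, hy, hyx⟩ := this
    have : y = x := M.subtype_injective hyx
    exact this ▸ hy

end Genotype

namespace Genotype

/-- sum over a subgroup in a representation -/
def eM {k : Type} [Field k] {G : Type} [Group G] [Fintype G] (V : FDRep k G) (M : Subgroup G) : V →ₗ[k] V :=
  ∑ g : G, if g ∈ M then V.ρ g else 0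

theorem rho_eM {k : Type} [Field k] {G : Type} [Group G] [Fintype G] (V : FDRep k G) (M : Subgroup G) (m : G) (hm : m ∈ M) :
    V.ρ m * eM V M = eM V M := by
  unfold eM
  rw [Finset.mul_sum]
  refine Fintype.sum_equiv (Equiv.mulLeft m) _ _ fun g => ?_
  simp only [Equiv.coe_mulLeft, Subgroup.mul_mem_cancel_left M hm]
  split_ifs
  · rw [map_mul]
  · rw [mul_zero]

theorem rho_eM_comm {k : Type} [Field k] {G : Type} [Group G] [Fintype G] (V : FDRep k G) (M : Subgroup G) [hM : M.Normal] (x : G) :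
    V.ρ x * eM V M = eM V M * V.ρ x := by
  unfold eM
  rw [Finset.mul_sum, Finset.sum_mul]
  refine Fintype.sum_equiv (MulAut.conj x).toEquiv _ _ fun g => ?_
  have e : (MulAut.conj x).toEquiv g = x * g * x⁻¹ := by simp
  rw [e]
  have : x * g * x⁻¹ ∈ M ↔ g ∈ M := ⟨fun h => by simpa [mul_assoc] using hM.conj_mem _ h x⁻¹, fun h => hM.conj_mem _ h x⟩
  simp only [this]
  split_ifs
  · rw [← map_mul, ← map_mul]; simp
  · simp

theorem eM_fixed {k : Type} [Field k] {G : Type} [Group G] [Fintype G] (V : FDRep k G) (M : Subgroup G) (v : V)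
    (hv : ∀ m ∈ M, V.ρ m v = v) : eM V M v = (Nat.card M : k) • v := by
  unfold eM
  rw [LinearMap.sum_apply]
  have : ∀ g ∈ Finset.univ, (if g ∈ M then V.ρ g else 0) v = if g ∈ M then v else 0 := by
    intro g _
    split_ifs with h
    · exact hv g h
    · rfl
  rw [Finset.sum_congr rfl this, ← Finset.sum_filter, Finset.sum_const, ← Nat.cast_smul_eq_nsmul k]
  congr 2
  rw [Nat.card_eq_fintype_card, Fintype.card_subtype]

theorem trace_wf {k : Type} [Field k] [CharZero k] {G : Type} [Group G] [Fintype G] (V : FDRep k G) (p : ℕ) (K Z : Subgroup G) :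
    ∑ g, ((wf p K Z g : ℚ) : k) * V.character g = LinearMap.trace k V ((p:k) • eM V K - eM V Z) := by
  unfold eM
  rw [Finset.smul_sum, ← Finset.sum_sub_distrib, map_sum]
  refine Finset.sum_congr rfl fun g _ => ?_
  unfold wf FDRep.character
  by_cases h1 : g ∈ K <;> by_cases h2 : g ∈ Z <;> simp [h1, h2, sub_mul]

/-- the submodule of K-fixed vectors killed by the sum over Z -/
def UU {k : Type} [Field k] {G : Type} [Group G] [Fintype G] (V : FDRep k G) (K Z : Subgroup G) : Submodule k V where
  carrier := {v | (∀ m ∈ K, V.ρ m v = v) ∧ eM V Z v = 0}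
  add_mem' := by
    rintro a b ⟨h1, h2⟩ ⟨h3, h4⟩
    exact ⟨fun m hm => by rw [map_add, h1 m hm, h3 m hm], by rw [map_add, h2, h4, add_zero]⟩
  zero_mem' := ⟨fun m _ => map_zero _, map_zero _⟩
  smul_mem' := by
    rintro c a ⟨h1, h2⟩
    exact ⟨fun m hm => by rw [map_smul, h1 m hm], by rw [map_smul, h2, smul_zero]⟩

theorem UU_inv {k : Type} [Field k] {G : Type} [Group G] [Fintype G] (V : FDRep k G) (K Z : Subgroup G)
    [hK : K.Normal] [hZ : Z.Normal] (g : G) (x : V) (hx : x ∈ UU V K Z) : V.ρ g x ∈ UU V K Z := by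
  obtain ⟨h1, h2⟩ := hx
  refine ⟨fun m hm => ?_, ?_⟩
  · have e : V.ρ m (V.ρ g x) = V.ρ g (V.ρ (g⁻¹ * m * g) x) := by
      rw [← Module.End.mul_apply, ← Module.End.mul_apply, ← map_mul, ← map_mul]
      congr 2
      group
    rw [e, h1 _ (by simpa using hK.conj_mem m hm g⁻¹)]
  · have := congrArg (fun f : V →ₗ[k] V => f x) (rho_eM_comm V Z g)
    simp only [Module.End.mul_apply] at this
    rw [← this, h2, map_zero]

theorem UU_bot {k : Type} [Field k] [CharZero k] {G : Type} [Group G] [Fintype G] (V : FDRep k G) (p : ℕ) (K Z : Subgroup G)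
    (hKZ : K ≤ Z) (hc : Nat.card Z = p * Nat.card K) (h : UU V K Z = ⊥) :
    ∑ g, ((wf p K Z g : ℚ) : k) * V.character g = 0 := by
  rw [trace_wf]
  suffices h0 : (p:k) • eM V K - eM V Z = 0 by rw [h0, map_zero]
  ext v
  have ef : ∀ M : Subgroup G, ∀ m ∈ M, V.ρ m (eM V M v) = eM V M v := fun M m hm =>
    congrArg (fun f : V →ₗ[k] V => f v) (rho_eM V M m hm)
  have hin : ((p:k) • eM V K - eM V Z) v ∈ UU V K Z := by
    refine ⟨fun m hm => ?_, ?_⟩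
    · simp only [LinearMap.sub_apply, LinearMap.smul_apply, map_sub, map_smul]
      rw [ef K m hm, ef Z m (hKZ hm)]
    · simp only [LinearMap.sub_apply, LinearMap.smul_apply, map_sub, map_smul]
      rw [eM_fixed V Z _ (ef Z)]
      have : eM V Z (eM V K v) = (Nat.card K : k) • eM V Z v := by
        have hz : ∀ m ∈ K, eM V Z * V.ρ m = eM V Z := by
          intro m hm
          unfold eM
          rw [Finset.sum_mul]
          refine Fintype.sum_equiv (Equiv.mulRight m) _ _ fun g => ?_
          simp only [Equiv.coe_mulRight, Subgroup.mul_mem_cancel_right Z (hKZ hm)]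
          split_ifs
          · rw [map_mul]
          · rw [zero_mul]
        have hz2 : eM V Z * eM V K = (Nat.card K : k) • eM V Z := by
          conv_lhs => rw [eM.eq_def V K]
          rw [Finset.mul_sum]
          have : ∀ g ∈ Finset.univ, eM V Z * (if g ∈ K then V.ρ g else 0) = if g ∈ K then eM V Z else 0 := by
            intro g _
            split_ifs with h
            · exact hz g h
            · rw [mul_zero]
          rw [Finset.sum_congr rfl this, ← Finset.sum_filter, Finset.sum_const, ← Nat.cast_smul_eq_nsmul k]
          congr 2
          rw [Nat.card_eq_fintype_card, Fintype.card_subtype]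
        exact congrArg (fun f : V →ₗ[k] V => f v) hz2
      rw [this, hc, smul_smul, Nat.cast_mul, sub_self]
  rw [h] at hin
  exact (Submodule.mem_bot k).1 hin

theorem UU_top {k : Type} [Field k] [CharZero k] {G : Type} [Group G] [Fintype G] (V : FDRep k G) (p : ℕ) (K Z : Subgroup G)
    (h : ∀ v, v ∈ UU V K Z) :
    ∑ g, ((wf p K Z g : ℚ) : k) * V.character g = p * Nat.card K * V.character 1 := by
  rw [trace_wf]
  have h0 : (p:k) • eM V K - eM V Z = ((p:k) * Nat.card K) • V.ρ 1 := by
    ext v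
    simp only [LinearMap.sub_apply, LinearMap.smul_apply]
    rw [(h v).2, eM_fixed V K v (h v).1, sub_zero, smul_smul, map_one, Module.End.one_apply]
  rw [h0, map_smul]
  rfl

end Genotype

namespace Genotype

/-- power by a unit of `ZMod n` -/
def pw {n : ℕ} {P : Type} [Group P] (r : (ZMod n)ˣ) (x : P) : P := x ^ (r.1.val)

theorem pw_cop {n : ℕ} [NeZero n] {P : Type} [Group P] (hn : ∀ x : P, x ^ n = 1) (s : ℕ) (hs : s.Coprime n) (x : P) :
    pw (ZMod.unitOfCoprime s hs) x = x ^ s := by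
  unfold pw
  rw [ZMod.coe_unitOfCoprime, ZMod.val_natCast]
  conv_rhs => rw [← Nat.mod_add_div s n, pow_add, pow_mul, hn, one_pow, mul_one]

theorem pw_mul {n : ℕ} [NeZero n] {P : Type} [Group P] (hn : ∀ x : P, x ^ n = 1) (r s : (ZMod n)ˣ) (x : P) :
    pw (r * s) x = pw r (pw s x) := by
  unfold pw
  rw [Units.val_mul, ZMod.val_mul, ← pow_mul, mul_comm]
  conv_rhs => rw [← Nat.mod_add_div (s.1.val * r.1.val) n, pow_add, pow_mul, hn, one_pow, mul_one]

theorem pw_one {n : ℕ} [NeZero n] {P : Type} [Group P] (hn : ∀ x : P, x ^ n = 1) (x : P) :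
    pw (1 : (ZMod n)ˣ) x = x := by
  have := pw_cop hn 1 (Nat.coprime_one_left n) x
  rw [pow_one] at this
  conv_rhs => rw [← this]
  congr 1
  ext
  simp

theorem pw_bij {n : ℕ} [NeZero n] {P : Type} [Group P] (hn : ∀ x : P, x ^ n = 1) (r : (ZMod n)ˣ) :
    Function.Bijective (pw r : P → P) := by
  refine Function.bijective_iff_has_inverse.2 ⟨pw r⁻¹, fun x => ?_, fun x => ?_⟩
  · rw [← pw_mul hn, inv_mul_cancel, pw_one hn]
  · rw [← pw_mul hn, mul_inv_cancel, pw_one hn]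

theorem pw_mem {n : ℕ} [NeZero n] {P : Type} [Group P] (hn : ∀ x : P, x ^ n = 1) (r : (ZMod n)ˣ) (M : Subgroup P) (x : P) :
    pw r x ∈ M ↔ x ∈ M := by
  refine ⟨fun h => ?_, fun h => M.pow_mem h _⟩
  have : pw r⁻¹ (pw r x) ∈ M := M.pow_mem h _
  rwa [← pw_mul hn, inv_mul_cancel, pw_one hn] at this

theorem pw_cop_val {n : ℕ} (r : (ZMod n)ˣ) : (r.1.val).Coprime n := ZMod.val_coe_unit_coprime r

theorem pw_conj {n : ℕ} {P : Type} [Group P] (r : (ZMod n)ˣ) (x g : P) : pw r (x⁻¹ * g * x) = x⁻¹ * pw r g * x := by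
  unfold pw
  have := conj_pow (i := r.1.val) (a := x⁻¹) (b := g)
  simpa using this

theorem eM_zero {k : Type} [Field k] [CharZero k] {P : Type} [Group P] [Fintype P] (φ : FDRep k P) (hφ : IsIrr φ)
    (hf : IsFaithfulRep φ) (z : P) (hz1 : z ≠ 1) (hz : ∀ x, x * z = z * x) : eM φ (Subgroup.zpowers z) = 0 := by
  let U : Submodule k φ := LinearMap.ker (φ.ρ z - 1)
  have memU : ∀ v, v ∈ U ↔ φ.ρ z v = v := fun v => by
    simp [U, LinearMap.mem_ker, sub_eq_zero]
  rcases hφ.2 U (fun g x hx => by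
    rw [memU] at hx ⊢
    rw [← Module.End.mul_apply, ← map_mul, ← hz, map_mul, Module.End.mul_apply, hx]) with h | h
  · ext v
    have : eM φ (Subgroup.zpowers z) v ∈ U := by
      rw [memU]
      exact congrArg (fun f : φ →ₗ[k] φ => f v) (rho_eM φ (Subgroup.zpowers z) z (Subgroup.mem_zpowers z))
    rw [h] at this
    exact (Submodule.mem_bot k).1 this
  · exfalso
    apply hz1
    apply hf
    ext v
    rw [map_one]
    exact (memU v).1 (h ▸ Submodule.mem_top)

theorem avg0 {k : Type} [Field k] [CharZero k] {P : Type} [Group P] [Fintype P] (φ : FDRep k P)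
    (M : Subgroup P) (h0 : eM φ M = 0) (x : P) :
    ∑ y : P, (if y ∈ M then φ.character (x * y) else 0) = 0 := by
  have h : LinearMap.trace k φ (φ.ρ x * eM φ M) = 0 := by rw [h0, mul_zero, map_zero]
  unfold eM at h
  rw [Finset.mul_sum, map_sum] at h
  refine Eq.trans ?_ h
  refine Finset.sum_congr rfl fun y _ => ?_
  split_ifs
  · rw [← map_mul]; rfl
  · rw [mul_zero, map_zero]

theorem sum_const_mem {k : Type} [Field k] [CharZero k] {P : Type} [Group P] [Fintype P] (M : Subgroup P) (c : k) :
    ∑ y : P, (if y ∈ M then c else 0) = Nat.card M * c := by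
  rw [← Finset.sum_filter, Finset.sum_const, ← Nat.cast_smul_eq_nsmul k, Nat.card_eq_fintype_card, Fintype.card_subtype, smul_eq_mul]

theorem off_A {k : Type} [Field k] [CharZero k] {p : ℕ} {P : Type} [Group P] [Fintype P] (φ : FDRep k P)
    (hφ : IsIrr φ) (hf : IsFaithfulRep φ) {A : Subgroup P} {z : P} (S : RS p P A z) (x : P) (hx : x ∉ A) :
    φ.character x = 0 := by
  have h2 := (S.alt.resolve_left fun h => hx (h x)).2.2.2.2.2
  have hc : ∀ n : ℕ, φ.character (x * z ^ n) = φ.character x := by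
    intro n
    induction n with
    | zero => simp
    | succ n ih =>
      have hn : x * z ^ n ∉ A := fun h => hx ((Subgroup.mul_mem_cancel_right A (A.pow_mem S.zA n)).1 h)
      obtain ⟨y, -, hy⟩ := h2 _ hn
      rw [← ih, ← FDRep.char_conj φ (x * z ^ n) y, hy]
      congr 1
      rw [pow_succ, ← mul_assoc, S.zc]
  have h0 := avg0 φ _ (eM_zero φ hφ hf z S.z1 S.zc) x
  have : ∀ y ∈ Finset.univ, (if y ∈ Subgroup.zpowers z then φ.character (x * y) else 0) =
      if y ∈ Subgroup.zpowers z then φ.character x else 0 := by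
    intro y _
    split_ifs with h
    · obtain ⟨n, rfl⟩ := mem_powers_iff_mem_zpowers.2 h
      exact hc n
    · rfl
  rw [Finset.sum_congr rfl this, sum_const_mem] at h0
  exact (mul_eq_zero.1 h0).resolve_left (by exact_mod_cast Nat.card_pos.ne')

theorem F_formula {k : Type} [Field k] [CharZero k] {p m : ℕ} (hp : p.Prime) {P : Type} [Group P] [Fintype P] (φ : FDRep k P)
    [NeZero (p ^ m)]
    (hm : Nat.card P ∣ p ^ m)
    (hφ : IsIrr φ) (hf : IsFaithfulRep φ) {A : Subgroup P} {z : P} (S : RS p P A z) (x : P) :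
    ((p : k) - 1) * ∑ r : (ZMod (p ^ m))ˣ, φ.character (pw r x) =
      Nat.card (ZMod (p ^ m))ˣ * φ.character 1 * ((wf p ⊥ (Subgroup.zpowers z) x : ℚ) : k) := by
  have := Fact.mk hp
  have hn : ∀ x : P, x ^ (p ^ m) = 1 := fun x => by
    obtain ⟨c, hc⟩ := hm
    rw [hc, pow_mul, pow_card_eq_one', one_pow]
  set F : P → k := fun x => ∑ r : (ZMod (p ^ m))ˣ, φ.character (pw r x) with hF
  have hoz : orderOf z = p := orderOf_eq_prime S.zp S.z1
  have hcz : Nat.card (Subgroup.zpowers z) = p := by rw [Nat.card_zpowers, hoz]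
  have Fpow : ∀ s : ℕ, ¬ p ∣ s → ∀ x, F (x ^ s) = F x := by
    intro s hs x
    have hc : s.Coprime (p ^ m) := Nat.Coprime.pow_right m ((Nat.Prime.coprime_iff_not_dvd hp).2 hs).symm
    rw [← pw_cop hn s hc]
    simp only [hF, ← pw_mul hn]
    exact Fintype.sum_equiv (Equiv.mulRight _) _ _ fun r => rfl
  have F1 : F 1 = Nat.card (ZMod (p ^ m))ˣ * φ.character 1 := by
    simp [hF, pw, Nat.card_eq_fintype_card]
  have Fsum : ∀ x, ∑ y : P, (if y ∈ Subgroup.zpowers z then F (x * y) else 0) = 0 ∨ x ∉ A := by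
    intro x
    by_cases hxA : x ∈ A
    swap
    · exact Or.inr hxA
    left
    have e : ∀ y ∈ Finset.univ, (if y ∈ Subgroup.zpowers z then F (x * y) else 0) =
        ∑ r : (ZMod (p ^ m))ˣ, if y ∈ Subgroup.zpowers z then φ.character (pw r x * pw r y) else 0 := by
      intro y _
      split_ifs with h
      · refine Finset.sum_congr rfl fun r _ => ?_
        congr 1
        unfold pw
        have : Commute x y := by
          obtain ⟨i, rfl⟩ := h
          exact (show Commute x z from S.zc x).zpow_right i
        exact this.mul_pow _
      · simp
    rw [Finset.sum_congr rfl e, Finset.sum_comm]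
    refine Finset.sum_eq_zero fun r _ => ?_
    refine Eq.trans ?_ (avg0 φ _ (eM_zero φ hφ hf z S.z1 S.zc) (pw r x))
    refine Fintype.sum_bijective (pw r) (pw_bij hn r) _ _ fun y => ?_
    simp only [pw_mem hn]
  change ((p:k) - 1) * F x = _
  by_cases hxA : x ∈ A
  swap
  · have h1 : x ≠ 1 := fun h => hxA (h ▸ A.one_mem)
    have h2 : x ∉ Subgroup.zpowers z := fun h => hxA ((Subgroup.zpowers_le.2 S.zA) h)
    have h3 : F x = 0 := Finset.sum_eq_zero fun r _ => off_A φ hφ hf S _ (by rwa [pw_mem hn])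
    simp [wf, h1, h2, h3]
  by_cases hx1 : x = 1
  · subst hx1
    rw [F1, wf_one]; push_cast; ring
  by_cases hxz : x ∈ Subgroup.zpowers z
  · have hs := (Fsum 1).resolve_right (fun h => h A.one_mem)
    simp only [one_mul] at hs
    have hconst : ∀ y ∈ Subgroup.zpowers z, y ≠ 1 → F y = F x := by
      intro y hy hy1
      have ho : orderOf x = p := by
        refine orderOf_eq_prime ?_ hx1
        obtain ⟨i, rfl⟩ := hxz
        change (z ^ i) ^ p = 1
        rw [← zpow_natCast, zpow_comm, zpow_natCast, S.zp, one_zpow]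
      have : Subgroup.zpowers x = Subgroup.zpowers z :=
        Subgroup.eq_of_le_of_card_ge (Subgroup.zpowers_le.2 hxz) (by rw [Nat.card_zpowers, Nat.card_zpowers, ho, hoz])
      rw [← this] at hy
      obtain ⟨s, rfl⟩ := mem_powers_iff_mem_zpowers.2 hy
      refine Fpow s (fun hd => hy1 ?_) x
      obtain ⟨c, rfl⟩ := hd
      change x ^ (p * c) = 1
      rw [pow_mul, ← ho, pow_orderOf_eq_one, one_pow]
    have e : ∀ y ∈ Finset.univ, (if y ∈ Subgroup.zpowers z then F y else 0) =
        (if y ∈ Subgroup.zpowers z then F x else 0) + (if y = 1 then F 1 - F x else 0) := by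
      intro y _
      by_cases h1 : y = 1
      · subst h1; simp [Subgroup.one_mem]
      · by_cases h2 : y ∈ Subgroup.zpowers z
        · simp [h1, h2, hconst y h2 h1]
        · simp [h1, h2]
    rw [Finset.sum_congr rfl e, Finset.sum_add_distrib, sum_const_mem, hcz, Finset.sum_ite_eq' Finset.univ (1:P)] at hs
    simp only [Finset.mem_univ, if_true, F1] at hs
    have hw : wf p ⊥ (Subgroup.zpowers z) x = -1 := by simp [wf, hx1, hxz]
    rw [hw]; push_cast
    linear_combination hs
  · have hs := (Fsum x).resolve_right (fun h => h hxA)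
    have e : ∀ y ∈ Finset.univ, (if y ∈ Subgroup.zpowers z then F (x * y) else 0) =
        (if y ∈ Subgroup.zpowers z then F x else 0) := by
      intro y _
      split_ifs with hy
      · have hzx := S.tr x hxA hx1
        have hyx : y ∈ Subgroup.zpowers x := (Subgroup.zpowers_le.2 hzx) hy
        obtain ⟨s, rfl⟩ := mem_powers_iff_mem_zpowers.2 hyx
        change F (x * x ^ s) = F x
        rw [← pow_succ']
        refine Fpow _ (fun hd => hxz ?_) x
        have hs' : ¬ p ∣ s := fun h => hp.one_lt.ne' (Nat.dvd_one.1 ((Nat.dvd_add_right h).1 hd))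
        have hc : s.Coprime (p ^ m) := Nat.Coprime.pow_right m ((Nat.Prime.coprime_iff_not_dvd hp).2 hs').symm
        have := (pw_mem hn (ZMod.unitOfCoprime s hc) (Subgroup.zpowers z) x).1
        rw [pw_cop hn] at this
        exact this hy
      · rfl
    rw [Finset.sum_congr rfl e, sum_const_mem, hcz] at hs
    have h3 : F x = 0 := (mul_eq_zero.1 hs).resolve_left (by exact_mod_cast hp.ne_zero)
    simp [wf, hx1, hxz, h3]

end Genotype

namespace Genotype

theorem trace_pow_formula {L : Type} [Field L] [CharZero L] {W : Type} [AddCommGroup W] [Module L W] [Module.Finite L W]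
    (T : Module.End L W) {n : ℕ} (hn : 0 < n) (hT : T ^ n = 1) {ζ : L} (hζ : IsPrimitiveRoot ζ n) :
    ∃ d : ℕ → ℕ, ∀ j, LinearMap.trace L W (T ^ j) = ∑ i ∈ Finset.range n, (d i : L) * ζ ^ (i * j) := by
  have hn0 : (n : L) ≠ 0 := by exact_mod_cast hn.ne'
  have hζ0 : ζ ≠ 0 := hζ.ne_zero hn.ne'
  let f : ℕ → ℕ → Module.End L W := fun i j => ((ζ⁻¹) ^ (i * j)) • T ^ j
  let E : ℕ → Module.End L W := fun i => (n : L)⁻¹ • ∑ j ∈ Finset.range n, f i j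
  have hfn : ∀ i, f i n = f i 0 := by
    intro i
    have : ζ⁻¹ ^ (i * n) = 1 := by rw [mul_comm, pow_mul, inv_pow, hζ.pow_eq_one, inv_one, one_pow]
    simp only [f, this, hT, mul_zero, pow_zero]
  have hshift : ∀ i, ∑ j ∈ Finset.range n, f i (j+1) = ∑ j ∈ Finset.range n, f i j := by
    intro i
    have h1 := Finset.sum_range_succ (f i) n
    rw [Finset.sum_range_succ' (f i) n, hfn] at h1
    exact add_right_cancel h1
  have hTE : ∀ i, T * E i = ζ ^ i • E i := by
    intro i
    simp only [E]
    rw [mul_smul_comm, smul_comm (ζ ^ i)]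
    congr 1
    conv_rhs => rw [← hshift i]
    rw [Finset.mul_sum, Finset.smul_sum]
    refine Finset.sum_congr rfl fun j _ => ?_
    simp only [f]
    rw [mul_smul_comm, smul_smul, ← pow_succ']
    congr 1
    rw [mul_add, mul_one, pow_add]
    have : ζ ^ i * ζ⁻¹ ^ i = 1 := by rw [← mul_pow, mul_inv_cancel₀ hζ0, one_pow]
    linear_combination (-ζ⁻¹ ^ (i * j)) * this
  have hTE2 : ∀ i j, T ^ j * E i = ζ ^ (i * j) • E i := by
    intro i j
    induction j with
    | zero => simp
    | succ j ih => rw [pow_succ', mul_assoc, ih, mul_smul_comm, hTE, smul_smul, ← pow_add]; rfl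
  have hid : ∀ i, E i * E i = E i := by
    intro i
    conv_lhs => enter [1]; simp only [E]
    rw [smul_mul_assoc, Finset.sum_mul]
    have : ∀ j ∈ Finset.range n, f i j * E i = E i := by
      intro j _
      simp only [f]
      rw [smul_mul_assoc, hTE2, smul_smul, ← mul_pow, inv_mul_cancel₀ hζ0, one_pow, one_smul]
    rw [Finset.sum_congr rfl this, Finset.sum_const, Finset.card_range, ← Nat.cast_smul_eq_nsmul L, smul_smul, inv_mul_cancel₀ hn0, one_smul]
  have hsum : ∑ i ∈ Finset.range n, E i = 1 := by
    simp only [E]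
    rw [← Finset.smul_sum, Finset.sum_comm]
    have : ∀ j ∈ Finset.range n, ∑ i ∈ Finset.range n, f i j = if j = 0 then (n:L) • (1 : Module.End L W) else 0 := by
      intro j hj
      simp only [f]
      rw [← Finset.sum_smul]
      split_ifs with h0
      · subst h0; simp
      · have h1 : ζ⁻¹ ^ j ≠ 1 := by
          rw [inv_pow, Ne, inv_eq_one]
          exact hζ.pow_ne_one_of_pos_of_lt h0 (Finset.mem_range.1 hj)
        have h2 : ∑ i ∈ Finset.range n, ζ⁻¹ ^ (i * j) = 0 := by
          have := geom_sum_mul (ζ⁻¹ ^ j) n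
          have e1 : (ζ⁻¹ ^ j) ^ n = 1 := by rw [← pow_mul, mul_comm j n, pow_mul, inv_pow, hζ.pow_eq_one, inv_one, one_pow]
          rw [e1, sub_self] at this
          have h3 := (mul_eq_zero.1 this).resolve_right (sub_ne_zero.2 h1)
          rw [← h3]
          refine Finset.sum_congr rfl fun i _ => ?_
          rw [← pow_mul, mul_comm]
        rw [h2, zero_smul]
    rw [Finset.sum_congr rfl this, Finset.sum_ite_eq' (Finset.range n) 0]
    simp [hn, hn0]
  have htr : ∀ i, ∃ d : ℕ, LinearMap.trace L W (E i) = d := by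
    intro i
    have hp : LinearMap.IsProj (LinearMap.range (E i)) (E i) := by
      refine ⟨fun x => ⟨x, rfl⟩, ?_⟩
      rintro _ ⟨x, rfl⟩
      exact congrArg (fun f : Module.End L W => f x) (hid i)
    exact ⟨_, hp.trace⟩
  choose d hd using htr
  refine ⟨d, fun j => ?_⟩
  rw [← mul_one (T ^ j), ← hsum, Finset.mul_sum, map_sum]
  refine Finset.sum_congr rfl fun i _ => ?_
  rw [hTE2, map_smul, hd, smul_eq_mul, mul_comm]

theorem galois_pow {k : Type} [Field k] [CharZero k] {H : Type} [Group H] [Fintype H] (V : FDRep k H) (r : ℕ)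
    (hr : r.Coprime (Nat.card H)) : IsGaloisConj V.character (fun h => V.character (h ^ r)) := by
  let n := Nat.card H
  have hn : 0 < n := Nat.card_pos
  have : NeZero n := ⟨hn.ne'⟩
  let L := AlgebraicClosure k
  have : CharZero L := charZero_of_injective_algebraMap (algebraMap k L).injective
  obtain ⟨ζ₀, hζ₀⟩ := HasEnoughRootsOfUnity.exists_primitiveRoot L n
  let M : IntermediateField ℚ L := IntermediateField.adjoin ℚ {ζ₀}
  have hcyc : IsCyclotomicExtension {n} ℚ M := by
    change IsCyclotomicExtension {n} ℚ (IntermediateField.adjoin ℚ {ζ₀}).toSubalgebra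
    rw [IntermediateField.adjoin_simple_toSubalgebra_of_isAlgebraic (((hζ₀.isIntegral hn).tower_top (A := ℚ)).isAlgebraic)]
    exact hζ₀.adjoin_isCyclotomicExtension ℚ
  have hgal : IsGalois ℚ M := IsCyclotomicExtension.isGalois {n} ℚ M
  let ζM : M := IsCyclotomicExtension.zeta n ℚ M
  have hζM : IsPrimitiveRoot ζM n := IsCyclotomicExtension.zeta_spec n ℚ M
  have hirr := Polynomial.cyclotomic.irreducible_rat hn
  let α : M ≃ₐ[ℚ] M := IsCyclotomicExtension.fromZetaAut (hζM.pow_of_coprime r hr) hirr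
  have hα : α ζM = ζM ^ r := IsCyclotomicExtension.fromZetaAut_spec (hζM.pow_of_coprime r hr) hirr
  have hζ : IsPrimitiveRoot (ζM : L) n := hζM.map_of_injective (f := M.val) M.val.injective
  have key : ∀ g : H, ∃ d : ℕ → ℕ, ∀ j, algebraMap k L (V.character (g ^ j)) =
      ((∑ i ∈ Finset.range n, (d i : M) * ζM ^ (i * j) : M) : L) := by
    intro g
    obtain ⟨d, hd⟩ := trace_pow_formula (L := L) ((V.ρ g).baseChange L) hn (by
      rw [← LinearMap.baseChange_pow, ← map_pow, pow_card_eq_one', map_one, LinearMap.baseChange_one]) hζ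
    refine ⟨d, fun j => ?_⟩
    have := hd j
    rw [← LinearMap.baseChange_pow, LinearMap.trace_baseChange, ← map_pow] at this
    push_cast
    exact this
  have hle : ∀ f : H → k, (∀ g, algebraMap k L (f g) ∈ M) → ∀ x ∈ charField f, algebraMap k L x ∈ M := by
    intro f hf x hx
    have : charField f ≤ M.toSubfield.comap (algebraMap k L) := by
      refine Subfield.closure_le.2 ?_
      rintro _ ⟨g, rfl⟩
      exact hf g
    exact this hx
  have hv : ∀ j : ℕ, ∀ g, algebraMap k L (V.character (g ^ j)) ∈ M := by
    intro j g
    obtain ⟨d, hd⟩ := key g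
    rw [hd]
    exact Subtype.property _
  have hv1 : ∀ g, algebraMap k L (V.character g) ∈ M := fun g => by simpa using hv 1 g
  refine ⟨M, inferInstance, inferInstance, hgal,
    ((algebraMap k L).comp (charField V.character).subtype).codRestrict M (fun x => hle _ hv1 x x.2),
    ((algebraMap k L).comp (charField (fun h => V.character (h ^ r))).subtype).codRestrict M (fun x => hle _ (hv r) x x.2),
    α.toRingEquiv, fun g => ?_⟩
  obtain ⟨d, hd⟩ := key g
  have e1 : (((algebraMap k L).comp (charField V.character).subtype).codRestrict M (fun x => hle _ hv1 x x.2))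
      ⟨V.character g, mem_charField _ g⟩ = ∑ i ∈ Finset.range n, (d i : M) * ζM ^ (i * 1) := by
    apply Subtype.ext
    rw [← hd 1, pow_one]
    rfl
  rw [e1]
  apply Subtype.ext
  change ((α (∑ i ∈ Finset.range n, (d i : M) * ζM ^ (i * 1)) : M) : L) = algebraMap k L (V.character (g ^ r))
  rw [hd r, map_sum]
  congr 1
  refine Finset.sum_congr rfl fun i _ => ?_
  rw [map_mul, map_natCast, map_pow, hα, ← pow_mul, mul_one, mul_comm r i]

end Genotype

namespace Genotype

/-- central lift of zpowers z -/
def Zc {H : Type} [Group H] (K : Subgroup H) [K.Normal] (z : H ⧸ K) : Subgroup H :=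
  (Subgroup.zpowers z).comap (QuotientGroup.mk' K)

theorem Zc_normal {H : Type} [Group H] (K : Subgroup H) [K.Normal] (z : H ⧸ K) (hz : ∀ x, x * z = z * x) :
    (Zc K z).Normal := by
  have : (Subgroup.zpowers z).Normal := ⟨by
    rintro _ ⟨i, rfl⟩ g
    have : Commute g (z ^ i) := (show Commute g z from hz g).zpow_right i
    refine ⟨i, ?_⟩
    change z ^ i = g * z ^ i * g⁻¹
    rw [this.eq]; group⟩
  exact this.comap _

theorem wf_Zc {H : Type} [Group H] (K : Subgroup H) [K.Normal] (z : H ⧸ K) (p : ℕ) (h : H) :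
    wf p ⊥ (Subgroup.zpowers z) (h : H ⧸ K) = wf p K (Zc K z) h := by
  simp only [wf, Zc, Subgroup.mem_comap, Subgroup.mem_bot, QuotientGroup.eq_one_iff, QuotientGroup.mk'_apply]

theorem fixed_zero {k : Type} [Field k] [CharZero k] {P : Type} [Group P] [Fintype P] (φ : FDRep k P) (hφ : IsIrr φ)
    (hf : IsFaithfulRep φ) (z : P) (hz1 : z ≠ 1) (hz : ∀ x, x * z = z * x) (v : φ) (hv : φ.ρ z v = v) : v = 0 := by
  have h0 := eM_zero φ hφ hf z hz1 hz
  have h1 := eM_fixed φ (Subgroup.zpowers z) v (by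
    intro m hm
    obtain ⟨n, rfl⟩ := mem_powers_iff_mem_zpowers.2 hm
    change φ.ρ (z ^ n) v = v
    induction n with
    | zero => simp
    | succ n ih => rw [pow_succ, map_mul, Module.End.mul_apply, hv, ih (Subgroup.npow_mem_zpowers z n)])
  rw [h0] at h1
  exact (smul_eq_zero.1 h1.symm).resolve_left (by exact_mod_cast Nat.card_pos.ne')

/-- pull back along a hom -/
def pull {k : Type} [Field k] {P H : Type} [Group P] [Group H] (φ : FDRep k P) (f : H →* P) : FDRep k H :=
  FDRep.of (V := φ) (φ.ρ.comp f)

theorem pull_char {k : Type} [Field k] {P H : Type} [Group P] [Group H] (φ : FDRep k P) (f : H →* P) (h : H) :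
    (pull φ f).character h = φ.character (f h) := rfl

theorem pull_irr {k : Type} [Field k] {P H : Type} [Group P] [Group H] (φ : FDRep k P) (f : H →* P)
    (hf : Function.Surjective f) (hφ : IsIrr φ) : IsIrr (pull φ f) := by
  refine ⟨hφ.1, fun U hU => hφ.2 U fun g x hx => ?_⟩
  obtain ⟨h, rfl⟩ := hf g
  exact hU h x hx

theorem pull_UU {k : Type} [Field k] [CharZero k] {H : Type} [Group H] [Fintype H] (K : Subgroup H) [K.Normal]
    (φ : FDRep k (H ⧸ K)) (hφ : IsIrr φ) (hf : IsFaithfulRep φ) (z : H ⧸ K) (hz1 : z ≠ 1) (hz : ∀ x, x * z = z * x)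
    (v : pull φ (QuotientGroup.mk' K)) : v ∈ UU (pull φ (QuotientGroup.mk' K)) K (Zc K z) := by
  refine ⟨fun m hm => ?_, ?_⟩
  · change φ.ρ (m : H ⧸ K) v = v
    rw [(QuotientGroup.eq_one_iff m).2 hm, map_one]; rfl
  · obtain ⟨y, hy⟩ := QuotientGroup.mk_surjective z
    refine fixed_zero φ hφ hf z hz1 hz _ ?_
    have e : φ.ρ z = φ.ρ (y : H ⧸ K) := by rw [hy]
    rw [e]
    exact congrArg (fun f : φ →ₗ[k] φ => f v) (rho_eM (pull φ (QuotientGroup.mk' K)) (Zc K z) y (by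
      change (y : H ⧸ K) ∈ Subgroup.zpowers z
      rw [hy]; exact Subgroup.mem_zpowers z))

theorem trans_galois {k : Type} [Field k] [CharZero k] {p m : ℕ} (hp : p.Prime) [NeZero (p ^ m)] {H : Type} [Group H] [Fintype H]
    (hm : Nat.card H ∣ p ^ m) (K : Subgroup H) [K.Normal]
    (φ : FDRep k (H ⧸ K)) (hφ : IsIrr φ) (hf : IsFaithfulRep φ) {A : Subgroup (H ⧸ K)} {z : H ⧸ K} (S : RS p (H ⧸ K) A z)
    (u : FDRep k H) (hu : IsIrr u) (hU : ∀ v, v ∈ UU u K (Zc K z)) :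
    IsGaloisConj (fun h : H => φ.character (h : H ⧸ K)) u.character := by
  have hm' : Nat.card (H ⧸ K) ∣ p ^ m := (Subgroup.card_quotient_dvd_card K).trans hm
  have h1 : ∑ h : H, (∑ r : (ZMod (p ^ m))ˣ, φ.character (pw r (h : H ⧸ K))) * u.character h⁻¹ ≠ 0 := by
    intro h0
    have h2 : ∑ h : H, (((p:k) - 1) * ∑ r : (ZMod (p ^ m))ˣ, φ.character (pw r (h : H ⧸ K))) * u.character h⁻¹ = 0 := by
      simp only [mul_assoc]
      rw [← Finset.mul_sum, h0, mul_zero]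
    simp only [F_formula hp φ hm' hφ hf S, wf_Zc, mul_assoc] at h2
    rw [← Finset.mul_sum, ← Finset.mul_sum] at h2
    have h3 : ∑ h : H, ((wf p K (Zc K z) h : ℚ) : k) * u.character h⁻¹ = ∑ h : H, ((wf p K (Zc K z) h : ℚ) : k) * u.character h := by
      refine Fintype.sum_equiv (Equiv.inv H) _ _ fun h => ?_
      simp [wf]
    rw [h3, UU_top u p K _ hU] at h2
    have c1 : (Nat.card (ZMod (p ^ m))ˣ : k) ≠ 0 := by exact_mod_cast Nat.card_pos.ne'
    have c2 : (Nat.card K : k) ≠ 0 := by exact_mod_cast Nat.card_pos.ne'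
    have c3 : (p : k) ≠ 0 := by exact_mod_cast hp.ne_zero
    exact mul_ne_zero c1 (mul_ne_zero hφ.char_one_ne (mul_ne_zero (mul_ne_zero c3 c2) hu.char_one_ne)) h2
  simp only [Finset.sum_mul] at h1
  rw [Finset.sum_comm] at h1
  obtain ⟨r, -, hr⟩ := Finset.exists_ne_zero_of_sum_ne_zero h1
  have hrc : (r.1.val).Coprime (p ^ m) := pw_cop_val r
  obtain ⟨θ, hθ, hA, hA1, hA2⟩ := RS.theta hp S r.1.val (hrc.coprime_dvd_right hm')
  have hchar : ∀ x, φ.character (θ x) = φ.character (pw r x) := by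
    intro x
    by_cases hx : x ∈ A
    · rw [hA x hx]; rfl
    · rw [off_A φ hφ hf S _ (hA1 x hx)]
      exact (off_A φ hφ hf S _ (hA2 x hx)).symm
  have hirr : IsIrr (pull φ (θ.comp (QuotientGroup.mk' K))) :=
    pull_irr φ _ (hθ.2.comp (QuotientGroup.mk'_surjective K)) hφ
  have hc2 : ∀ h, (pull φ (θ.comp (QuotientGroup.mk' K))).character h = φ.character (pw r (h : H ⧸ K)) :=
    fun h => hchar _
  have := schur_char _ u hirr hu (by simp only [hc2]; exact hr)
  have hg := galois_pow (pull φ (QuotientGroup.mk' K)) r.1.val (hrc.coprime_dvd_right hm)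
  have e : u.character = fun h => (pull φ (QuotientGroup.mk' K)).character (h ^ r.1.val) := by
    funext h
    rw [← this, hc2]
    rfl
  rw [e]
  exact hg

theorem T_formula {k : Type} [Field k] [CharZero k] {p m : ℕ} (hp : p.Prime) [NeZero (p ^ m)] {H : Type} [Group H] [Fintype H]
    (hm : Nat.card H ∣ p ^ m) (K : Subgroup H) [K.Normal]
    (φ : FDRep k (H ⧸ K)) (hφ : IsIrr φ) (hf : IsFaithfulRep φ) {A : Subgroup (H ⧸ K)} {z : H ⧸ K} (S : RS p (H ⧸ K) A z)
    (c : H → k) (hc : Nat.card (Zc K z) = p * Nat.card K)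
    (h1 : CharMult (fun h : H => φ.character (h : H ⧸ K)) c 1)
    (h2 : ∀ cφ' : H → k, IsIrrChar cφ' → IsGaloisConj (fun h : H => φ.character (h : H ⧸ K)) cφ' → CharOccurs cφ' c →
      cφ' = (fun h : H => φ.character (h : H ⧸ K))) :
    ∑ h, ((wf p K (Zc K z) h : ℚ) : k) * c h = p * Nat.card K * φ.character 1 := by
  have hZn := Zc_normal K z S.zc
  obtain ⟨W, hW, hW2⟩ := h1
  rw [one_smul] at hW
  have hbot : UU W K (Zc K z) = ⊥ := by
    by_contra hne
    obtain ⟨u, j, hu, ⟨X, hX⟩, hj, hjU, hjr⟩ := exists_irr_sub W _ (UU_inv W K (Zc K z)) hne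
    have hU : ∀ v, v ∈ UU u K (Zc K z) := by
      intro v
      obtain ⟨a, b⟩ := hjU v
      refine ⟨fun m hm => hj ?_, hj ?_⟩
      · rw [hjr, a m hm]
      · rw [map_zero, ← b]
        unfold eM
        rw [LinearMap.sum_apply, LinearMap.sum_apply, map_sum]
        refine Finset.sum_congr rfl fun g _ => ?_
        split_ifs
        · exact hjr g v
        · simp
    have hg := trans_galois hp hm K φ hφ hf S u hu hU
    have heq := h2 u.character ⟨u, hu, rfl⟩ hg
      ⟨FDRep.of (V := (pull φ (QuotientGroup.mk' K)) × X) (Representation.prod (k := k) (G := H) (pull φ (QuotientGroup.mk' K)).ρ X.ρ), by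
        rw [hW, hX]
        have : (FDRep.of (V := (pull φ (QuotientGroup.mk' K)) × X) (Representation.prod (k := k) (G := H) (pull φ (QuotientGroup.mk' K)).ρ X.ρ)).character
          = (pull φ (QuotientGroup.mk' K)).character + X.character := by
          funext g
          exact LinearMap.trace_prodMap' _ _
        rw [this]
        have e : (pull φ (QuotientGroup.mk' K)).character = (fun h : H => φ.character (h : H ⧸ K)) := rfl
        rw [e]
        abel⟩
    exact hW2 ⟨X, by rw [← heq]; exact hX⟩
  have hKZ : K ≤ Zc K z := fun h hh => by
    change (h : H ⧸ K) ∈ Subgroup.zpowers z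
    rw [(QuotientGroup.eq_one_iff h).2 hh]; exact Subgroup.one_mem _
  have e1 := UU_bot W p K (Zc K z) hKZ hc hbot
  have e2 := UU_top (pull φ (QuotientGroup.mk' K)) p K (Zc K z) (pull_UU K φ hφ hf z S.z1 S.zc)
  rw [hW]
  simp only [Pi.add_apply, mul_add, Finset.sum_add_distrib, e1, add_zero]
  exact e2

end Genotype

namespace Genotype

theorem wg_mem {G : Type} [Group G] (p : ℕ) (H : Subgroup G) (K : Subgroup H) [K.Normal] (z : H ⧸ K) (h : H) :
    wf p (Kg H K) (Zg H K z) (h : G) = wf p K (Zc K z) h := by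
  have h1 : (h : G) ∈ Kg H K ↔ h ∈ K := by
    rw [mem_Kg]
    exact ⟨fun ⟨_, e⟩ => (QuotientGroup.eq_one_iff _).1 e, fun e => ⟨h.2, (QuotientGroup.eq_one_iff _).2 e⟩⟩
  have h2 : (h : G) ∈ Zg H K z ↔ h ∈ Zc K z := by
    rw [mem_Zg]
    exact ⟨fun ⟨_, e⟩ => e, fun e => ⟨h.2, e⟩⟩
  simp only [wf, h1, h2]

theorem wg_not {G : Type} [Group G] (p : ℕ) (H : Subgroup G) (K : Subgroup H) [K.Normal] (z : H ⧸ K) (g : G) (hg : g ∉ H) :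
    wf p (Kg H K) (Zg H K z) g = 0 := by
  have h1 : g ∉ Kg H K := fun h => hg (mem_Kg.1 h).1
  have h2 : g ∉ Zg H K z := fun h => hg (mem_Zg.1 h).1
  simp [wf, h1, h2]

theorem card_Zc {G : Type} [Group G] [Finite G] (p : ℕ) (hp : p.Prime) (H : Subgroup G) (K : Subgroup H) [K.Normal] {A : Subgroup (H ⧸ K)}
    {z : H ⧸ K} (S : RS p (H ⧸ K) A z) : Nat.card (Zc K z) = p * Nat.card K := by
  have := Fact.mk hp
  have hoz : orderOf z = p := orderOf_eq_prime S.zp S.z1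
  rw [← card_Zg H K z p hoz]
  exact (Subgroup.card_map_of_injective H.subtype_injective).symm

/-- extension by zero of the inflation -/
def f0 {k : Type} [Field k] {G : Type} [Group G] (H : Subgroup G) (K : Subgroup H) [K.Normal] (φ : FDRep k (H ⧸ K)) (g : G) : k :=
  if h : g ∈ H then φ.character ((⟨g, h⟩ : H) : H ⧸ K) else 0

theorem f0_sum {k : Type} [Field k] [CharZero k] {p m : ℕ} (hp : p.Prime) [NeZero (p ^ m)] {G : Type} [Group G] [Fintype G]
    (hm : Nat.card G = p ^ m) (H : Subgroup G) (K : Subgroup H) [K.Normal]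
    (φ : FDRep k (H ⧸ K)) (hφ : IsIrr φ) (hf : IsFaithfulRep φ) {A : Subgroup (H ⧸ K)} {z : H ⧸ K} (S : RS p (H ⧸ K) A z) (y : G) :
    ((p : k) - 1) * ∑ r : (ZMod (p ^ m))ˣ, f0 H K φ (pw r y) =
      Nat.card (ZMod (p ^ m))ˣ * φ.character 1 * ((wf p (Kg H K) (Zg H K z) y : ℚ) : k) := by
  have hn : ∀ x : G, x ^ (p ^ m) = 1 := fun x => by rw [← hm]; exact pow_card_eq_one'
  by_cases hy : y ∈ H
  · have h1 : Nat.card (H ⧸ K) ∣ p ^ m :=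
      (Subgroup.card_quotient_dvd_card K).trans (hm ▸ Subgroup.card_subgroup_dvd_card H)
    have h2 := wg_mem p H K z ⟨y, hy⟩
    change wf p (Kg H K) (Zg H K z) y = _ at h2
    rw [h2, ← wf_Zc, ← F_formula hp φ h1 hφ hf S]
    congr 1
    refine Finset.sum_congr rfl fun r _ => ?_
    unfold f0
    rw [dif_pos ((pw_mem hn r H y).2 hy)]
    rfl
  · rw [wg_not p H K z y hy, Rat.cast_zero, mul_zero]
    have : ∀ r : (ZMod (p ^ m))ˣ, f0 H K φ (pw r y) = 0 := fun r => by
      unfold f0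
      rw [dif_neg (fun h => hy ((pw_mem hn r H y).1 h))]
    simp [this]

theorem ind_eq {k : Type} [Field k] [CharZero k] {G : Type} [Group G] [Fintype G] (H : Subgroup G) (K : Subgroup H) [K.Normal]
    (φ : FDRep k (H ⧸ K)) (c : G → k) (h : TightIndSub H K c φ.character) (g : G) :
    Nat.card H * c g = ∑ x : G, f0 H K φ (x⁻¹ * g * x) := by
  have h1 := congrFun h.1 g
  unfold indChar at h1
  rw [finsum_eq_sum_of_fintype] at h1
  have c2 : (Nat.card H : k) ≠ 0 := by exact_mod_cast Nat.card_pos.ne'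
  rw [h1, mul_inv_cancel_left₀ c2]
  rfl

theorem R1 {k : Type} [Field k] [CharZero k] {p m : ℕ} (hp : p.Prime) [NeZero (p ^ m)] {G : Type} [Group G] [Fintype G]
    (hm : Nat.card G = p ^ m) (H : Subgroup G) (K : Subgroup H) [K.Normal]
    (φ : FDRep k (H ⧸ K)) (hφ : IsIrr φ) (hf : IsFaithfulRep φ) {A : Subgroup (H ⧸ K)} {z : H ⧸ K} (S : RS p (H ⧸ K) A z)
    (c : G → k) (h : TightIndSub H K c φ.character) (g : G) :
    Nat.card H * (((p : k) - 1) * ∑ r : (ZMod (p ^ m))ˣ, c (pw r g)) =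
      Nat.card (ZMod (p ^ m))ˣ * φ.character 1 * ((indSum (wf p (Kg H K) (Zg H K z)) g : ℚ) : k) := by
  unfold indSum
  rw [Rat.cast_sum, mul_left_comm, Finset.mul_sum, Finset.mul_sum (a := (Nat.card (ZMod (p ^ m))ˣ * φ.character 1 : k))]
  simp only [ind_eq H K φ c h]
  rw [Finset.sum_comm, Finset.mul_sum]
  refine Finset.sum_congr rfl fun x _ => ?_
  rw [← f0_sum hp hm H K φ hφ hf S]
  simp only [pw_conj]

theorem R2a {k : Type} [Field k] [CharZero k] {p m : ℕ} (hp : p.Prime) [NeZero (p ^ m)] {G : Type} [Group G] [Fintype G]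
    (hm : Nat.card G = p ^ m) (H : Subgroup G) (K : Subgroup H) [K.Normal]
    (φ : FDRep k (H ⧸ K)) (hφ : IsIrr φ) (hf : IsFaithfulRep φ) {A : Subgroup (H ⧸ K)} {z : H ⧸ K} (S : RS p (H ⧸ K) A z)
    (c : G → k) (h : TightIndSub H K c φ.character) :
    ∑ g : G, ((wf p (Kg H K) (Zg H K z) g : ℚ) : k) * c g = p * Nat.card K * φ.character 1 := by
  rw [← T_formula hp (hm ▸ Subgroup.card_subgroup_dvd_card H) K φ hφ hf S (resChar H c) (card_Zc p hp H K S) h.2.1 h.2.2]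
  have e : ∀ h : H, ((wf p K (Zc K z) h : ℚ) : k) * resChar H c h =
      (fun g : G => ((wf p (Kg H K) (Zg H K z) g : ℚ) : k) * c g) h := fun h => by
    simp only [wg_mem]; rfl
  simp only [e]
  symm
  refine Finset.sum_of_injOn (fun h : H => (h : G)) (fun a _ b _ hab => Subtype.ext hab) (fun a _ => Finset.mem_coe.2 (Finset.mem_univ _)) ?_ (fun _ _ => rfl)
  intro g _ hg
  rw [wg_not, Rat.cast_zero, zero_mul]
  intro hgH
  exact hg ⟨⟨g, hgH⟩, by simp, rfl⟩

theorem R2b {k : Type} [Field k] [CharZero k] {p m : ℕ} [NeZero (p ^ m)] {G : Type} [Group G] [Fintype G]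
    (hm : Nat.card G = p ^ m) (K Z : Subgroup G) (c : G → k) :
    ∑ g : G, (∑ r : (ZMod (p ^ m))ˣ, c (pw r g)) * ((wf p K Z g : ℚ) : k) =
      Nat.card (ZMod (p ^ m))ˣ * ∑ g : G, ((wf p K Z g : ℚ) : k) * c g := by
  have hn : ∀ x : G, x ^ (p ^ m) = 1 := fun x => by rw [← hm]; exact pow_card_eq_one'
  simp only [Finset.sum_mul]
  rw [Finset.sum_comm]
  have : ∀ r : (ZMod (p ^ m))ˣ, ∑ g : G, c (pw r g) * ((wf p K Z g : ℚ) : k) = ∑ g : G, ((wf p K Z g : ℚ) : k) * c g := by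
    intro r
    refine Fintype.sum_equiv (Equiv.ofBijective _ (pw_bij hn r)) _ _ fun g => ?_
    rw [mul_comm]
    simp only [Equiv.ofBijective_apply, wf, pw_mem hn r]
  simp only [this]
  rw [Finset.sum_const, nsmul_eq_mul, Finset.card_univ, Nat.card_eq_fintype_card]

theorem hS_lem {k : Type} [Field k] [CharZero k] {p m : ℕ} (hp : p.Prime) [NeZero (p ^ m)] {G : Type} [Group G] [Fintype G]
    (hm : Nat.card G = p ^ m) (H : Subgroup G) (K : Subgroup H) [K.Normal]
    (φ : FDRep k (H ⧸ K)) (hφ : IsIrr φ) (hf : IsFaithfulRep φ) {A : Subgroup (H ⧸ K)} {z : H ⧸ K} (S : RS p (H ⧸ K) A z)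
    (c : G → k) (h : TightIndSub H K c φ.character) :
    ∑ g, (indSum (wf p (Kg H K) (Zg H K z)) g) ^ 2 =
      Nat.card G * (p * (p - 1) * Nat.card K * Nat.card H) := by
  simp only [pow_two]
  rw [sum_mul_indSum _ _ (fun y g => indSum_conj _ y g)]
  congr 1
  have a1 := R2a hp hm H K φ hφ hf S c h
  have a2 := R2b hm (Kg H K) (Zg H K z) c
  rw [a1] at a2
  have a3 : ∑ g, (Nat.card H * (((p : k) - 1) * ∑ r : (ZMod (p ^ m))ˣ, c (pw r g))) * ((wf p (Kg H K) (Zg H K z) g : ℚ) : k) =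
    ∑ g, (Nat.card (ZMod (p ^ m))ˣ * φ.character 1 * ((indSum (wf p (Kg H K) (Zg H K z)) g : ℚ) : k)) * ((wf p (Kg H K) (Zg H K z) g : ℚ) : k) :=
    Finset.sum_congr rfl fun g _ => by rw [R1 hp hm H K φ hφ hf S c h]
  simp only [mul_assoc] at a3
  simp only [← Finset.mul_sum] at a3
  rw [a2] at a3
  have c1 : (Nat.card (ZMod (p ^ m))ˣ : k) ≠ 0 := by exact_mod_cast Nat.card_pos.ne'
  have a4 := hφ.char_one_ne
  have : ((∑ g, indSum (wf p (Kg H K) (Zg H K z)) g * wf p (Kg H K) (Zg H K z) g : ℚ) : k) =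
      ((p * (p - 1) * Nat.card K * Nat.card H : ℚ) : k) := by
    push_cast
    refine mul_left_cancel₀ a4 (mul_left_cancel₀ c1 ?_)
    rw [← a3]
    ring
  exact_mod_cast this

theorem hW_lem {k : Type} [Field k] [CharZero k] {p m : ℕ} (hp : p.Prime) [NeZero (p ^ m)] {G : Type} [Group G] [Fintype G]
    (hm : Nat.card G = p ^ m) (H : Subgroup G) (K : Subgroup H) [K.Normal]
    (φ : FDRep k (H ⧸ K)) (hφ : IsIrr φ) (hf : IsFaithfulRep φ) {A : Subgroup (H ⧸ K)} {z : H ⧸ K} (S : RS p (H ⧸ K) A z)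
    (H' : Subgroup G) (K' : Subgroup H') [K'.Normal]
    (φ' : FDRep k (H' ⧸ K')) (hφ' : IsIrr φ') (hf' : IsFaithfulRep φ') {A' : Subgroup (H' ⧸ K')} {z' : H' ⧸ K'} (S' : RS p (H' ⧸ K') A' z')
    (c : G → k) (h : TightIndSub H K c φ.character) (h' : TightIndSub H' K' c φ'.character) (g : G) :
    indSum (wf p (Kg H K) (Zg H K z)) g = indSum (wf p (Kg H' K') (Zg H' K' z')) g := by
  have a := R1 hp hm H K φ hφ hf S c h
  have a' := R1 hp hm H' K' φ' hφ' hf' S' c h'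
  have a1 := a 1
  have a1' := a' 1
  have ag := a g
  have ag' := a' g
  rw [indSum_wf_one] at a1 a1'
  have c1 : (Nat.card (ZMod (p ^ m))ˣ : k) ≠ 0 := by exact_mod_cast Nat.card_pos.ne'
  have c2 : (Nat.card H : k) ≠ 0 := by exact_mod_cast Nat.card_pos.ne'
  have c2' : (Nat.card H' : k) ≠ 0 := by exact_mod_cast Nat.card_pos.ne'
  have c3 : (Nat.card G : k) ≠ 0 := by exact_mod_cast Nat.card_pos.ne'
  have d := hφ.char_one_ne
  have d' := hφ'.char_one_ne
  have c4 : (p : k) - 1 ≠ 0 := by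
    rw [sub_ne_zero]; exact_mod_cast hp.one_lt.ne'
  push_cast at a1 a1'
  set R : k := (Nat.card (ZMod (p ^ m))ˣ : k)
  set E1 := ∑ r : (ZMod (p ^ m))ˣ, c (pw r 1)
  set Eg := ∑ r : (ZMod (p ^ m))ˣ, c (pw r g)
  have b : (Nat.card H : k) * E1 = R * φ.character 1 * Nat.card G := by
    apply mul_right_cancel₀ c4; linear_combination a1
  have b' : (Nat.card H' : k) * E1 = R * φ'.character 1 * Nat.card G := by
    apply mul_right_cancel₀ c4; linear_combination a1'
  have hE : E1 ≠ 0 := by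
    intro h0
    rw [h0, mul_zero] at b
    exact mul_ne_zero (mul_ne_zero c1 d) c3 b.symm
  have q : ((indSum (wf p (Kg H K) (Zg H K z)) g : ℚ) : k) * E1 = Nat.card G * ((p - 1) * Eg) := by
    apply mul_left_cancel₀ c2
    linear_combination ((indSum (wf p (Kg H K) (Zg H K z)) g : ℚ) : k) * b - Nat.card G * ag
  have q' : ((indSum (wf p (Kg H' K') (Zg H' K' z')) g : ℚ) : k) * E1 = Nat.card G * ((p - 1) * Eg) := by
    apply mul_left_cancel₀ c2'
    linear_combination ((indSum (wf p (Kg H' K') (Zg H' K' z')) g : ℚ) : k) * b' - Nat.card G * ag'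
  have := mul_right_cancel₀ hE (q.trans q'.symm)
  exact_mod_cast this

theorem main_nontriv {k : Type} [Field k] [CharZero k] {p m : ℕ} (hp : p.Prime) {G : Type} [Group G] [Fintype G]
    (hG : IsPGroup p G)
    (hm : Nat.card G = p ^ m) (H : Subgroup G) (K : Subgroup H) [K.Normal]
    (φ : FDRep k (H ⧸ K)) (hφ : IsIrr φ) (hf : IsFaithfulRep φ) {A : Subgroup (H ⧸ K)} {z : H ⧸ K} (S : RS p (H ⧸ K) A z)
    (H' : Subgroup G) (K' : Subgroup H') [K'.Normal]
    (φ' : FDRep k (H' ⧸ K')) (hφ' : IsIrr φ') (hf' : IsFaithfulRep φ') {A' : Subgroup (H' ⧸ K')} {z' : H' ⧸ K'} (S' : RS p (H' ⧸ K') A' z')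
    (c : G → k) (h : TightIndSub H K c φ.character) (h' : TightIndSub H' K' c φ'.character) :
    Nat.card H = Nat.card H' ∧ Nat.card K = Nat.card K' ∧ H.index ≤ Nat.card K := by
  have : NeZero (p ^ m) := ⟨(pow_pos hp.pos m).ne'⟩
  have s := hS_lem hp hm H K φ hφ hf S c h
  have s' := hS_lem hp hm H' K' φ' hφ' hf' S' c h'
  have w := hW_lem hp hm H K φ hφ hf S H' K' φ' hφ' hf' S' c h h'
  have eP : Nat.card (H ⧸ K) = Nat.card (H' ⧸ K') := by
    rcases lt_trichotomy (Nat.card (H ⧸ K)) (Nat.card (H' ⧸ K')) with hl | hl | hl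
    · exact (counting_lt p hp hG H K H' K' S S' w s s' hl).elim
    · exact hl
    · exact (counting_lt p hp hG H' K' H K S' S (fun g => (w g).symm) s' s hl).elim
  have e1 := s
  simp only [w] at e1
  rw [s'] at e1
  have c3 : (Nat.card G : ℚ) ≠ 0 := by exact_mod_cast Nat.card_pos.ne'
  have c4 : (p : ℚ) * (p - 1) ≠ 0 := mul_ne_zero (by exact_mod_cast hp.ne_zero) (by
    rw [sub_ne_zero]; exact_mod_cast hp.one_lt.ne')
  have e2 := mul_left_cancel₀ c3 e1
  rw [mul_assoc, mul_assoc _ (Nat.card K : ℚ)] at e2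
  have e3 := mul_left_cancel₀ c4 e2
  have e4 : Nat.card K' * Nat.card H' = Nat.card K * Nat.card H := by exact_mod_cast e3
  have f := Subgroup.card_eq_card_quotient_mul_card_subgroup K
  have f' := Subgroup.card_eq_card_quotient_mul_card_subgroup K'
  rw [← eP] at f'
  have eK : Nat.card K = Nat.card K' := by
    rw [f, f'] at e4
    have e5 : Nat.card (H ⧸ K) * (Nat.card K' * Nat.card K') = Nat.card (H ⧸ K) * (Nat.card K * Nat.card K) := by
      linarith
    have := Nat.eq_of_mul_eq_mul_left Nat.card_pos e5
    exact (Nat.mul_self_inj.1 this).symm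
  exact ⟨by rw [f, f', eK], eK, bound p hp hG H K S s⟩

end Genotype

namespace Genotype

theorem trivA {k : Type} [Field k] [CharZero k] {G : Type} [Group G] [Fintype G] (ψ : FDRep k G) (hψ : IsIrr ψ)
    (H : Subgroup G) (K : Subgroup H) [K.Normal] [Subsingleton (H ⧸ K)]
    (φ : FDRep k (H ⧸ K)) (hφ : IsIrr φ) (h : TightIndSub H K ψ.character φ.character) (g : G) : ψ.character g = 1 := by
  have hT : IsIrr (FDRep.of (V := k) (1 : Representation k G k)) := by
    refine ⟨inferInstanceAs (Nontrivial k), fun U _ => ?_⟩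
    exact eq_bot_or_eq_top (α := Submodule k k) U
  have hTc : ∀ g, (FDRep.of (V := k) (1 : Representation k G k)).character g = 1 := fun g => by
    change LinearMap.trace k k (1 : k →ₗ[k] k) = 1
    rw [LinearMap.trace_one, Module.finrank_self, Nat.cast_one]
  rw [schur_char ψ _ hψ hT ?_, hTc]
  simp only [hTc, mul_one]
  intro h0
  have h1 : ∑ g, Nat.card H * ψ.character g = 0 := by rw [← Finset.mul_sum, h0, mul_zero]
  simp only [ind_eq H K φ _ h] at h1
  have h2 := sum_mul_indSum (R := k) (fun _ : G => (1:k)) (f0 H K φ) (fun _ _ => rfl)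
  unfold indSum at h2
  simp only [one_mul] at h2
  rw [h1] at h2
  have h3 : ∀ g, f0 H K φ g = if g ∈ H then φ.character 1 else 0 := fun g => by
    unfold f0
    split_ifs with hg
    · rw [Subsingleton.elim ((⟨g, hg⟩ : H) : H ⧸ K) 1]
    · rfl
  simp only [h3, sum_const_mem] at h2
  have c2 : (Nat.card H : k) ≠ 0 := by exact_mod_cast Nat.card_pos.ne'
  have c3 : (Nat.card G : k) ≠ 0 := by exact_mod_cast Nat.card_pos.ne'
  exact mul_ne_zero c3 (mul_ne_zero c2 hφ.char_one_ne) h2.symm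

theorem trivB {k : Type} [Field k] [CharZero k] {G : Type} [Group G] [Fintype G] (c : G → k) (hc : ∀ g, c g = 1)
    (H : Subgroup G) (K : Subgroup H) [K.Normal]
    (φ : FDRep k (H ⧸ K)) (hφ : IsIrr φ) (h : TightIndSub H K c φ.character) : H = ⊤ ∧ ∀ q, φ.character q = 1 := by
  have h1 := ind_eq H K φ c h 1
  have e : ∀ x : G, f0 H K φ (x⁻¹ * 1 * x) = φ.character 1 := fun x => by
    have : x⁻¹ * 1 * x = 1 := by group
    rw [this]
    unfold f0
    rw [dif_pos H.one_mem]
    rfl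
  simp only [e, hc] at h1
  rw [mul_one] at h1
  rw [Finset.sum_const, nsmul_eq_mul, Finset.card_univ, ← Nat.card_eq_fintype_card] at h1
  have d := hφ.char_one_ne
  have hD : φ.character 1 = (Module.finrank k φ : k) := FDRep.char_one φ
  rw [hD] at h1 d
  have h2 : Nat.card H = Nat.card G * Module.finrank k φ := by exact_mod_cast h1
  have hpos : 0 < Module.finrank k φ := Nat.pos_of_ne_zero (by exact_mod_cast d)
  have hle : Nat.card H ≤ Nat.card G := Subgroup.card_le_card_group H
  have hHG : Nat.card H = Nat.card G := le_antisymm hle (by rw [h2]; exact Nat.le_mul_of_pos_right _ hpos)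
  have hH : H = ⊤ := Subgroup.eq_top_of_card_eq H hHG
  refine ⟨hH, fun q => ?_⟩
  obtain ⟨y, rfl⟩ := QuotientGroup.mk_surjective q
  have h3 := ind_eq H K φ c h y
  have e : ∀ x : G, f0 H K φ (x⁻¹ * y * x) = φ.character (y : H ⧸ K) := fun x => by
    have hx : ∀ x : G, x ∈ H := fun x => by rw [hH]; trivial
    unfold f0
    rw [dif_pos (hx _)]
    have := FDRep.char_conj φ (y : H ⧸ K) ((⟨x⁻¹, hx _⟩ : H) : H ⧸ K)
    rw [← this]
    congr 1
    rw [← QuotientGroup.mk_mul, ← QuotientGroup.mk_inv, ← QuotientGroup.mk_mul]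
    congr 1
    ext
    simp
  simp only [e, hc, mul_one] at h3
  rw [Finset.sum_const, nsmul_eq_mul, Finset.card_univ, ← Nat.card_eq_fintype_card, hHG] at h3
  have c3 : (Nat.card G : k) ≠ 0 := by exact_mod_cast Nat.card_pos.ne'
  refine (mul_left_cancel₀ c3 ?_).symm
  rw [mul_one]; exact h3

theorem trivC {k : Type} [Field k] [CharZero k] {p : ℕ} {P : Type} [Group P] [Fintype P] (φ : FDRep k P)
    (hφ : IsIrr φ) (hf : IsFaithfulRep φ) {A : Subgroup P} {z : P} (S : RS p P A z) (h : ∀ q, φ.character q = 1) : False := by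
  have h1 := avg0 φ (Subgroup.zpowers z) (eM_zero φ hφ hf z S.z1 S.zc) 1
  simp only [h, sum_const_mem, mul_one] at h1
  exact Nat.card_pos.ne' (show Nat.card (Subgroup.zpowers z) = 0 by exact_mod_cast h1)

theorem trivD {k : Type} [Field k] [CharZero k] {p : ℕ} (hp : p.Prime) {G : Type} [Group G] [Fintype G] (hG : IsPGroup p G)
    (c : G → k) (hc : ∀ g, c g = 1)
    (H : Subgroup G) (K : Subgroup H) [K.Normal] (hR : IsRoquette (H ⧸ K))
    (φ : FDRep k (H ⧸ K)) (hφ : IsIrr φ) (hf : IsFaithfulRep φ) (h : TightIndSub H K c φ.character) :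
    Nat.card H = Nat.card G ∧ Nat.card K = Nat.card G ∧ H.index = 1 := by
  obtain ⟨hH, hq⟩ := trivB c hc H K φ hφ h
  have hs : Subsingleton (H ⧸ K) := by
    by_contra hn
    rw [not_subsingleton_iff_nontrivial] at hn
    obtain ⟨A, z, S⟩ := exists_RS p hp ((hG.to_subgroup H).to_quotient K) hR
    exact trivC φ hφ hf S hq
  have h1 : Nat.card H = Nat.card G := by rw [hH]; exact Subgroup.card_top
  refine ⟨h1, ?_, by rw [hH]; exact Subgroup.index_top⟩
  have := Subgroup.card_eq_card_quotient_mul_card_subgroup K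
  rw [Nat.card_unique (α := H ⧸ K), one_mul] at this
  rw [← this, h1]

end Genotype


namespace Genotype

/-- Let `H/K` and `H'/K'` be genetic subquotients for the same `𝕂G`-irrep `ψ` (i.e.
Roquette subquotients from faithful irreps of which `ψ` is tightly induced). Then
`|H| = |H'|`, `|K| = |K'|`, and `|G : H| ≤ |K|`. -/
theorem genetic_subquotient_orders (p : ℕ) (hp : p.Prime)
    (G : Type) [Group G] [Fintype G] (hG : IsPGroup p G)
    (k : Type) [Field k] [CharZero k] (ψ : FDRep k G) (hψ : IsIrr ψ)
    (H : Subgroup G) (K : Subgroup H) [K.Normal]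
    (H' : Subgroup G) (K' : Subgroup H') [K'.Normal]
    (hR : IsRoquette (H ⧸ K)) (hR' : IsRoquette (H' ⧸ K'))
    (hgen : ∃ φ : FDRep k (H ⧸ K), IsIrr φ ∧ IsFaithfulRep φ ∧
        TightIndSub H K ψ.character φ.character)
    (hgen' : ∃ φ' : FDRep k (H' ⧸ K'), IsIrr φ' ∧ IsFaithfulRep φ' ∧
        TightIndSub H' K' ψ.character φ'.character) :
    Nat.card H = Nat.card H' ∧ Nat.card K = Nat.card K' ∧ H.index ≤ Nat.card K := by
  obtain ⟨φ, hφ, hf, ht⟩ := hgen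
  obtain ⟨φ', hφ', hf', ht'⟩ := hgen'
  have triv : (∀ g, ψ.character g = 1) →
      Nat.card H = Nat.card H' ∧ Nat.card K = Nat.card K' ∧ H.index ≤ Nat.card K := by
    intro hc
    obtain ⟨a, b, c⟩ := trivD hp hG _ hc H K hR φ hφ hf ht
    obtain ⟨a', b', c'⟩ := trivD hp hG _ hc H' K' hR' φ' hφ' hf' ht'
    exact ⟨a.trans a'.symm, b.trans b'.symm, by rw [c]; exact Nat.card_pos⟩
  rcases subsingleton_or_nontrivial (H ⧸ K) with hs | hn
  · exact triv (trivA ψ hψ H K φ hφ ht)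
  rcases subsingleton_or_nontrivial (H' ⧸ K') with hs' | hn'
  · exact triv (trivA ψ hψ H' K' φ' hφ' ht')
  obtain ⟨A, z, S⟩ := exists_RS p hp ((hG.to_subgroup H).to_quotient K) hR
  obtain ⟨A', z', S'⟩ := exists_RS p hp ((hG.to_subgroup H').to_quotient K') hR'
  have := Fact.mk hp
  obtain ⟨m, hm⟩ := IsPGroup.iff_card.1 hG
  exact main_nontriv hp hG hm H K φ hφ hf S H' K' φ' hφ' hf' S' _ ht ht'

end Genotype
end
end

section
/- (tom Dieck injectivity) Let G be a finite p-group, let ψ_1, ..., ψ_r be pairwise non-Galois-conjugate irreducible complex representations of G, and let a_1, ..., a_r be integers such that Σ_{j=1}^{r} a_j · dim_ℂ(ψ_j^H) = 0 for every subgroup H ≤ G, where ψ_j^H denotes the subspace of H-fixed vectors of ψ_j. Then a_j = 0 for all j. -/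
open scoped Classical

noncomputable section

namespace Genotype

/-- The subspace of `H`-fixed vectors of a complex representation `V` of `G`. -/
def fixedSubspace {G : Type} [Group G] (V : FDRep ℂ G) (H : Subgroup G) :
    Submodule ℂ V :=
  ⨅ h : H, LinearMap.ker (V.ρ (h : G) - LinearMap.id)

open Cardinal in
theorem td_extend (K : Type) [Field K] (hK : #K ≤ ℵ₀) (f g : K →+* ℂ) :
    ∃ s : ℂ ≃+* ℂ, ∀ x, s (f x) = g x := by
  have key : ∀ (A B : Type) [Field A] [Field B] [IsAlgClosed A] [IsAlgClosed B]
      [Algebra K A] [Algebra K B], ℵ₀ < #A → ℵ₀ < #B → #A = #B →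
      ∃ s : A ≃+* B, ∀ x, s (algebraMap K A x) = algebraMap K B x := by
    intro A B _ _ _ _ _ _ hA hB hAB
    obtain ⟨s, hs⟩ := exists_isTranscendenceBasis K A
    obtain ⟨t, ht⟩ := exists_isTranscendenceBasis K B
    have h1 := IsAlgClosed.cardinal_eq_cardinal_transcendence_basis_of_aleph0_lt' _ hs hK hA
    have h2 := IsAlgClosed.cardinal_eq_cardinal_transcendence_basis_of_aleph0_lt' _ ht hK hB
    obtain ⟨e⟩ := Cardinal.eq.1 (h1.symm.trans (hAB.trans h2))
    letI := IsAlgClosed.isAlgClosure_of_transcendence_basis _ hs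
    letI := IsAlgClosed.isAlgClosure_of_transcendence_basis _ ht
    let E := (hs.1.aevalEquiv.symm.trans (MvPolynomial.renameEquiv K e)).trans ht.1.aevalEquiv
    refine ⟨IsAlgClosure.equivOfEquiv A B E.toRingEquiv, fun x => ?_⟩
    have := IsAlgClosure.equivOfEquiv_algebraMap A B E.toRingEquiv (algebraMap K _ x)
    rw [← IsScalarTower.algebraMap_apply] at this
    rw [this]
    have h3 : E.toRingEquiv (algebraMap K _ x) = algebraMap K _ x := E.commutes x
    rw [h3, ← IsScalarTower.algebraMap_apply]
  have hC : ℵ₀ < #ℂ := by rw [Cardinal.mk_complex]; exact Cardinal.aleph0_lt_continuum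
  exact @key ℂ ℂ _ _ _ _ f.toAlgebra g.toAlgebra hC hC rfl

theorem td_galois (n : ℕ) [NeZero n] (k : ℕ) (hk : k.Coprime n) :
    ∃ s : ℂ ≃+* ℂ, ∀ z : ℂ, z ^ n = 1 → s z = z ^ k := by
  haveI : NeZero ((n : ℕ) : ℚ) := ⟨by exact_mod_cast NeZero.ne n⟩
  haveI : IsCyclotomicExtension {n} ℚ (CyclotomicField n ℚ) := CyclotomicField.isCyclotomicExtension n ℚ
  have hz := IsCyclotomicExtension.zeta_spec n ℚ (CyclotomicField n ℚ)
  have hirr := Polynomial.cyclotomic.irreducible_rat (NeZero.pos n)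
  have hw : IsPrimitiveRoot (Complex.exp (2 * Real.pi * Complex.I / n)) n :=
    Complex.isPrimitiveRoot_exp n (NeZero.ne n)
  set w := Complex.exp (2 * Real.pi * Complex.I / n)
  let E := hz.embeddingsEquivPrimitiveRoots ℂ hirr
  let f := E.symm ⟨w, (mem_primitiveRoots (NeZero.pos n)).2 hw⟩
  let g := E.symm ⟨w ^ k, (mem_primitiveRoots (NeZero.pos n)).2 (hw.pow_of_coprime k hk)⟩
  have hf : f (IsCyclotomicExtension.zeta n ℚ (CyclotomicField n ℚ)) = w := by
    rw [← hz.embeddingsEquivPrimitiveRoots_apply_coe ℂ hirr f]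
    simp [f, E]
  have hg : g (IsCyclotomicExtension.zeta n ℚ (CyclotomicField n ℚ)) = w ^ k := by
    rw [← hz.embeddingsEquivPrimitiveRoots_apply_coe ℂ hirr g]
    simp [g, E]
  have hc : Cardinal.mk (CyclotomicField n ℚ) ≤ Cardinal.aleph0 := by
    simpa using Algebra.IsAlgebraic.cardinalMk_le_max ℚ (CyclotomicField n ℚ)
  obtain ⟨s, hs⟩ := td_extend _ hc f.toRingHom g.toRingHom
  refine ⟨s, fun z h => ?_⟩
  obtain ⟨i, -, rfl⟩ := hw.eq_pow_of_pow_eq_one h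
  have h2 : s w = w ^ k := by
    rw [← hg]; conv_lhs => rw [← hf]
    exact hs _
  rw [map_pow, h2, ← pow_mul, ← pow_mul, mul_comm]

theorem td_trace {V : Type} [AddCommGroup V] [Module ℂ V] [FiniteDimensional ℂ V]
    (A : Module.End ℂ V) (n : ℕ) [NeZero n] (hA : A ^ n = 1) :
    ∃ (ι : Type) (_ : Fintype ι) (m : ι → ℂ), (∀ i, m i ^ n = 1) ∧
      ∀ k : ℕ, LinearMap.trace ℂ V (A ^ k) = ∑ i, m i ^ k := by
  classical
  have hss : A.IsSemisimple := by
    refine Module.End.isSemisimple_of_squarefree_aeval_eq_zero (p := Polynomial.X ^ n - 1) ?_ ?_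
    · exact (Polynomial.separable_X_pow_sub_C (1 : ℂ) (by exact_mod_cast NeZero.ne n) one_ne_zero).squarefree
    · simp [hA]
  have hint : DirectSum.IsInternal (fun μ : ℂ => A.eigenspace μ) := by
    rw [DirectSum.isInternal_submodule_iff_iSupIndep_and_iSup_eq_top]
    exact ⟨A.eigenspaces_iSupIndep, hss.iSup_eigenspace_eq_top⟩
  let b := hint.collectedBasis (fun μ => Module.finBasis ℂ (A.eigenspace μ))
  haveI : Fintype (Σ μ : ℂ, Fin (Module.finrank ℂ (A.eigenspace μ))) := 
    FiniteDimensional.fintypeBasisIndex b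
  have hb : ∀ i k, (A ^ k) (b i) = i.1 ^ k • b i := by
    intro i k
    have : b i ∈ A.eigenspace i.1 := hint.collectedBasis_mem _ i
    have h1 := Module.End.mem_eigenspace_iff.1 this
    induction k with
    | zero => simp
    | succ k ih => rw [pow_succ, Module.End.mul_apply, h1, map_smul, ih, smul_smul, pow_succ, mul_comm]
  refine ⟨Σ μ : ℂ, Fin (Module.finrank ℂ (A.eigenspace μ)), inferInstance, fun i => i.1, fun i => ?_, fun k => ?_⟩
  · have := hb i n
    rw [hA, Module.End.one_apply] at this
    have h2 : (1 - i.1 ^ n) • b i = 0 := by rw [sub_smul, one_smul, ← this, sub_self]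
    rcases smul_eq_zero.1 h2 with h | h
    · exact (sub_eq_zero.1 h).symm
    · exact absurd h (b.ne_zero i)
  · rw [LinearMap.trace_eq_matrix_trace ℂ b, Matrix.trace]
    refine Finset.sum_congr rfl fun i _ => ?_
    rw [Matrix.diag_apply, LinearMap.toMatrix_apply, hb]
    simp

theorem td_irr {G : Type} [Group G] [Fintype G] (V : FDRep ℂ G) (hV : IsIrr V) :
    CategoryTheory.Simple V := by
  rw [FDRep.simple_iff_char_is_norm_one]
  have := invertibleOfNonzero (NeZero.ne (Nat.card G : ℂ))
  haveI : Representation.IsIrreducible V.ρ := by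
    haveI := hV.1
    refine { exists_pair_ne := ⟨⊥, ⊤, fun h => ?_⟩, eq_bot_or_eq_top := fun U => ?_ }
    · have h1 : (⊥ : Submodule ℂ V) = ⊤ := congrArg Subrepresentation.toSubmodule h
      exact bot_ne_top h1
    · rcases hV.2 U.toSubmodule (fun g x hx => U.apply_mem_toSubmodule g hx) with h | h
      · exact Or.inl (Subrepresentation.toSubmodule_injective h)
      · exact Or.inr (Subrepresentation.toSubmodule_injective h)
  have h := Representation.char_orthonormal V.ρ V.ρ
  rw [if_pos ⟨Representation.Equiv.refl _⟩] at h
  have hne : (Nat.card G : ℂ) ≠ 0 := NeZero.ne _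
  rw [inv_mul_eq_iff_eq_mul₀ hne, mul_one] at h
  exact h

theorem td_twist {G : Type} [Group G] [Fintype G] (V : FDRep ℂ G) (s : ℂ ≃+* ℂ) :
    ∃ W : FDRep ℂ G, ∀ g, W.character g = s (V.character g) := by
  let b := Module.finBasis ℂ V
  let ρ : G →* ((Fin (Module.finrank ℂ V) → ℂ) →ₗ[ℂ] (Fin (Module.finrank ℂ V) → ℂ)) :=
    ((Matrix.toLinAlgEquiv' : _ ≃ₐ[ℂ] _).toRingEquiv.toRingHom.toMonoidHom.comp
      (RingHom.mapMatrix (s : ℂ →+* ℂ)).toMonoidHom).comp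
      ((LinearMap.toMatrixAlgEquiv b).toRingEquiv.toRingHom.toMonoidHom.comp V.ρ)
  refine ⟨FDRep.of ρ, fun g => ?_⟩
  have h1 : (FDRep.of ρ).character g = LinearMap.trace ℂ _ (ρ g) := rfl
  have h2 : ρ g = Matrix.toLin' ((LinearMap.toMatrix b b (V.ρ g)).map s) := rfl
  have h3 : V.character g = LinearMap.trace ℂ _ (V.ρ g) := rfl
  rw [h1, h2, Matrix.trace_toLin'_eq, h3, LinearMap.trace_eq_matrix_trace ℂ b]
  exact (AddMonoidHom.map_trace (s : ℂ →+* ℂ).toAddMonoidHom _).symm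

theorem td_twist_simple {G : Type} [Group G] [Fintype G] (V W : FDRep ℂ G) (s : ℂ ≃+* ℂ)
    (hW : ∀ g, W.character g = s (V.character g)) (hV : CategoryTheory.Simple V) :
    CategoryTheory.Simple W := by
  rw [FDRep.simple_iff_char_is_norm_one] at *
  simp_rw [hW, ← map_mul, ← map_sum, hV, map_natCast]

theorem td_fixed {G : Type} [Group G] [Fintype G] (V : FDRep ℂ G) (H : Subgroup G) :
    ∑ h : H, V.character h = Nat.card H * (Module.finrank ℂ (fixedSubspace V H) : ℂ) := by
  have := invertibleOfNonzero (NeZero.ne (Nat.card H : ℂ))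
  have h := Representation.card_inv_mul_sum_char_eq_finrank (V.ρ.comp H.subtype : Representation ℂ H V)
  have hne : (Nat.card H : ℂ) ≠ 0 := NeZero.ne _
  rw [inv_mul_eq_iff_eq_mul₀ hne] at h
  have e : fixedSubspace V H = Representation.invariants (V.ρ.comp H.subtype : Representation ℂ H V) := by
    ext v
    simp [fixedSubspace, Representation.mem_invariants, sub_eq_zero]
  rw [e]
  exact h

theorem td_conj {G : Type} (f f' : G → ℂ) (hf : ∀ g, IsAlgebraic ℚ (f g))
    (hf' : ∀ g, IsAlgebraic ℚ (f' g)) (s : ℂ ≃+* ℂ) (h : ∀ g, s (f g) = f' g) :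
    IsGaloisConj f f' := by
  have hle : ∀ f : G → ℂ, (∀ g, IsAlgebraic ℚ (f g)) →
      charField f ≤ (algebraicClosure ℚ ℂ).toSubfield := by
    intro f hf
    refine Subfield.closure_le.2 ?_
    rintro _ ⟨g, rfl⟩
    exact (mem_algebraicClosure_iff).2 (hf g)
  let σ : ℂ ≃ₐ[ℚ] ℂ := AlgEquiv.ofRingEquiv (f := s) (fun x => by simp)
  haveI : Normal ℚ (algebraicClosure ℚ ℂ) := by
    haveI : IsAlgClosure ℚ (algebraicClosure ℚ ℂ) := algebraicClosure.isAlgClosure ℚ ℂ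
    exact IsAlgClosure.normal ℚ _
  refine ⟨algebraicClosure ℚ ℂ, inferInstance, inferInstance, IsGalois.mk,
    Subfield.inclusion (hle f hf), Subfield.inclusion (hle f' hf'),
    (σ.restrictNormal (algebraicClosure ℚ ℂ)).toRingEquiv, fun g => ?_⟩
  apply Subtype.ext
  have := σ.restrictNormal_commutes (algebraicClosure ℚ ℂ) (Subfield.inclusion (hle f hf) ⟨f g, mem_charField f g⟩)
  exact this.trans (h g)

theorem td_comb {G : Type} [Group G] [Fintype G] (F : G → ℂ)
    (hF : ∀ H : Subgroup G, ∑ x : H, F x = 0)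
    (hk : ∀ k : ℕ, k.Coprime (Nat.card G) → ∀ g, F (g ^ k) = F g) : ∀ g, F g = 0 := by
  suffices H : ∀ m (g : G), orderOf g = m → F g = 0 from fun g => H _ g rfl
  intro m
  induction m using Nat.strong_induction_on with
  | _ m ih =>
  intro g hg
  have h1 := hF (Subgroup.zpowers g)
  have h2 : ∀ x : Subgroup.zpowers g, F x = if orderOf (x : G) = m then F g else 0 := by
    rintro ⟨x, hx⟩
    have hdvd : orderOf x ∣ m := hg ▸ orderOf_dvd_of_mem_zpowers hx
    have hm : 0 < m := hg ▸ orderOf_pos g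
    split_ifs with hxm
    · simp only at hxm ⊢
      obtain ⟨i, rfl⟩ := (mem_powers_iff_mem_zpowers.2 hx)
      simp only at hxm ⊢
      have hcop : i.Coprime m := by
        have := orderOf_pow g (n := i)
        rw [hg] at this
        rw [hxm] at this
        have h5 : m.gcd i = 1 := by
          have h6 := Nat.gcd_dvd_left m i
          have h7 : m / m.gcd i * m.gcd i = m := Nat.div_mul_cancel h6
          rw [← this] at h7
          exact Nat.eq_of_mul_eq_mul_left hm (by omega)
        rw [Nat.coprime_comm]; exact h5
      have hmn : m ∣ Nat.card G := hg ▸ orderOf_dvd_natCard g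
      obtain ⟨u, hu⟩ := ZMod.unitsMap_surjective hmn (ZMod.unitOfCoprime i hcop)
      have hu' : ((u : ZMod (Nat.card G)).val : ZMod m) = (i : ZMod m) := by
        have := congrArg (fun v : (ZMod m)ˣ => (v : ZMod m)) hu
        simp only [ZMod.unitsMap_def, Units.coe_map, ZMod.coe_unitOfCoprime] at this
        rw [← this]
        simp [ZMod.natCast_val]
      have h8 : g ^ i = g ^ (u : ZMod (Nat.card G)).val := by
        rw [pow_eq_pow_iff_modEq, hg]
        exact ((ZMod.natCast_eq_natCast_iff _ _ _).1 hu').symm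
      rw [h8]
      exact hk _ (ZMod.val_coe_unit_coprime u) g
    · exact ih _ (lt_of_le_of_ne (Nat.le_of_dvd hm hdvd) hxm) x rfl
  simp_rw [h2] at h1
  rw [← Finset.sum_filter, Finset.sum_const, nsmul_eq_mul, mul_eq_zero] at h1
  rcases h1 with h1 | h1
  · exfalso
    have h3 : (⟨g, Subgroup.mem_zpowers g⟩ : Subgroup.zpowers g) ∈
      Finset.univ.filter (fun x : Subgroup.zpowers g => orderOf (x : G) = m) := by
        simp only [Finset.mem_filter, Finset.mem_univ, true_and]; exact hg
    rw [Nat.cast_eq_zero, Finset.card_eq_zero] at h1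
    rw [h1] at h3
    simp at h3
  · exact h1

theorem td_char {G : Type} [Group G] [Fintype G] (V : FDRep ℂ G) (g : G) :
    ∃ (ι : Type) (_ : Fintype ι) (m : ι → ℂ), (∀ i, m i ^ (Nat.card G) = 1) ∧
      ∀ k : ℕ, V.character (g ^ k) = ∑ i, m i ^ k := by
  haveI : NeZero (Nat.card G) := ⟨Nat.card_pos.ne'⟩
  obtain ⟨ι, hι, m, hm, h⟩ := td_trace (V.ρ g) (Nat.card G) (by rw [← map_pow, pow_card_eq_one', map_one])
  refine ⟨ι, hι, m, hm, fun k => ?_⟩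
  rw [← h, ← map_pow]
  rfl

theorem td_char_alg {G : Type} [Group G] [Fintype G] (V : FDRep ℂ G) (g : G) :
    IsAlgebraic ℚ (V.character g) := by
  obtain ⟨ι, hι, m, hm, h⟩ := td_char V g
  have h1 := h 1
  simp only [pow_one] at h1
  rw [h1]
  refine IsIntegral.isAlgebraic (IsIntegral.sum _ fun i _ => ?_)
  refine (IsIntegral.of_pow (n := Nat.card G) Nat.card_pos ?_)
  rw [hm]
  exact isIntegral_one

theorem td_char_galois {G : Type} [Group G] [Fintype G] (k : ℕ) (hk : k.Coprime (Nat.card G)) :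
    ∃ s : ℂ ≃+* ℂ, ∀ (V : FDRep ℂ G) (g : G), s (V.character g) = V.character (g ^ k) := by
  haveI : NeZero (Nat.card G) := ⟨Nat.card_pos.ne'⟩
  obtain ⟨s, hs⟩ := td_galois (Nat.card G) k hk
  refine ⟨s, fun V g => ?_⟩
  obtain ⟨ι, hι, m, hm, h⟩ := td_char V g
  have h1 := h 1
  simp only [pow_one] at h1
  rw [h1, h, map_sum]
  exact Finset.sum_congr rfl fun i _ => hs _ (hm i)

theorem td_inner {G : Type} [Group G] [Fintype G] (k : ℕ) (hk : k.Coprime (Nat.card G))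
    (V W : FDRep ℂ G) (hV : IsIrr V) (hW : IsIrr W) :
    (∑ g : G, V.character (g ^ k) * W.character g⁻¹ = Nat.card G ∧
      IsGaloisConj V.character W.character) ∨
    ∑ g : G, V.character (g ^ k) * W.character g⁻¹ = 0 := by
  obtain ⟨s, hs⟩ := td_char_galois (G := G) k hk
  obtain ⟨V', hV'⟩ := td_twist V s
  haveI := td_twist_simple V V' s hV' (td_irr V hV)
  haveI := td_irr W hW
  have := invertibleOfNonzero (NeZero.ne (Nat.card G : ℂ))
  have h := FDRep.char_orthonormal V' W
  have hne : (Nat.card G : ℂ) ≠ 0 := NeZero.ne _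
  rw [inv_mul_eq_iff_eq_mul₀ hne] at h
  simp_rw [hV', hs] at h
  rw [h]
  split_ifs with hi
  · left
    refine ⟨by simp, ?_⟩
    obtain ⟨e⟩ := hi
    refine td_conj _ _ (td_char_alg V) (td_char_alg W) s fun g => ?_
    rw [← hV', FDRep.char_iso e]
  · right; simp

theorem td_units {G : Type} [Group G] [Fintype G] (f : G → ℂ)
    (hf : ∀ H : Subgroup G, ∑ x : H, f x = 0) (g : G) :
    haveI : NeZero (Nat.card G) := ⟨Nat.card_pos.ne'⟩
    ∑ u : (ZMod (Nat.card G))ˣ, f (g ^ (u : ZMod (Nat.card G)).val) = 0 := by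
  haveI : NeZero (Nat.card G) := ⟨Nat.card_pos.ne'⟩
  refine td_comb (fun g => ∑ u : (ZMod (Nat.card G))ˣ, f (g ^ (u : ZMod (Nat.card G)).val)) ?_ ?_ g
  · intro H
    rw [Finset.sum_comm]
    refine Finset.sum_eq_zero fun u _ => ?_
    have hc : (Nat.card H).Coprime (u : ZMod (Nat.card G)).val :=
      ((ZMod.val_coe_unit_coprime u).coprime_dvd_right (Subgroup.card_subgroup_dvd_card H)).symm
    rw [← hf H]
    exact Fintype.sum_equiv (powCoprime hc) _ _ (fun x => by simp)
  · intro k hk g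
    refine Fintype.sum_equiv (Equiv.mulLeft (ZMod.unitOfCoprime k hk)) _ _ fun u => ?_
    congr 1
    rw [← pow_mul, pow_eq_pow_iff_modEq]
    refine Nat.ModEq.of_dvd (orderOf_dvd_natCard g) ?_
    rw [← ZMod.natCast_eq_natCast_iff]
    simp

/-- **tom Dieck injectivity.** Let `G` be a finite `p`-group, `ψ_1, ..., ψ_r` pairwise
non-Galois-conjugate irreducible complex representations of `G`, and `a_1, ..., a_r`
integers with `Σ_j a_j · dim_ℂ (ψ_j^H) = 0` for every subgroup `H ≤ G`. Then all
`a_j = 0`. -/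
theorem tom_dieck_injectivity (p : ℕ) (hp : p.Prime)
    (G : Type) [Group G] [Fintype G] (hG : IsPGroup p G)
    (r : ℕ) (ψs : Fin r → FDRep ℂ G) (hirr : ∀ j, IsIrr (ψs j))
    (hnc : ∀ i j, i ≠ j → ¬ IsGaloisConj (ψs i).character (ψs j).character)
    (a : Fin r → ℤ)
    (h : ∀ H : Subgroup G,
      ∑ j, a j * (Module.finrank ℂ (fixedSubspace (ψs j) H) : ℤ) = 0) :
    ∀ j, a j = 0 := by
  intro i
  haveI : NeZero (Nat.card G) := ⟨Nat.card_pos.ne'⟩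
  have hne : (Nat.card G : ℂ) ≠ 0 := NeZero.ne _
  have hf := td_units (fun g => ∑ j, (a j : ℂ) * (ψs j).character g) (by
    intro H
    rw [Finset.sum_comm]
    simp_rw [← Finset.mul_sum, td_fixed]
    have := congrArg (fun z : ℤ => (Nat.card H : ℂ) * (z : ℂ)) (h H)
    simp only [Int.cast_sum, Int.cast_mul, Int.cast_natCast, Int.cast_zero, mul_zero,
      Finset.mul_sum] at this
    rw [← this]
    exact Finset.sum_congr rfl fun j _ => by ring)
  let c : (ZMod (Nat.card G))ˣ → Fin r → ℂ := fun u j =>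
    ∑ g : G, (ψs j).character (g ^ (u : ZMod (Nat.card G)).val) * (ψs i).character g⁻¹
  have h0 : ∑ j, (a j : ℂ) * ∑ u, c u j = 0 := by
    have : ∑ g : G, (∑ u : (ZMod (Nat.card G))ˣ, ∑ j, (a j : ℂ) *
        (ψs j).character (g ^ (u : ZMod (Nat.card G)).val)) * (ψs i).character g⁻¹ = 0 :=
      Finset.sum_eq_zero fun g _ => by rw [hf g, zero_mul]
    rw [← this]
    simp only [c, Finset.mul_sum, Finset.sum_mul]
    rw [Finset.sum_comm' (t' := Finset.univ) (s' := fun _ => Finset.univ) (by simp)]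
    rw [Finset.sum_comm (γ := G)]
    refine Finset.sum_congr rfl fun u _ => ?_
    rw [Finset.sum_comm]
    exact Finset.sum_congr rfl fun g _ => Finset.sum_congr rfl fun j _ => by ring
  have hcop : ∀ u : (ZMod (Nat.card G))ˣ, ((u : ZMod (Nat.card G)).val).Coprime (Nat.card G) :=
    fun u => ZMod.val_coe_unit_coprime u
  rw [Finset.sum_eq_single i] at h0
  rotate_left
  · intro j _ hj
    rw [Finset.sum_eq_zero, mul_zero]
    intro u _
    rcases td_inner _ (hcop u) (ψs j) (ψs i) (hirr j) (hirr i) with h1 | h1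
    · exact absurd h1.2 (hnc j i hj)
    · exact h1
  · simp
  rcases mul_eq_zero.1 h0 with h1 | h1
  · exact_mod_cast h1
  exfalso
  have h2 : ∀ u, c u i = if c u i = 0 then 0 else (Nat.card G : ℂ) := by
    intro u
    split_ifs with h3
    · exact h3
    · rcases td_inner _ (hcop u) (ψs i) (ψs i) (hirr i) (hirr i) with h1 | h1
      · exact h1.1
      · exact absurd h1 h3
  have h4 : c 1 i = Nat.card G := by
    have h5 := (FDRep.simple_iff_char_is_norm_one (ψs i)).1 (td_irr _ (hirr i))
    rw [← h5]
    refine Finset.sum_congr rfl fun g _ => ?_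
    have : g ^ ((1 : (ZMod (Nat.card G))ˣ) : ZMod (Nat.card G)).val = g := by
      conv_rhs => rw [← pow_one g]
      rw [pow_eq_pow_iff_modEq]
      refine Nat.ModEq.of_dvd (orderOf_dvd_natCard g) ?_
      rw [← ZMod.natCast_eq_natCast_iff]
      simp
    rw [this]
  have h6 : ∑ u, c u i = ∑ u, if c u i = 0 then 0 else (Nat.card G : ℂ) :=
    Finset.sum_congr rfl fun u _ => h2 u
  rw [h6, Finset.sum_ite, Finset.sum_const_zero, zero_add, Finset.sum_const, nsmul_eq_mul,
    mul_eq_zero] at h1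
  rcases h1 with h1 | h1
  · rw [Nat.cast_eq_zero, Finset.card_eq_zero] at h1
    have h7 : (1 : (ZMod (Nat.card G))ˣ) ∈
        Finset.univ.filter (fun u : (ZMod (Nat.card G))ˣ => ¬ c u i = 0) := by
      simp only [Finset.mem_filter, Finset.mem_univ, true_and, h4]
      exact hne
    rw [h1] at h7
    simp at h7
  · exact hne h1

end Genotype
end
end
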